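/- arXiv:math/0301293 — 2 statements merged into one kernel-verified Lean document; each statement's English description precedes it below -/
import Mathlib

section
/- Let the integers k, p, m and n satisfy k + m + 1 ≤ (p − k)·n. Then for any σ-perfect map f : X → Y between metrizable spaces with dim f ≤ k and dim Y ≤ m, the space C*(X, ℝ^p) with the source limitation topology contains a dense G_δ-subset of maps g such that |(f×g)⁻¹(z)| ≤ n for every z ∈ Y × ℝ^p. -/
open Set Topology Metric BoundedContinuousFunction

noncomputable section

/-- Covering dimension at most `n` (for a natural number `n`): every finite open cover
has an open refinement covering the space such that every point belongs to at most
`n + 1` members of the refinement. -/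
def CovDimLENat (X : Type*) [TopologicalSpace X] (n : ℕ) : Prop :=
  ∀ 𝒰 : Set (Set X), 𝒰.Finite → (∀ U ∈ 𝒰, IsOpen U) → ⋃₀ 𝒰 = Set.univ →
    ∃ 𝒱 : Set (Set X), (∀ V ∈ 𝒱, IsOpen V) ∧ ⋃₀ 𝒱 = Set.univ ∧
      (∀ V ∈ 𝒱, ∃ U ∈ 𝒰, V ⊆ U) ∧
      ∀ x : X, {V ∈ 𝒱 | x ∈ V}.Finite ∧ {V ∈ 𝒱 | x ∈ V}.ncard ≤ n + 1

/-- Covering dimension at most `n` for an integer `n`; negative bounds mean the space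
is empty (`dim ∅ = -1`). -/
def CovDimLE (X : Type*) [TopologicalSpace X] (n : ℤ) : Prop :=
  IsEmpty X ∨ ∃ k : ℕ, (k : ℤ) ≤ n ∧ CovDimLENat X k

/-- A space is finite-dimensional if its covering dimension is at most `n` for some `n`. -/
def FiniteDimSpace (X : Type*) [TopologicalSpace X] : Prop :=
  ∃ n : ℕ, CovDimLENat X n

/-- A perfect map: continuous, closed, with compact fibers. -/
def IsPerfectMap {X Y : Type*} [TopologicalSpace X] [TopologicalSpace Y] (f : X → Y) : Prop :=
  Continuous f ∧ IsClosedMap f ∧ ∀ y : Y, IsCompact (f ⁻¹' {y})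

/-- A σ-perfect map: `X` is a countable union of closed sets `A i` whose images are
closed and on which `f` restricts to a perfect map onto its image. -/
def IsSigmaPerfectMap {X Y : Type*} [TopologicalSpace X] [TopologicalSpace Y] (f : X → Y) :
    Prop :=
  Continuous f ∧ ∃ A : ℕ → Set X, (⋃ i, A i) = Set.univ ∧
    ∀ i, IsClosed (A i) ∧ IsClosed (f '' A i) ∧
      IsPerfectMap (Set.MapsTo.restrict f (A i) (f '' A i) (Set.mapsTo_image f (A i)))

/-- `dim f ≤ k`: every fiber of `f` has covering dimension at most `k`. -/
def DimMapLE {X Y : Type*} [TopologicalSpace X] [TopologicalSpace Y] (f : X → Y) (k : ℤ) :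
    Prop :=
  ∀ y : Y, CovDimLE (f ⁻¹' {y}) k

/-- `B_n(h)`: the set of points of the codomain having at least `n` preimages. -/
def BranchSet {X Z : Type*} (h : X → Z) (n : ℕ) : Set Z :=
  {z | ∃ S : Finset X, n ≤ S.card ∧ ∀ x ∈ S, h x = z}

/-- The source limitation topology on the space of bounded continuous maps. -/
def sourceLimitation (X E : Type*) [TopologicalSpace X] [PseudoMetricSpace E] :
    TopologicalSpace (X →ᵇ E) where
  IsOpen U := ∀ g ∈ U, ∃ α : X → ℝ, Continuous α ∧ (∀ x, 0 < α x) ∧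
    ∀ h : X →ᵇ E, (∀ x, dist (h x) (g x) ≤ α x) → h ∈ U
  isOpen_univ := fun g _ =>
    ⟨fun _ => 1, continuous_const, fun _ => one_pos, fun _ _ => trivial⟩
  isOpen_inter := by
    rintro U V hU hV g ⟨hgU, hgV⟩
    obtain ⟨α, hαc, hαp, hα⟩ := hU g hgU
    obtain ⟨β, hβc, hβp, hβ⟩ := hV g hgV
    exact ⟨fun x => min (α x) (β x), hαc.min hβc, fun x => lt_min (hαp x) (hβp x),
      fun h hh => ⟨hα h fun x => (hh x).trans (min_le_left _ _),
        hβ h fun x => (hh x).trans (min_le_right _ _)⟩⟩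
  isOpen_sUnion := by
    rintro S hS g ⟨U, hU, hgU⟩
    obtain ⟨α, hc, hp, h⟩ := hS U hU g hgU
    exact ⟨α, hc, hp, fun h' hh' => ⟨U, hU, h h' hh'⟩⟩

/-- A C-space. -/
def IsCSpace (Y : Type*) [TopologicalSpace Y] : Prop :=
  ∀ 𝒰 : ℕ → Set (Set Y), (∀ n, (∀ U ∈ 𝒰 n, IsOpen U) ∧ ⋃₀ 𝒰 n = Set.univ) →
    ∃ 𝒱 : ℕ → Set (Set Y),
      (∀ n, (∀ V ∈ 𝒱 n, IsOpen V) ∧ (∀ V ∈ 𝒱 n, ∃ U ∈ 𝒰 n, V ⊆ U) ∧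
        (𝒱 n).Pairwise (Disjoint · ·)) ∧
      ⋃₀ (⋃ n, 𝒱 n) = Set.univ

/-- `F` is a `Z_m`-set in `M`: `F` is closed and the maps from the `m`-cube avoiding `F`
are dense in `C(𝕀^m, M)` (uniform convergence topology). -/
def IsZmSet (m : ℕ) {M : Type*} [TopologicalSpace M] (F : Set M) : Prop :=
  IsClosed F ∧ Dense {u : C((Fin m → unitInterval), M) | ∀ z, u z ∉ F}

/-- `F` is a `Z`-set in `M` if it is a `Z_m`-set for all `m`. -/
def IsZSet {M : Type*} [TopologicalSpace M] (F : Set M) : Prop :=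
  ∀ m : ℕ, IsZmSet m F

end

/-- finite shrinking -/
theorem aux_finite_shrink {Y : Type*} [TopologicalSpace Y] {m : ℕ} (hY : CovDimLENat Y m)
    {ι : Type*} [Finite ι] (u : ι → Set Y) (uo : ∀ i, IsOpen (u i)) (uc : ⋃ i, u i = univ) :
    ∃ v : ι → Set Y, (∀ i, IsOpen (v i)) ∧ (∀ i, v i ⊆ u i) ∧ ⋃ i, v i = univ ∧
      ∀ y, {i | y ∈ v i}.Finite ∧ {i | y ∈ v i}.ncard ≤ m + 1 := by
  classical
  obtain ⟨𝒱, h1, h2, h3, h4⟩ := hY (range u) (finite_range u)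
    (by rintro _ ⟨i, rfl⟩; exact uo i) (by rw [sUnion_range]; exact uc)
  have h3' : ∀ V : 𝒱, ∃ i, V.1 ⊆ u i := by
    intro V
    obtain ⟨_, ⟨i, rfl⟩, h⟩ := h3 V.1 V.2
    exact ⟨i, h⟩
  choose c hc using h3'
  refine ⟨fun i => ⋃ V : 𝒱, ⋃ _ : c V = i, V.1, ?_, ?_, ?_, ?_⟩
  · intro i
    exact isOpen_iUnion fun V => isOpen_iUnion fun _ => h1 V.1 V.2
  · intro i
    refine iUnion_subset fun V => iUnion_subset fun h => ?_
    rw [← h]; exact hc V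
  · refine eq_univ_of_forall fun y => ?_
    have : y ∈ ⋃₀ 𝒱 := by rw [h2]; trivial
    obtain ⟨V, hV, hy⟩ := this
    simp only [mem_iUnion]
    exact ⟨c ⟨V, hV⟩, ⟨V, hV⟩, rfl, hy⟩
  · intro y
    refine ⟨toFinite _, ?_⟩
    have hsub : {i | y ∈ ⋃ V : 𝒱, ⋃ _ : c V = i, V.1} ⊆
        (fun V => if h : V ∈ 𝒱 then c ⟨V, h⟩ else Classical.choice (by
          have : y ∈ ⋃ i, u i := by rw [uc]; trivial
          obtain ⟨i, _⟩ := mem_iUnion.1 this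
          exact ⟨i⟩)) '' {V ∈ 𝒱 | y ∈ V} := by
      intro i hi
      simp only [mem_ofPred_eq, mem_iUnion] at hi
      obtain ⟨V, hV, hy⟩ := hi
      exact ⟨V.1, ⟨V.2, hy⟩, by simp [hV]⟩
    exact (ncard_le_ncard hsub ((h4 y).1.image _)).trans
      ((ncard_image_le (h4 y).1).trans (h4 y).2)

theorem aux_covdim_mono {Y : Type*} [TopologicalSpace Y] {k m : ℕ} (h : k ≤ m)
    (hY : CovDimLENat Y k) : CovDimLENat Y m := by
  intro 𝒰 h1 h2 h3
  obtain ⟨𝒱, a, b, c, d⟩ := hY 𝒰 h1 h2 h3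
  exact ⟨𝒱, a, b, c, fun x => ⟨(d x).1, (d x).2.trans (by omega)⟩⟩

theorem aux_step_shrink {Y : Type*} [TopologicalSpace Y] {m : ℕ} (hY : CovDimLENat Y m)
    {I : Type*} (T : Finset I) (W : I → Set Y) (Wo : ∀ i, IsOpen (W i)) (Wc : ⋃ i, W i = univ) :
    ∃ V : I → Set Y, (∀ i, IsOpen (V i)) ∧ (∀ i, V i ⊆ W i) ∧ (⋃ i, V i = univ) ∧
      (∀ i, i ∉ T → V i = W i) ∧ ∀ y, {i | i ∈ T ∧ y ∈ V i}.ncard ≤ m + 1 := by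
  classical
  obtain ⟨v, vo, vs, vc, vn⟩ := aux_finite_shrink hY
    (fun i : Option T => match i with
      | none => ⋃ i, ⋃ _ : i ∉ T, W i
      | some i => W i.1)
    (by
      rintro (_ | i)
      · exact isOpen_iUnion fun i => isOpen_iUnion fun _ => Wo i
      · exact Wo _)
    (by
      refine eq_univ_of_forall fun y => ?_
      have : y ∈ ⋃ i, W i := by rw [Wc]; trivial
      obtain ⟨i, hi⟩ := mem_iUnion.1 this
      by_cases h : i ∈ T
      · exact mem_iUnion.2 ⟨some ⟨i, h⟩, hi⟩
      · refine mem_iUnion.2 ⟨none, ?_⟩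
        simp only [mem_iUnion]
        exact ⟨i, h, hi⟩)
  refine ⟨fun i => if h : i ∈ T then v (some ⟨i, h⟩) else W i, ?_, ?_, ?_, ?_, ?_⟩
  · intro i
    dsimp only
    split_ifs with h
    · exact vo _
    · exact Wo _
  · intro i
    dsimp only
    split_ifs with h
    · exact vs (some ⟨i, h⟩)
    · exact subset_rfl
  · refine eq_univ_of_forall fun y => ?_
    have : y ∈ ⋃ i, v i := by rw [vc]; trivial
    obtain ⟨i, hi⟩ := mem_iUnion.1 this
    rcases i with _ | i
    · have := vs none hi
      simp only [mem_iUnion] at this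
      obtain ⟨j, hj, hy⟩ := this
      refine mem_iUnion.2 ⟨j, ?_⟩
      rw [dif_neg hj]; exact hy
    · refine mem_iUnion.2 ⟨i.1, ?_⟩
      rw [dif_pos i.2]; exact hi
  · intro i hi
    exact dif_neg hi
  · intro y
    refine le_trans ?_ (vn y).2
    have hf := (vn y).1
    rw [← ncard_image_of_injective (s := {i | i ∈ T ∧ y ∈ if h : i ∈ T then v (some ⟨i, h⟩) else W i})
      (Option.some_injective I), ← ncard_image_of_injective (s := {i | y ∈ v i})
      (Option.map_injective (Subtype.val_injective (p := (· ∈ T))))]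
    refine ncard_le_ncard ?_ (hf.image _)
    rintro _ ⟨i, ⟨hi, hy⟩, rfl⟩
    rw [dif_pos hi] at hy
    exact ⟨some ⟨i, hi⟩, hy, rfl⟩

theorem aux_iter_shrink {Y : Type*} [TopologicalSpace Y] {m : ℕ} (hY : CovDimLENat Y m)
    {I : Type*} (T : ℕ → Finset I) (W : I → Set Y) (Wo : ∀ i, IsOpen (W i))
    (Wc : ⋃ i, W i = univ) (hT : ∀ i, ∃ N, ∀ n, N ≤ n → i ∉ T n)
    (hW : ∀ y, ∃ n, ∀ i, y ∈ W i → i ∈ T n) :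
    ∃ V : I → Set Y, (∀ i, IsOpen (V i)) ∧ (∀ i, V i ⊆ W i) ∧ (⋃ i, V i = univ) ∧
      ∀ y, {i | y ∈ V i}.Finite ∧ {i | y ∈ V i}.ncard ≤ m + 1 := by
  classical
  let S := {W : I → Set Y // (∀ i, IsOpen (W i)) ∧ (⋃ i, W i = univ)}
  have step : ∀ (n : ℕ) (W : S), ∃ V : S, (∀ i, V.1 i ⊆ W.1 i) ∧
      (∀ i, i ∉ T n → V.1 i = W.1 i) ∧ ∀ y, {i | i ∈ T n ∧ y ∈ V.1 i}.ncard ≤ m + 1 := by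
    intro n W
    obtain ⟨V, a, b, c, d, e⟩ := aux_step_shrink hY (T n) W.1 W.2.1 W.2.2
    exact ⟨⟨V, a, c⟩, b, d, e⟩
  choose F hF1 hF2 hF3 using step
  let U : ℕ → S := fun n => Nat.rec ⟨W, Wo, Wc⟩ (fun n V => F n V) n
  have hUs : ∀ n, U (n + 1) = F n (U n) := fun n => rfl
  have hanti : ∀ i, Antitone fun n => (U n).1 i := by
    intro i
    refine antitone_nat_of_succ_le fun n => ?_
    rw [hUs]; exact hF1 n (U n) i
  choose N hN using hT
  have hconst : ∀ i n, N i ≤ n → (U n).1 i = (U (N i)).1 i := by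
    intro i n hn
    induction n, hn using Nat.le_induction with
    | base => rfl
    | succ n hn ih => rw [hUs, hF2 n (U n) i (hN i n hn), ih]
  have hle : ∀ i n, (U (N i)).1 i ⊆ (U n).1 i := by
    intro i n
    rcases le_total (N i) n with h | h
    · rw [hconst i n h]
    · exact hanti i h
  have hfin : ∀ y, {i | y ∈ W i}.Finite := by
    intro y
    obtain ⟨n, hn⟩ := hW y
    exact (T n).finite_toSet.subset hn
  refine ⟨fun i => (U (N i)).1 i, fun i => (U (N i)).2.1 i, fun i => hle i 0, ?_, ?_⟩
  · refine eq_univ_of_forall fun y => ?_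
    obtain ⟨M, hM⟩ := ((hfin y).image N).bddAbove
    have : y ∈ ⋃ i, (U M).1 i := by rw [(U M).2.2]; trivial
    obtain ⟨i, hi⟩ := mem_iUnion.1 this
    refine mem_iUnion.2 ⟨i, ?_⟩
    rw [← hconst i M (hM ⟨i, hanti i (Nat.zero_le M) hi, rfl⟩)]
    exact hi
  · intro y
    refine ⟨(hfin y).subset fun i hi => hle i 0 hi, ?_⟩
    obtain ⟨n, hn⟩ := hW y
    refine le_trans (ncard_le_ncard ?_ ?_) (hF3 n (U n) y)
    · intro i hi
      exact ⟨hn i (hle i 0 hi), hle i (n + 1) hi⟩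
    · exact (T n).finite_toSet.subset fun i hi => hi.1

theorem aux_countable_shrink {Y : Type*} [TopologicalSpace Y] [T2Space Y] [ParacompactSpace Y]
    {m : ℕ} (hY : CovDimLENat Y m) (O : ℕ → Set Y) (Oo : ∀ i, IsOpen (O i))
    (Oc : ⋃ i, O i = univ) :
    ∃ V : ℕ → Set Y, (∀ i, IsOpen (V i)) ∧ (∀ i, V i ⊆ O i) ∧ (⋃ i, V i = univ) ∧
      ∀ y, {i | y ∈ V i}.Finite ∧ {i | y ∈ V i}.ncard ≤ m + 1 := by
  classical
  obtain ⟨θ, hθ⟩ := exists_continuous_forall_mem_convex_of_local_const (X := Y) (E := ℝ)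
    (t := fun y => {r | ∃ l : ℕ, (l : ℝ) ≤ r ∧ y ∈ O l})
    (by
      intro y
      refine OrdConnected.convex ⟨?_⟩
      rintro a ⟨l, hl, hy⟩ b _ c hc
      exact ⟨l, hl.trans hc.1, hy⟩)
    (by
      intro y
      have : y ∈ ⋃ i, O i := by rw [Oc]; trivial
      obtain ⟨l, hl⟩ := mem_iUnion.1 this
      refine ⟨l, ?_⟩
      filter_upwards [(Oo l).mem_nhds hl] with z hz
      exact ⟨l, le_rfl, hz⟩)
  have hθ0 : ∀ y, 0 ≤ θ y := by
    intro y
    obtain ⟨l, hl, _⟩ := hθ y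
    exact (Nat.cast_nonneg l).trans hl
  obtain ⟨V, Vo, Vs, Vc, Vn⟩ := aux_iter_shrink hY
    (fun n => ({n, n + 1} : Finset ℕ) ×ˢ Finset.range (n + 3))
    (fun i : ℕ × ℕ => if i.2 < i.1 + 2 then
      {y | (i.1 : ℝ) - 1 < θ y ∧ θ y < i.1 + 1} ∩ O i.2 else ∅)
    (by
      intro i
      split_ifs
      · refine IsOpen.inter ?_ (Oo _)
        exact (isOpen_lt continuous_const θ.continuous).inter
          (isOpen_lt θ.continuous continuous_const)
      · exact isOpen_empty)
    (by
      refine eq_univ_of_forall fun y => ?_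
      obtain ⟨l, hl, hy⟩ := hθ y
      refine mem_iUnion.2 ⟨(⌊θ y⌋₊, l), ?_⟩
      have h1 := Nat.le_floor hl
      have h2 := Nat.floor_le (hθ0 y)
      have h3 := Nat.lt_floor_add_one (θ y)
      dsimp only
      rw [if_pos (by omega)]
      exact ⟨⟨by linarith, h3⟩, hy⟩)
    (by
      intro i
      refine ⟨i.1 + 1, fun n hn h => ?_⟩
      simp only [Finset.mem_product, Finset.mem_insert, Finset.mem_singleton] at h
      omega)
    (by
      intro y
      refine ⟨⌊θ y⌋₊, fun i hi => ?_⟩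
      have h2 := Nat.floor_le (hθ0 y)
      have h3 := Nat.lt_floor_add_one (θ y)
      split_ifs at hi with h
      · obtain ⟨⟨h4, h5⟩, _⟩ := hi
        have h6 : (i.1 : ℝ) < ⌊θ y⌋₊ + 2 := by linarith
        have h7 : (⌊θ y⌋₊ : ℝ) < i.1 + 1 := by linarith
        have h6' : i.1 < ⌊θ y⌋₊ + 2 := by exact_mod_cast h6
        have h7' : ⌊θ y⌋₊ < i.1 + 1 := by exact_mod_cast h7
        simp only [Finset.mem_product, Finset.mem_insert, Finset.mem_singleton, Finset.mem_range]
        omega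
      · exact absurd hi (by simp))
  refine ⟨fun l => ⋃ j, V (j, l), fun l => isOpen_iUnion fun j => Vo _, ?_, ?_, ?_⟩
  · intro l
    refine iUnion_subset fun j => (Vs _).trans ?_
    dsimp only
    split_ifs
    · exact inter_subset_right
    · exact empty_subset _
  · refine eq_univ_of_forall fun y => ?_
    have : y ∈ ⋃ i, V i := by rw [Vc]; trivial
    obtain ⟨⟨j, l⟩, hi⟩ := mem_iUnion.1 this
    exact mem_iUnion.2 ⟨l, mem_iUnion.2 ⟨j, hi⟩⟩
  · intro y
    have hsub : {l | y ∈ ⋃ j, V (j, l)} ⊆ Prod.snd '' {i | y ∈ V i} := by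
      intro l hl
      obtain ⟨j, hj⟩ := mem_iUnion.1 hl
      exact ⟨(j, l), hj, rfl⟩
    exact ⟨((Vn y).1.image _).subset hsub, (ncard_le_ncard hsub ((Vn y).1.image _)).trans
      ((ncard_image_le (Vn y).1).trans (Vn y).2)⟩

/-- the Dowker theorem. -/
theorem aux_dowker {Y : Type*} [TopologicalSpace Y] [T2Space Y] [ParacompactSpace Y]
    {m : ℕ} (hY : CovDimLENat Y m) {ι : Type*} (u : ι → Set Y) (uo : ∀ i, IsOpen (u i))
    (uc : ⋃ i, u i = univ) :
    ∃ V : ι → Set Y, (∀ i, IsOpen (V i)) ∧ (∀ i, V i ⊆ u i) ∧ (⋃ i, V i = univ) ∧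
      ∀ y, {i | y ∈ V i}.Finite ∧ {i | y ∈ V i}.ncard ≤ m + 1 := by
  classical
  obtain ⟨ρ, hρ⟩ := PartitionOfUnity.exists_isSubordinate (s := (univ : Set Y)) isClosed_univ u uo
    (by rw [uc])
  have hfin : ∀ y, {i | ρ i y ≠ 0}.Finite := fun y => ρ.locallyFinite.point_finite y
  let D : Finset ι → Set Y := fun T => {y | (∀ i ∈ T, 0 < ρ i y) ∧ ∀ i ∈ T, ∀ j, j ∉ T → ρ j y < ρ i y}
  have hDo : ∀ T, IsOpen (D T) := by
    intro T
    rw [isOpen_iff_mem_nhds]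
    rintro y ⟨hy1, hy2⟩
    obtain ⟨N, hN, hNf⟩ := ρ.locallyFinite y
    have h1 : ∀ᶠ z in 𝓝 y, ∀ i ∈ T, 0 < ρ i z := by
      rw [Filter.eventually_all_finset]
      intro i hi
      exact ((ρ i).continuous.tendsto y).eventually (lt_mem_nhds (hy1 i hi))
    have h2 : ∀ᶠ z in 𝓝 y, ∀ i ∈ T, ∀ j ∈ hNf.toFinset, j ∉ T → ρ j z < ρ i z := by
      rw [Filter.eventually_all_finset]
      intro i hi
      rw [Filter.eventually_all_finset]
      intro j hj
      by_cases h : j ∈ T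
      · exact Filter.Eventually.of_forall fun z hz => absurd h hz
      · filter_upwards [((ρ j).continuous.tendsto y).eventually_lt ((ρ i).continuous.tendsto y)
          (hy2 i hi j h)] with z hz _
        exact hz
    filter_upwards [h1, h2, hN] with z hz1 hz2 hz3
    refine ⟨hz1, fun i hi j hj => ?_⟩
    by_cases h : j ∈ hNf.toFinset
    · exact hz2 i hi j h hj
    · have : ρ j z = 0 := by
        by_contra h0
        apply h
        rw [Finite.mem_toFinset]
        exact ⟨z, h0, hz3⟩
      rw [this]; exact hz1 i hi
  have hDd : ∀ T T' : Finset ι, T.card = T'.card → ∀ y, y ∈ D T → y ∈ D T' → T = T' := by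
    intro T T' hc y h1 h2
    by_contra hne
    have a : ¬ T ⊆ T' := fun h => hne (Finset.eq_of_subset_of_card_le h hc.ge)
    have b : ¬ T' ⊆ T := fun h => hne (Finset.eq_of_subset_of_card_le h hc.le).symm
    obtain ⟨i, hi, hi'⟩ := Finset.not_subset.1 a
    obtain ⟨j, hj, hj'⟩ := Finset.not_subset.1 b
    exact lt_asymm (h1.2 i hi j hj') (h2.2 j hj i hi')
  obtain ⟨V, Vo, Vs, Vc, Vn⟩ := aux_countable_shrink hY
    (fun q => ⋃ T : Finset ι, ⋃ _ : T.card = q ∧ T.Nonempty, D T)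
    (fun q => isOpen_iUnion fun T => isOpen_iUnion fun _ => hDo T)
    (by
      refine eq_univ_of_forall fun y => ?_
      refine mem_iUnion.2 ⟨(hfin y).toFinset.card, ?_⟩
      simp only [mem_iUnion]
      refine ⟨(hfin y).toFinset, ⟨rfl, ?_⟩, ?_, ?_⟩
      · by_contra h
        rw [Finset.not_nonempty_iff_eq_empty] at h
        have h1 := ρ.sum_eq_one (mem_univ y)
        have h2 : ∀ i, ρ i y = 0 := by
          intro i
          by_contra h0
          have : i ∈ (hfin y).toFinset := by rw [Finite.mem_toFinset]; exact h0
          rw [h] at this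
          exact absurd this (by simp)
        simp [h2] at h1
      · intro i hi
        rw [Finite.mem_toFinset] at hi
        exact lt_of_le_of_ne (ρ.nonneg i y) (Ne.symm hi)
      · intro i hi j hj
        rw [Finite.mem_toFinset] at hi hj
        have : ρ j y = 0 := not_not.1 hj
        rw [this]
        exact lt_of_le_of_ne (ρ.nonneg i y) (Ne.symm hi))
  refine ⟨fun i => ⋃ T : Finset ι, ⋃ _ : ∃ h : T.Nonempty, h.choose = i, D T ∩ V T.card, ?_, ?_, ?_, ?_⟩
  · intro i
    exact isOpen_iUnion fun T => isOpen_iUnion fun _ => (hDo T).inter (Vo _)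
  · intro i
    refine iUnion_subset fun T => iUnion_subset fun h => ?_
    obtain ⟨hT, rfl⟩ := h
    intro y hy
    have := hy.1.1 _ hT.choose_spec
    exact hρ _ (subset_tsupport _ this.ne')
  · refine eq_univ_of_forall fun y => ?_
    have : y ∈ ⋃ i, V i := by rw [Vc]; trivial
    obtain ⟨q, hq⟩ := mem_iUnion.1 this
    have := Vs q hq
    simp only [mem_iUnion] at this
    obtain ⟨T, ⟨rfl, hT⟩, hy⟩ := this
    simp only [mem_iUnion]
    exact ⟨hT.choose, T, ⟨hT, rfl⟩, hy, hq⟩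
  · intro y
    have hsub : ∃ c : ℕ → ι, {i | y ∈ ⋃ T : Finset ι, ⋃ _ : ∃ h : T.Nonempty, h.choose = i,
        D T ∩ V T.card} ⊆ c '' {q | y ∈ V q} := by
      have hne : Nonempty ι := by
        have : y ∈ ⋃ i, u i := by rw [uc]; trivial
        obtain ⟨i, _⟩ := mem_iUnion.1 this
        exact ⟨i⟩
      have : ∀ q, ∃ i, ∀ T : Finset ι, T.card = q → y ∈ D T → ∀ h : T.Nonempty, h.choose = i := by
        intro q
        by_cases h : ∃ T : Finset ι, T.card = q ∧ y ∈ D T ∧ T.Nonempty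
        · obtain ⟨T, hT, hy, hn⟩ := h
          refine ⟨hn.choose, fun T' hT' hy' hn' => ?_⟩
          have := hDd T' T (hT'.trans hT.symm) y hy' hy
          subst this
          rfl
        · exact ⟨Classical.choice hne, fun T hT hy hn => absurd ⟨T, hT, hy, hn⟩ h⟩
      choose c hc using this
      refine ⟨c, ?_⟩
      intro i hi
      simp only [mem_ofPred_eq, mem_iUnion] at hi
      obtain ⟨T, ⟨hT, hi⟩, hy, hV⟩ := hi
      exact ⟨T.card, hV, by rw [← hc T.card T rfl hy hT, hi]⟩
    obtain ⟨c, hsub⟩ := hsub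
    exact ⟨((Vn y).1.image _).subset hsub, (ncard_le_ncard hsub ((Vn y).1.image _)).trans
      ((ncard_image_le (Vn y).1).trans (Vn y).2)⟩

/-- the simplex with vertex set `A` -/
def auxSimp {Y : Type*} (A : Finset Y) : Set (Y → ℝ) :=
  {t | (∀ i, 0 ≤ t i) ∧ (∀ i, i ∉ A → t i = 0) ∧ ∑ i ∈ A, t i = 1}

theorem auxSimp_closed {Y : Type*} (A : Finset Y) : IsClosed (auxSimp A) := by
  have h1 : IsClosed {t : Y → ℝ | ∀ i, 0 ≤ t i} := by
    have : {t : Y → ℝ | ∀ i, 0 ≤ t i} = ⋂ i, {t | 0 ≤ t i} := by ext; simp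
    rw [this]
    exact isClosed_iInter fun i => isClosed_le continuous_const (continuous_apply i)
  have h2 : IsClosed {t : Y → ℝ | ∀ i, i ∉ A → t i = 0} := by
    have : {t : Y → ℝ | ∀ i, i ∉ A → t i = 0} = ⋂ i, ⋂ (_ : i ∉ A), {t | t i = 0} := by ext; simp
    rw [this]
    exact isClosed_iInter fun i => isClosed_iInter fun _ =>
      isClosed_eq (continuous_apply i) continuous_const
  have h3 : IsClosed {t : Y → ℝ | ∑ i ∈ A, t i = 1} :=
    isClosed_eq (continuous_finsetSum _ fun i _ => continuous_apply i) continuous_const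
  exact h1.inter (h2.inter h3)

theorem auxSimp_le_one {Y : Type*} {A : Finset Y} {t : Y → ℝ} (ht : t ∈ auxSimp A) (i : Y) :
    t i ≤ 1 := by
  by_cases h : i ∈ A
  · rw [← ht.2.2]
    exact Finset.single_le_sum (fun j _ => ht.1 j) h
  · rw [ht.2.1 i h]; exact zero_le_one

theorem auxSimp_compact {Y : Type*} (A : Finset Y) : IsCompact (auxSimp A) := by
  refine (isCompact_univ_pi (fun _ : Y => isCompact_Icc (a := (0 : ℝ)) (b := 1))).of_isClosed_subset
    (auxSimp_closed A) ?_
  intro t ht i _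
  exact ⟨ht.1 i, auxSimp_le_one ht i⟩

theorem auxSimp_mono {Y : Type*} {A B : Finset Y} (h : B ⊆ A) : auxSimp B ⊆ auxSimp A := by
  intro t ht
  refine ⟨ht.1, fun i hi => ht.2.1 i fun hB => hi (h hB), ?_⟩
  rw [← ht.2.2]
  exact (Finset.sum_subset h fun i _ hi => ht.2.1 i hi).symm

theorem auxSimp_of_support {Y : Type*} {A B : Finset Y} {t : Y → ℝ} (ht : t ∈ auxSimp A)
    (h : ∀ i, t i ≠ 0 → i ∈ B) (hBA : B ⊆ A) : t ∈ auxSimp B := by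
  refine ⟨ht.1, fun i hi => by by_contra h0; exact hi (h i h0), ?_⟩
  rw [← ht.2.2]
  exact Finset.sum_subset hBA fun i _ hi => by by_contra h0; exact hi (h i h0)

theorem auxSimp_empty {Y : Type*} {t : Y → ℝ} : t ∉ auxSimp (∅ : Finset Y) := by
  intro h
  have := h.2.2
  simp at this

open Classical in
/-- pushforward -/
noncomputable def auxPush {Y : Type*} (r : Y → Y) (B : Finset Y) (q : Y → ℝ) : Y → ℝ :=
  fun a => ∑ b ∈ B, if r b = a then q b else 0

theorem auxPush_cont {Y : Type*} (r : Y → Y) (B : Finset Y) : Continuous (auxPush r B) := by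
  classical
  refine continuous_pi fun a => continuous_finsetSum _ fun b _ => ?_
  by_cases h : r b = a
  · simp only [h, if_true]; exact continuous_apply b
  · simp only [h, if_false]; exact continuous_const

theorem auxPush_mem {Y : Type*} [DecidableEq Y] (r : Y → Y) (B : Finset Y) {q : Y → ℝ}
    (hq : q ∈ auxSimp B) :
    auxPush r B q ∈ auxSimp (B.image r) := by
  refine ⟨fun a => Finset.sum_nonneg fun b _ => ?_, fun a ha => Finset.sum_eq_zero fun b hb => ?_, ?_⟩
  · split_ifs
    · exact hq.1 b
    · exact le_rfl
  · rw [if_neg]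
    rintro rfl
    exact ha (Finset.mem_image_of_mem r hb)
  · unfold auxPush
    rw [Finset.sum_comm, ← hq.2.2]
    refine Finset.sum_congr rfl fun b hb => ?_
    rw [Finset.sum_eq_single (r b)]
    · rw [if_pos rfl]
    · intro c _ hc
      rw [if_neg (Ne.symm hc)]
    · intro hc
      exact absurd (Finset.mem_image_of_mem r hb) hc

theorem auxPush_subset {Y : Type*} (r : Y → Y) {B B' : Finset Y} {q : Y → ℝ}
    (hq : q ∈ auxSimp B') (h : B' ⊆ B) :
    auxPush r B' q = auxPush r B q := by
  classical
  funext a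
  refine Finset.sum_subset h fun i _ hi => ?_
  rw [hq.2.1 i hi]; simp

open Classical in
/-- support as a finset -/
noncomputable def auxSupp {Y : Type*} (q : Y → ℝ) : Finset Y :=
  if h : (Function.support q).Finite then h.toFinset else ∅

theorem auxSupp_spec {Y : Type*} {B : Finset Y} {q : Y → ℝ} (hq : q ∈ auxSimp B) :
    auxSupp q ⊆ B ∧ q ∈ auxSimp (auxSupp q) := by
  have h0 : Function.support q ⊆ B := by
    intro i hi
    by_contra h
    exact hi (hq.2.1 i h)
  have h1 : (Function.support q).Finite := B.finite_toSet.subset h0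
  have h2 : auxSupp q = h1.toFinset := by unfold auxSupp; rw [dif_pos h1]
  have h3 : auxSupp q ⊆ B := by
    rw [h2]; intro i hi
    exact h0 (h1.mem_toFinset.1 hi)
  refine ⟨h3, auxSimp_of_support hq (fun i hi => ?_) h3⟩
  rw [h2, Finite.mem_toFinset]; exact hi

/-- filling property -/
def AuxFill {Y E : Type*} [TopologicalSpace E] (m : ℕ) (G : Set (Y × E)) : Prop :=
  ∀ y : Y, ∀ A : Finset Y, A.Nonempty → A.card ≤ m + 1 → ∀ Φ : (Y → ℝ) → E,
    (∀ B, B ⊂ A → ContinuousOn Φ (auxSimp B) ∧ ∀ t ∈ auxSimp B, (y, Φ t) ∈ G) →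
    ∃ Ψ : (Y → ℝ) → E, ContinuousOn Ψ (auxSimp A) ∧ (∀ t ∈ auxSimp A, (y, Ψ t) ∈ G) ∧
      ∀ B, B ⊂ A → EqOn Ψ Φ (auxSimp B)

/-- stage property -/
def AuxStage {Y E : Type*} [TopologicalSpace Y] [TopologicalSpace E] (G : Set (Y × E)) (s : ℕ) :
    Prop :=
  ∃ (V : Y → Set Y) (Φ : (Y → ℝ) → E), (∀ y, IsOpen (V y)) ∧ LocallyFinite V ∧
    (⋃ y, V y = univ) ∧ ∀ A : Finset Y, A.card ≤ s → ∀ z, (∀ a ∈ A, z ∈ closure (V a)) →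
      ContinuousOn Φ (auxSimp A) ∧ ∀ t ∈ auxSimp A, (z, Φ t) ∈ G

theorem aux_tube {Y E T : Type*} [TopologicalSpace Y] [TopologicalSpace E] [TopologicalSpace T]
    {G : Set (Y × E)}
    (hG : IsOpen G) {K : Set T} (hK : IsCompact K) {Ψ : T → E} (hΨ : ContinuousOn Ψ K) {y : Y}
    (h : ∀ t ∈ K, (y, Ψ t) ∈ G) : ∀ᶠ z in 𝓝 y, ∀ t ∈ K, (z, Ψ t) ∈ G := by
  have hK' : IsCompact (Ψ '' K) := hK.image_of_continuousOn hΨ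
  obtain ⟨u, v, uo, vo, hu, hv, huv⟩ := generalized_tube_lemma (isCompact_singleton (x := y)) hK' hG
    (by
      rintro ⟨a, b⟩ ⟨ha, ⟨t, ht, rfl⟩⟩
      have ha' : a = y := ha
      subst ha'
      exact h t ht)
  filter_upwards [uo.mem_nhds (hu rfl)] with z hz t ht
  exact huv ⟨hz, hv ⟨t, ht, rfl⟩⟩

theorem aux_stage_succ {Y E : Type*} [TopologicalSpace Y] [TopologicalSpace E] [T2Space Y]
    [ParacompactSpace Y] {m : ℕ} {G : Set (Y × E)} (hG : IsOpen G) (hF : AuxFill m G) {s : ℕ}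
    (hs : s ≤ m) (h : AuxStage G s) : AuxStage G (s + 1) := by
  classical
  obtain ⟨V, Φ, Vo, Vf, Vc, hΦ⟩ := h
  have hr : ∀ y, ∃ a, y ∈ V a := fun y => mem_iUnion.1 (by rw [Vc]; trivial)
  choose r hr using hr
  have hfill : ∀ y, ∀ A : Finset Y, ∃ Ψ : (Y → ℝ) → E, A.card = s + 1 →
      (∀ a ∈ A, y ∈ closure (V a)) →
      ContinuousOn Ψ (auxSimp A) ∧ (∀ t ∈ auxSimp A, (y, Ψ t) ∈ G) ∧
      ∀ B, B ⊂ A → EqOn Ψ Φ (auxSimp B) := by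
    intro y A
    by_cases h : A.card = s + 1 ∧ ∀ a ∈ A, y ∈ closure (V a)
    · obtain ⟨Ψ, hΨ⟩ := hF y A (by rw [← Finset.card_pos]; omega) (by omega) Φ (by
        intro B hB
        have := Finset.card_lt_card hB
        exact hΦ B (by omega) y fun a ha => h.2 a (hB.1 ha))
      exact ⟨Ψ, fun _ _ => hΨ⟩
    · exact ⟨Φ, fun h1 h2 => absurd ⟨h1, h2⟩ h⟩
  choose Ψ hΨ using hfill
  have Vcl : LocallyFinite fun a => closure (V a) := Vf.closure
  have hU : ∀ y, ∃ U : Set Y, IsOpen U ∧ y ∈ U ∧ U ⊆ V (r y) ∧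
      (∀ z ∈ U, ∀ a, z ∈ closure (V a) → y ∈ closure (V a)) ∧
      ∀ z ∈ U, ∀ A : Finset Y, A.card = s + 1 → (∀ a ∈ A, y ∈ closure (V a)) →
        ∀ t ∈ auxSimp A, (z, Ψ y A t) ∈ G := by
    intro y
    have hfin : {a | y ∈ closure (V a)}.Finite := Vcl.point_finite y
    have e1 : ∀ᶠ z in 𝓝 y, ∀ A ∈ hfin.toFinset.powerset, A.card = s + 1 →
        (∀ a ∈ A, y ∈ closure (V a)) → ∀ t ∈ auxSimp A, (z, Ψ y A t) ∈ G := by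
      rw [Filter.eventually_all_finset]
      intro A _
      by_cases h : A.card = s + 1 ∧ ∀ a ∈ A, y ∈ closure (V a)
      · filter_upwards [aux_tube hG (auxSimp_compact A) (hΨ y A h.1 h.2).1 (hΨ y A h.1 h.2).2.1]
          with z hz _ _
        exact hz
      · exact Filter.Eventually.of_forall fun z h1 h2 => absurd ⟨h1, h2⟩ h
    have e2 := Vcl.iInter_compl_mem_nhds (fun a => isClosed_closure) y
    have e3 : V (r y) ∈ 𝓝 y := (Vo _).mem_nhds (hr y)
    obtain ⟨U, hU, Uo, hyU⟩ := mem_nhds_iff.1 (Filter.inter_mem e1 (Filter.inter_mem e2 e3))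
    refine ⟨U, Uo, hyU, fun z hz => (hU hz).2.2, ?_, ?_⟩
    · intro z hz a hza
      by_contra hya
      have := (hU hz).2.1
      simp only [mem_iInter] at this
      exact this a hya hza
    · intro z hz A hA hA'
      refine (hU hz).1 A ?_ hA hA'
      rw [Finset.mem_powerset]
      intro a ha
      rw [Finite.mem_toFinset]
      exact hA' a ha
  choose U Uo hyU hUV hUc hUG using hU
  obtain ⟨v, vo, vc, vf, vs⟩ := precise_refinement U Uo
    (eq_univ_of_forall fun y => mem_iUnion.2 ⟨y, hyU y⟩)
  obtain ⟨w, wc, wo, ws⟩ := exists_iUnion_eq_closure_subset vo vf.point_finite vc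
  let Θ : Finset Y → (Y → ℝ) → E := fun B =>
    if h : B.Nonempty then Ψ h.choose (B.image r) else Φ
  let Φ' : (Y → ℝ) → E := fun q =>
    if (auxSupp q).card = s + 1 ∧ ((auxSupp q).image r).card = s + 1 then
      Θ (auxSupp q) (auxPush r (auxSupp q) q) else Φ (auxPush r (auxSupp q) q)
  have hwv : ∀ i, w i ⊆ v i := fun i => subset_closure.trans (ws i)
  refine ⟨w, Φ', wo, vf.subset hwv, wc, ?_⟩
  intro B hB z hz
  have hzU : ∀ b ∈ B, z ∈ U b := fun b hb => vs b (ws b (hz b hb))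
  have hzV : ∀ a ∈ B.image r, z ∈ closure (V a) := by
    intro a ha
    obtain ⟨b, hb, rfl⟩ := Finset.mem_image.1 ha
    exact subset_closure (hUV b (hzU b hb))
  have hbV : ∀ b ∈ B, ∀ a ∈ B.image r, b ∈ closure (V a) := fun b hb a ha =>
    hUc b z (hzU b hb) a (hzV a ha)
  by_cases hc : (B.image r).card ≤ s
  · have key : EqOn Φ' (fun q => Φ (auxPush r B q)) (auxSimp B) := by
      intro q hq
      obtain ⟨h1, h2⟩ := auxSupp_spec hq
      have h3 : ¬ ((auxSupp q).card = s + 1 ∧ ((auxSupp q).image r).card = s + 1) := by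
        rintro ⟨h4, h5⟩
        have := Finset.card_le_card (Finset.image_subset_image (f := r) h1)
        omega
      change (if _ then _ else _) = _
      rw [if_neg h3, auxPush_subset r h2 h1]
    obtain ⟨c1, c2⟩ := hΦ (B.image r) hc z hzV
    refine ⟨ContinuousOn.congr (c1.comp (auxPush_cont r B).continuousOn
      fun q hq => auxPush_mem r B hq) key, fun q hq => ?_⟩
    rw [key hq]
    exact c2 _ (auxPush_mem r B hq)
  · have hle := Finset.card_image_le (s := B) (f := r)
    have hB1 : B.card = s + 1 := by omega
    have hB2 : (B.image r).card = s + 1 := by omega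
    have hBn : B.Nonempty := by rw [← Finset.card_pos]; omega
    have hΘ : Θ B = Ψ hBn.choose (B.image r) := dif_pos hBn
    obtain ⟨c1, c2, c3⟩ := hΨ hBn.choose (B.image r) hB2 (hbV _ hBn.choose_spec)
    have key : EqOn Φ' (fun q => Ψ hBn.choose (B.image r) (auxPush r B q)) (auxSimp B) := by
      intro q hq
      obtain ⟨h1, h2⟩ := auxSupp_spec hq
      change (if _ then _ else _) = _
      by_cases h3 : auxSupp q = B
      · rw [h3, if_pos ⟨hB1, hB2⟩, hΘ]
      · have h4 : auxSupp q ⊂ B := lt_of_le_of_ne h1 h3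
        have h5 := Finset.card_lt_card h4
        rw [if_neg (by omega)]
        have h6 : (auxSupp q).image r ⊂ B.image r := by
          refine lt_of_le_of_ne (Finset.image_subset_image h1) ?_
          intro h7
          have h8 := Finset.card_image_le (s := auxSupp q) (f := r)
          rw [h7] at h8
          omega
        have := c3 _ h6 (auxPush_mem r _ h2)
        refine this.symm.trans ?_
        rw [auxPush_subset r h2 h1]
    refine ⟨ContinuousOn.congr (c1.comp (auxPush_cont r B).continuousOn
      fun q hq => auxPush_mem r B hq) key, fun q hq => ?_⟩
    rw [key hq]
    exact hUG _ z (hzU _ hBn.choose_spec) _ hB2 (hbV _ hBn.choose_spec) _ (auxPush_mem r B hq)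

theorem aux_stage_zero {Y E : Type*} [TopologicalSpace Y] [TopologicalSpace E] [Nonempty Y]
    [Nonempty E] (G : Set (Y × E)) : AuxStage G 0 := by
  classical
  obtain ⟨y0⟩ := ‹Nonempty Y›
  obtain ⟨e0⟩ := ‹Nonempty E›
  refine ⟨fun y => if y = y0 then univ else ∅, fun _ => e0, ?_, ?_, ?_, ?_⟩
  · intro y
    dsimp only
    split_ifs
    · exact isOpen_univ
    · exact isOpen_empty
  · intro x
    refine ⟨univ, Filter.univ_mem, (finite_singleton y0).subset ?_⟩
    rintro y ⟨z, hz, _⟩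
    by_contra h
    have h' : y ≠ y0 := h
    simp [h'] at hz
  · exact eq_univ_of_forall fun y => mem_iUnion.2 ⟨y0, by simp⟩
  · intro A hA z _
    have : A = ∅ := Finset.card_eq_zero.1 (by omega)
    subst this
    exact ⟨continuousOn_const, fun t ht => absurd ht auxSimp_empty⟩

/-- the selection lemma -/
theorem aux_selection {Y E : Type*} [TopologicalSpace Y] [TopologicalSpace E] [T2Space Y]
    [ParacompactSpace Y] [Nonempty E] {m : ℕ} (hY : CovDimLENat Y m)
    {G : Set (Y × E)} (hG : IsOpen G) (hF : AuxFill m G) :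
    ∃ h : Y → E, Continuous h ∧ ∀ y, (y, h y) ∈ G := by
  classical
  rcases isEmpty_or_nonempty Y with hYe | hYe
  · obtain ⟨e0⟩ := ‹Nonempty E›
    exact ⟨fun _ => e0, continuous_const, fun y => isEmptyElim y⟩
  have hst : ∀ s, s ≤ m + 1 → AuxStage G s := by
    intro s
    induction s with
    | zero => intro _; exact aux_stage_zero G
    | succ s ih => intro hs; exact aux_stage_succ hG hF (by omega) (ih (by omega))
  obtain ⟨V, Φ, Vo, Vf, Vc, hΦ⟩ := hst (m + 1) le_rfl
  obtain ⟨W, Wo, WV, Wc, Wn⟩ := aux_dowker hY V Vo Vc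
  obtain ⟨ρ, hρ⟩ := PartitionOfUnity.exists_isSubordinate (s := (univ : Set Y)) isClosed_univ W Wo
    (by rw [Wc])
  let τ : Y → (Y → ℝ) := fun y i => ρ i y
  have hτ : Continuous τ := continuous_pi fun i => (ρ i).continuous
  have main : ∀ y0, ContinuousAt (fun y => Φ (τ y)) y0 ∧ (y0, Φ (τ y0)) ∈ G := by
    intro y0
    have hTf : {i | y0 ∈ tsupport (ρ i)}.Finite := (Wn y0).1.subset fun i hi => hρ i hi
    have hTc : hTf.toFinset.card ≤ m + 1 := by
      rw [← ncard_eq_toFinset_card _ hTf]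
      exact (ncard_le_ncard (fun i hi => hρ i hi) (Wn y0).1).trans (Wn y0).2
    obtain ⟨c1, c2⟩ := hΦ hTf.toFinset hTc y0 (by
      intro a ha
      rw [Finite.mem_toFinset] at ha
      exact subset_closure (WV a (hρ a ha)))
    have hev : ∀ᶠ y in 𝓝 y0, τ y ∈ auxSimp hTf.toFinset := by
      filter_upwards [ρ.locallyFinite_tsupport.iInter_compl_mem_nhds
        (fun i => isClosed_tsupport _) y0] with y hy
      have hz : ∀ i, i ∉ hTf.toFinset → ρ i y = 0 := by
        intro i hi
        rw [Finite.mem_toFinset] at hi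
        simp only [mem_iInter] at hy
        exact image_eq_zero_of_notMem_tsupport (hy i hi)
      refine ⟨fun i => ρ.nonneg i y, hz, ?_⟩
      have := ρ.sum_eq_one (mem_univ y)
      rw [finsum_eq_sum_of_support_subset (s := hTf.toFinset)] at this
      · exact this
      · intro i hi
        by_contra h
        exact hi (hz i h)
    have h0 : τ y0 ∈ auxSimp hTf.toFinset := hev.self_of_nhds
    refine ⟨?_, c2 _ h0⟩
    exact (c1 _ h0).tendsto.comp (tendsto_nhdsWithin_iff.2 ⟨hτ.continuousAt, hev⟩)
  exact ⟨fun y => Φ (τ y), continuous_iff_continuousAt.2 fun y => (main y).1, fun y => (main y).2⟩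

open Classical in
/-- extension by zero -/
noncomputable def auxExt {ι S E : Type*} [Zero E] (j : S → ι) (c : {i // i ∉ range j} → E) (i : ι) :
    E := if h : i ∉ range j then c ⟨i, h⟩ else 0

open Classical in
/-- the bad parametrization -/
noncomputable def auxBad {ι S P E : Type*} [NormedAddCommGroup E] [NormedSpace ℝ E]
    (γ : ι → P → E) (σ : S → Finset ι) (j : S → ι) :
    (E × P × ((Σ s, {i // i ∈ (σ s).erase (j s)}) → ℝ) × ({i // i ∉ range j} → E)) → ι → E :=
  fun w i => if h : ∃ s, j s = i then
      (1 + ∑ i' : {i // i ∈ (σ h.choose).erase (j h.choose)}, w.2.2.1 ⟨h.choose, i'⟩) • w.1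
        - γ i w.2.1 - ∑ i' : {i // i ∈ (σ h.choose).erase (j h.choose)},
          w.2.2.1 ⟨h.choose, i'⟩ • (γ i' w.2.1 + auxExt j w.2.2.2 i')
    else auxExt j w.2.2.2 i

open Classical in
theorem auxBad_contDiff {ι S P E : Type*} [Fintype ι] [Fintype S] [NormedAddCommGroup E]
    [NormedSpace ℝ E] [NormedAddCommGroup P] [NormedSpace ℝ P]
    (γ : ι → P → E) (hγ : ∀ i, ContDiff ℝ 1 (γ i)) (σ : S → Finset ι) (j : S → ι) :
    ContDiff ℝ 1 (auxBad γ σ j) := by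
  classical
  have hext : ∀ i, ContDiff ℝ 1 (fun w : (E × P × ((Σ s, {i // i ∈ (σ s).erase (j s)}) → ℝ) ×
      ({i // i ∉ range j} → E)) => auxExt j w.2.2.2 i) := by
    intro i
    unfold auxExt
    split_ifs with h
    · exact contDiff_const
    · fun_prop
  have hg : ∀ i, ContDiff ℝ 1 (fun w : (E × P × ((Σ s, {i // i ∈ (σ s).erase (j s)}) → ℝ) ×
      ({i // i ∉ range j} → E)) => γ i w.2.1) := by
    intro i
    exact (hγ i).comp (by fun_prop)
  rw [contDiff_pi]
  intro i
  unfold auxBad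
  split_ifs with h
  · refine ContDiff.sub (ContDiff.sub (ContDiff.smul ?_ (by fun_prop)) (hg i)) ?_
    · refine ContDiff.add contDiff_const (ContDiff.sum fun i' _ => by fun_prop)
    · refine ContDiff.sum fun i' _ => ContDiff.smul (by fun_prop) ((hg _).add (hext _))
  · exact hext i

theorem aux_generic {ι P : Type*} [Fintype ι] [NormedAddCommGroup P] [NormedSpace ℝ P]
    [FiniteDimensional ℝ P] {k n p m : ℕ} (hP : Module.finrank ℝ P ≤ m)
    (hineq : m + (n + 1) * k < n * p) (γ : ι → P → EuclideanSpace ℝ (Fin p))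
    (hγ : ∀ i, ContDiff ℝ 1 (γ i)) {δ : ℝ} (hδ : 0 < δ) :
    ∃ d : ι → EuclideanSpace ℝ (Fin p), (∀ i, ‖d i‖ < δ) ∧
      ∀ (t : P) (z : EuclideanSpace ℝ (Fin p)) (a : Fin (n + 1) → ι → ℝ), (∀ s i, 0 ≤ a s i) →
        (∀ s, ∑ i, a s i = 1) → (∀ s, {i | a s i ≠ 0}.ncard ≤ k + 1) →
        (∀ s s', s ≠ s' → ∀ i, a s i = 0 ∨ a s' i = 0) →
        (∀ s, ∑ i, a s i • (γ i t + d i) = z) → False := by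
  classical
  let Q := {q : (Fin (n + 1) → Finset ι) × (Fin (n + 1) → ι) //
    (∀ s, (q.1 s).card ≤ k + 1 ∧ q.2 s ∈ q.1 s) ∧ Function.Injective q.2}
  have hdim : ∀ q : Q, dimH (range (auxBad γ q.1.1 q.1.2)) ≤
      ((Fintype.card ι * p - 1 : ℕ) : ENNReal) ∧ 0 < Fintype.card ι * p := by
    intro q
    obtain ⟨⟨σ, j⟩, hσ, hj⟩ := q
    dsimp only at hσ hj ⊢
    have h1 : Fintype.card (Σ s, {i // i ∈ (σ s).erase (j s)}) ≤ (n + 1) * k := by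
      rw [Fintype.card_sigma]
      calc _ ≤ ∑ s : Fin (n + 1), k := by
            refine Finset.sum_le_sum fun s _ => ?_
            rw [Fintype.card_coe, Finset.card_erase_of_mem (hσ s).2]
            have := (hσ s).1
            omega
        _ = _ := by simp
    have h2 : Fintype.card {i // i ∉ range j} + (n + 1) = Fintype.card ι := by
      have h3 : Fintype.card {i // i ∈ range j} = n + 1 := by
        have := Fintype.card_congr (Equiv.ofInjective j hj)
        rw [Fintype.card_fin] at this
        exact (Fintype.card_congr (Equiv.refl _)).trans this.symm
      have h4 := Fintype.card_subtype_compl (fun i => i ∈ range j)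
      have h5 := Fintype.card_subtype_le (fun i => i ∈ range j)
      omega
    have h3 : Module.finrank ℝ (EuclideanSpace ℝ (Fin p) × P ×
        ((Σ s, {i // i ∈ (σ s).erase (j s)}) → ℝ) ×
        ({i // i ∉ range j} → EuclideanSpace ℝ (Fin p))) < Fintype.card ι * p := by
      rw [Module.finrank_prod, Module.finrank_prod, Module.finrank_prod, Module.finrank_pi,
        Module.finrank_pi_fintype]
      simp only [finrank_euclideanSpace, Fintype.card_fin, Finset.sum_const, Finset.card_univ,
        smul_eq_mul]
      rw [← h2, add_mul, add_mul]
      omega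
    refine ⟨(auxBad_contDiff γ hγ σ j).dimH_range_le.trans ?_, by omega⟩
    exact_mod_cast Nat.le_sub_one_of_lt h3
  have hd : ∃ d : ι → EuclideanSpace ℝ (Fin p), (∀ i, ‖d i‖ < δ) ∧
      ∀ q : Q, d ∉ range (auxBad γ q.1.1 q.1.2) := by
    rcases isEmpty_or_nonempty Q with hQ | ⟨⟨q0⟩⟩
    · exact ⟨0, fun i => by simpa using hδ, fun q => isEmptyElim q⟩
    · have h0 := (hdim q0).2
      have h1 : dimH (⋃ q : Q, range (auxBad γ q.1.1 q.1.2)) <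
          (Module.finrank ℝ (ι → EuclideanSpace ℝ (Fin p)) : ENNReal) := by
        rw [dimH_iUnion, Module.finrank_pi_fintype]
        simp only [finrank_euclideanSpace, Fintype.card_fin, Finset.sum_const, Finset.card_univ,
          smul_eq_mul]
        refine lt_of_le_of_lt (iSup_le fun q => (hdim q).1) ?_
        exact_mod_cast Nat.sub_lt h0 one_pos
      have h2 := dense_compl_of_dimH_lt_finrank h1
      obtain ⟨d, hd1, hd2⟩ := h2.exists_dist_lt 0 hδ
      refine ⟨d, fun i => ?_, fun q hq => hd1 (mem_iUnion.2 ⟨q, hq⟩)⟩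
      rw [dist_zero_left] at hd2
      exact (norm_le_pi_norm d i).trans_lt hd2
  obtain ⟨d, hd1, hd2⟩ := hd
  refine ⟨d, hd1, ?_⟩
  intro t z a ha hsum hcard hdisj heq
  let σ : Fin (n + 1) → Finset ι := fun s => Finset.univ.filter fun i => a s i ≠ 0
  have hne : ∀ s, ∃ i, a s i ≠ 0 := by
    intro s
    by_contra h
    push Not at h
    have := hsum s
    simp [h] at this
  choose j hj using hne
  have hjσ : ∀ s, j s ∈ σ s := fun s => by simp [σ, hj s]
  have hjinj : Function.Injective j := by
    intro s s' h
    by_contra hss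
    rcases hdisj s s' hss (j s) with h1 | h1
    · exact hj s h1
    · rw [h] at h1; exact hj s' h1
  have hσc : ∀ s, (σ s).card ≤ k + 1 := by
    intro s
    have := hcard s
    rw [ncard_eq_toFinset_card'] at this
    simpa [σ] using this
  refine hd2 ⟨(σ, j), fun s => ⟨hσc s, hjσ s⟩, hjinj⟩ ?_
  refine ⟨(z, t, fun x => a x.1 x.2 / a x.1 (j x.1), fun i => d i), ?_⟩
  funext i
  have hext : ∀ i, i ∉ range j → auxExt j (fun i : {i // i ∉ range j} => d i) i = d i := by
    intro i hi
    unfold auxExt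
    rw [dif_pos hi]
  unfold auxBad
  dsimp only
  by_cases h : ∃ s, j s = i
  · rw [dif_pos h]
    generalize hs : h.choose = s
    have hsi : j s = i := by rw [← hs]; exact h.choose_spec
    subst hsi
    have hmem : ∀ i' ∈ (σ s).erase (j s), i' ∉ range j := by
      rintro i' hi' ⟨s', rfl⟩
      rw [Finset.mem_erase] at hi'
      have hss : s ≠ s' := fun h => hi'.1 (by rw [h])
      rcases hdisj s s' hss (j s') with h1 | h1
      · have := hi'.2
        simp [σ, h1] at this
      · exact hj s' h1
    have e1 : ∑ i' : {i // i ∈ (σ s).erase (j s)}, a s i' / a s (j s) =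
        ∑ i' ∈ (σ s).erase (j s), a s i' / a s (j s) :=
      Finset.sum_coe_sort ((σ s).erase (j s)) (fun i' => a s i' / a s (j s))
    have e2 : ∑ i' : {i // i ∈ (σ s).erase (j s)}, (a s i' / a s (j s)) •
          (γ i' t + auxExt j (fun i : {i // i ∉ range j} => d i) i') =
        ∑ i' ∈ (σ s).erase (j s), (a s i' / a s (j s)) • (γ i' t + d i') := by
      refine Eq.trans ?_ (Finset.sum_coe_sort ((σ s).erase (j s))
        (fun i' => (a s i' / a s (j s)) • (γ i' t + d i')))
      refine Finset.sum_congr rfl fun i' _ => ?_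
      rw [hext i' (hmem i' i'.2)]
    rw [e1, e2]
    have hσsum : ∀ {M : Type} [AddCommMonoid M] (F : ι → M), (∀ i, a s i = 0 → F i = 0) →
        ∑ i, F i = F (j s) + ∑ i ∈ (σ s).erase (j s), F i := by
      intro M _ F hF
      rw [Finset.add_sum_erase _ _ (hjσ s)]
      symm
      refine Finset.sum_subset (Finset.subset_univ _) fun i _ hi => hF i ?_
      by_contra h0
      exact hi (by simp [σ, h0])
    have f1 := hsum s
    rw [hσsum _ (fun i h => h)] at f1
    have f2 := heq s
    rw [hσsum _ (fun i h => by rw [h, zero_smul])] at f2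
    have g1 : 1 + ∑ i' ∈ (σ s).erase (j s), a s i' / a s (j s) = (a s (j s))⁻¹ := by
      rw [← Finset.sum_div]
      have := hj s
      field_simp
      exact f1
    have g2 : ∑ i' ∈ (σ s).erase (j s), (a s i' / a s (j s)) • (γ i' t + d i') =
        (a s (j s))⁻¹ • ∑ i' ∈ (σ s).erase (j s), a s i' • (γ i' t + d i') := by
      rw [Finset.smul_sum]
      refine Finset.sum_congr rfl fun i' _ => ?_
      rw [smul_smul, div_eq_inv_mul]
    rw [g1, g2, ← f2, smul_add, smul_smul, inv_mul_cancel₀ (hj s), one_smul]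
    abel
  · rw [dif_neg h]
    exact hext i (fun ⟨s, hs⟩ => h ⟨s, hs⟩)

/-- perfectness of `f` on the closed set `A` -/
def AuxPerf {X Y : Type*} [TopologicalSpace X] [TopologicalSpace Y] (f : X → Y) (A : Set X) : Prop :=
  IsClosed A ∧ (∀ C, C ⊆ A → IsClosed C → IsClosed (f '' C)) ∧ ∀ y, IsCompact (A ∩ f ⁻¹' {y})

/-- no `n+1` points of `K`, pairwise `ε`-separated, with the same image under `u` -/
def AuxSep {X Z : Type*} [PseudoMetricSpace X] (ε : ℝ) (n : ℕ) (K : Set X) (u : X → Z) : Prop :=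
  ∀ x : Fin (n + 1) → X, (∀ s, x s ∈ K) → (∀ s s', s ≠ s' → ε ≤ dist (x s) (x s')) →
    (∀ s s', u (x s) = u (x s')) → False

theorem aux_perf_open {X Y E : Type*} [MetricSpace X] [TopologicalSpace Y] [TopologicalSpace E]
    {f : X → Y} {A : Set X} (hA : AuxPerf f A) {N : ℕ} {Ω : Set ((Fin N → X) × E)}
    (hΩ : IsOpen Ω) :
    IsOpen {q : Y × E | ∀ x : Fin N → X, (∀ s, x s ∈ A ∩ f ⁻¹' {q.1}) → (x, q.2) ∈ Ω} := by
  obtain ⟨hA1, hA2, hA3⟩ := hA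
  rw [isOpen_iff_mem_nhds]
  rintro ⟨y, u⟩ h
  have hK := hA3 y
  have hKN : IsCompact (Set.pi univ fun _ : Fin N => A ∩ f ⁻¹' {y}) :=
    isCompact_univ_pi fun _ => hK
  obtain ⟨U1, U2, U1o, U2o, h1, h2, h12⟩ := generalized_tube_lemma hKN
    (isCompact_singleton (x := u)) hΩ (by
      rintro ⟨x, v⟩ ⟨hx, hv⟩
      have hv' : v = u := hv
      subst hv'
      exact h x fun s => hx s trivial)
  obtain ⟨r, hr, hrU⟩ := hKN.exists_thickening_subset_open U1o h1
  have hVo : IsOpen (f '' (A \ thickening r (A ∩ f ⁻¹' {y})))ᶜ := by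
    rw [isOpen_compl_iff]
    exact hA2 _ sdiff_subset (hA1.sdiff isOpen_thickening)
  have hyV : y ∈ (f '' (A \ thickening r (A ∩ f ⁻¹' {y})))ᶜ := by
    rintro ⟨x, ⟨hxA, hx⟩, rfl⟩
    exact hx (self_subset_thickening hr _ ⟨hxA, rfl⟩)
  filter_upwards [(hVo.prod U2o).mem_nhds ⟨hyV, h2 rfl⟩]
  rintro ⟨y', u'⟩ ⟨hy', hu'⟩ x hx
  refine h12 ⟨hrU ?_, hu'⟩
  have : ∀ s, ∃ c ∈ A ∩ f ⁻¹' {y}, dist (x s) c < r := by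
    intro s
    by_contra hc
    refine hy' ⟨x s, ⟨(hx s).1, fun ht => hc ?_⟩, (hx s).2⟩
    exact mem_thickening_iff.1 ht
  choose c hc hcr using this
  rw [mem_thickening_iff]
  exact ⟨c, fun s _ => hc s, (dist_pi_lt_iff hr).2 hcr⟩

theorem aux_open_close {X Y E : Type*} [MetricSpace X] [TopologicalSpace Y] [PseudoMetricSpace E]
    {f : X → Y} {A : Set X} (hA : AuxPerf f A) (g : X →ᵇ E) {α : X → ℝ} (hα : Continuous α) :
    IsOpen {q : Y × (X →ᵇ E) | ∀ x ∈ A ∩ f ⁻¹' {q.1}, dist (q.2 x) (g x) < α x} := by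
  have h := aux_perf_open (E := X →ᵇ E) hA (N := 1)
    (Ω := {w | dist (w.2 (w.1 0)) (g (w.1 0)) < α (w.1 0)}) (by
      have h0 : Continuous fun w : (Fin 1 → X) × (X →ᵇ E) => w.1 0 :=
        (continuous_apply 0).comp continuous_fst
      refine isOpen_lt (Continuous.dist ?_ (g.continuous.comp h0)) (hα.comp h0)
      exact continuous_snd.eval h0)
  convert h using 1
  ext q
  simp only [mem_ofPred_eq]
  constructor
  · intro h x hx
    exact h (x 0) (hx 0)
  · intro h x hx
    exact h (fun _ => x) (fun _ => hx)

theorem aux_open_sep {X Y E : Type*} [MetricSpace X] [TopologicalSpace Y] [MetricSpace E]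
    {f : X → Y} {A : Set X} (hA : AuxPerf f A) (ε : ℝ) (n : ℕ) :
    IsOpen {q : Y × (X →ᵇ E) | AuxSep ε n (A ∩ f ⁻¹' {q.1}) q.2} := by
  have h := aux_perf_open (E := X →ᵇ E) hA (N := n + 1)
    (Ω := (⋃ s, ⋃ s', ⋃ _ : s ≠ s', {w | dist (w.1 s) (w.1 s') < ε}) ∪
      ⋃ s, ⋃ s', {w | w.2 (w.1 s) ≠ w.2 (w.1 s')}) (by
      have h0 : ∀ s, Continuous fun w : (Fin (n + 1) → X) × (X →ᵇ E) => w.1 s := fun s =>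
        (continuous_apply s).comp continuous_fst
      have h1 : ∀ s, Continuous fun w : (Fin (n + 1) → X) × (X →ᵇ E) => w.2 (w.1 s) := fun s =>
        continuous_snd.eval (h0 s)
      refine IsOpen.union ?_ ?_
      · exact isOpen_iUnion fun s => isOpen_iUnion fun s' => isOpen_iUnion fun _ =>
          isOpen_lt ((h0 s).dist (h0 s')) continuous_const
      · exact isOpen_iUnion fun s => isOpen_iUnion fun s' => isOpen_ne_fun (h1 s) (h1 s'))
  convert h using 1
  ext q
  simp only [mem_ofPred_eq, AuxSep, mem_union, mem_iUnion]
  refine forall_congr' fun x => forall_congr' fun _ => ?_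
  constructor
  · intro h
    by_contra hc
    push Not at hc
    exact h (fun s s' hs => hc.1 s s' hs) hc.2
  · rintro (⟨s, s', hs, h⟩ | ⟨s, s', h⟩) h1 h2
    · exact absurd (h1 s s' hs) (not_le.2 h)
    · exact h (h2 s s')

theorem aux_perf_union {X Y : Type*} [TopologicalSpace X] [TopologicalSpace Y] {f : X → Y}
    {A B : Set X} (hA : AuxPerf f A) (hB : AuxPerf f B) : AuxPerf f (A ∪ B) := by
  refine ⟨hA.1.union hB.1, ?_, ?_⟩
  · intro C hC hCc
    have : C = (C ∩ A) ∪ (C ∩ B) := by rw [← inter_union_distrib_left, inter_eq_left.2 hC]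
    rw [this, image_union]
    exact (hA.2.1 _ inter_subset_right (hCc.inter hA.1)).union
      (hB.2.1 _ inter_subset_right (hCc.inter hB.1))
  · intro y
    rw [union_inter_distrib_right]
    exact (hA.2.2 y).union (hB.2.2 y)

theorem aux_perf_of_sigma {X Y : Type*} [TopologicalSpace X] [TopologicalSpace Y] [T1Space Y]
    {f : X → Y} (hf : IsSigmaPerfectMap f) :
    ∃ B : ℕ → Set X, Monotone B ∧ (⋃ i, B i = univ) ∧ ∀ i, AuxPerf f (B i) := by
  obtain ⟨hfc, A, hA, hAi⟩ := hf
  have hP : ∀ i, AuxPerf f (A i) := by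
    intro i
    obtain ⟨h1, h2, h3, h4, h5⟩ := hAi i
    refine ⟨h1, ?_, ?_⟩
    · intro C hC hCc
      have h6 := h4 (Subtype.val ⁻¹' C) (hCc.preimage continuous_subtype_val)
      have h7 := h2.isClosedEmbedding_subtypeVal.isClosedMap _ h6
      convert h7 using 1
      ext y
      constructor
      · rintro ⟨x, hx, rfl⟩
        exact ⟨⟨f x, x, hC hx, rfl⟩, ⟨⟨x, hC hx⟩, hx, rfl⟩, rfl⟩
      · rintro ⟨_, ⟨x, hx, rfl⟩, rfl⟩
        exact ⟨x, hx, rfl⟩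
    · intro y
      by_cases hy : y ∈ f '' A i
      · have h6 := (h5 ⟨y, hy⟩).image continuous_subtype_val
        convert h6 using 1
        ext x
        constructor
        · rintro ⟨hx, hxy⟩
          exact ⟨⟨x, hx⟩, Subtype.ext hxy, rfl⟩
        · rintro ⟨x, hx, rfl⟩
          exact ⟨x.2, congrArg Subtype.val hx⟩
      · have : A i ∩ f ⁻¹' {y} = ∅ := by
          rw [eq_empty_iff_forall_notMem]
          rintro x ⟨hx, hxy⟩
          exact hy ⟨x, hx, hxy⟩
        rw [this]
        exact isCompact_empty
  refine ⟨fun N => Nat.rec (A 0) (fun i B => B ∪ A (i + 1)) N, ?_, ?_, ?_⟩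
  · exact monotone_nat_of_le_succ fun n => subset_union_left
  · refine eq_univ_of_forall fun x => ?_
    have : x ∈ ⋃ i, A i := by rw [hA]; trivial
    obtain ⟨i, hi⟩ := mem_iUnion.1 this
    refine mem_iUnion.2 ⟨i, ?_⟩
    cases i with
    | zero => exact hi
    | succ i => exact Or.inr hi
  · intro N
    induction N with
    | zero => exact hP 0
    | succ N ih => exact aux_perf_union ih (hP _)

/-- covers of a compact subset of a finite-dimensional set -/
theorem aux_compact_cover {X : Type*} [TopologicalSpace X] {K L : Set X} (hK : IsCompact K)
    (hKc : IsClosed K) (hKL : K ⊆ L) {k : ℕ} (hL : CovDimLENat L k) (O : X → Set X)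
    (Oo : ∀ x, IsOpen (O x)) (hO : ∀ x ∈ K, x ∈ O x) :
    ∃ (T : Finset X) (V : {x // x ∈ T} → Set X), (∀ i, IsOpen (V i)) ∧ (∀ i, V i ⊆ O i) ∧
      (K ⊆ ⋃ i, V i) ∧ ∀ x ∈ K, {i | x ∈ V i}.ncard ≤ k + 1 := by
  classical
  obtain ⟨T, hTK, hT⟩ := hK.elim_nhds_subcover O fun x hx => (Oo x).mem_nhds (hO x hx)
  obtain ⟨v, vo, vs, vc, vn⟩ := aux_finite_shrink hL
    (fun i : Option {x // x ∈ T} => match i with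
      | none => (Subtype.val ⁻¹' Kᶜ : Set L)
      | some i => Subtype.val ⁻¹' (O i.1))
    (by
      rintro (_ | i)
      · exact hKc.isOpen_compl.preimage continuous_subtype_val
      · exact (Oo _).preimage continuous_subtype_val)
    (by
      refine eq_univ_of_forall fun y => ?_
      by_cases hy : y.1 ∈ K
      · have := hT hy
        simp only [mem_iUnion] at this
        obtain ⟨x, hx, hyx⟩ := this
        exact mem_iUnion.2 ⟨some ⟨x, hx⟩, hyx⟩
      · exact mem_iUnion.2 ⟨none, hy⟩)
  have hW : ∀ i : {x // x ∈ T}, ∃ W : Set X, IsOpen W ∧ Subtype.val ⁻¹' W = v (some i) :=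
    fun i => isOpen_induced_iff.1 (vo (some i))
  choose W Wo hW using hW
  have hmem : ∀ x (hx : x ∈ K) i, x ∈ W i ∩ O i → (⟨x, hKL hx⟩ : L) ∈ v (some i) := by
    intro x hx i h
    rw [← hW]
    exact h.1
  refine ⟨T, fun i => W i ∩ O i, fun i => (Wo i).inter (Oo _), fun i => inter_subset_right, ?_, ?_⟩
  · intro x hx
    have : (⟨x, hKL hx⟩ : L) ∈ ⋃ i, v i := by rw [vc]; trivial
    obtain ⟨i, hi⟩ := mem_iUnion.1 this
    rcases i with _ | i
    · exact absurd hx (vs none hi)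
    · refine mem_iUnion.2 ⟨i, ?_, vs (some i) hi⟩
      rw [← hW] at hi
      exact hi
  · intro x hx
    refine le_trans ?_ (vn ⟨x, hKL hx⟩).2
    rw [← ncard_image_of_injective _ (Option.some_injective _)]
    refine ncard_le_ncard ?_ (vn ⟨x, hKL hx⟩).1
    rintro _ ⟨i, hi, rfl⟩
    exact hmem x hx i hi

/-- smooth approximation on the simplex -/
theorem aux_smooth {Y : Type*} [DecidableEq Y] {p : ℕ} (A : Finset Y) (a0 : Y) (ha0 : a0 ∈ A)
    (φ : (Y → ℝ) → EuclideanSpace ℝ (Fin p)) (hφ : ContinuousOn φ (auxSimp A)) {η : ℝ}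
    (hη : 0 < η) :
    ∃ γ : ({a // a ∈ A.erase a0} → ℝ) → EuclideanSpace ℝ (Fin p), ContDiff ℝ 1 γ ∧
      ∀ t ∈ auxSimp A, dist (γ fun a => t a) (φ t) < η := by
  have : CompactSpace (auxSimp A) := isCompact_iff_compactSpace.1 (auxSimp_compact A)
  let e : auxSimp A → ({a // a ∈ A.erase a0} → ℝ) := fun t a => t.1 a
  have he : Continuous e := continuous_pi fun a => (continuous_apply a.1).comp continuous_subtype_val
  have hinj : Function.Injective e := by
    intro t t' h
    have h1 : ∀ a ∈ A.erase a0, t.1 a = t'.1 a := fun a ha => congrFun h ⟨a, ha⟩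
    have h2 := t.2.2.2
    have h3 := t'.2.2.2
    rw [← Finset.add_sum_erase _ _ ha0] at h2 h3
    rw [Finset.sum_congr rfl h1] at h2
    refine Subtype.ext (funext fun a => ?_)
    by_cases ha : a ∈ A
    · by_cases haa : a = a0
      · subst haa; linarith
      · exact h1 a (Finset.mem_erase.2 ⟨haa, ha⟩)
    · rw [t.2.2.1 a ha, t'.2.2.1 a ha]
  obtain ⟨G, hG⟩ := ContinuousMap.exists_extension (he.isClosedEmbedding hinj)
    ⟨fun t : auxSimp A => φ t, hφ.domRestrict⟩
  obtain ⟨γ, hγ1, hγ2, _⟩ := G.continuous.exists_contDiff_approx (ε := fun _ => η) 1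
    continuous_const fun _ => hη
  refine ⟨γ, hγ1, fun t ht => ?_⟩
  have h1 := hγ2 (e ⟨t, ht⟩)
  have h2 : G (e ⟨t, ht⟩) = φ t := DFunLike.congr_fun hG ⟨t, ht⟩
  rw [h2] at h1
  exact h1

theorem aux_const_cont {X Z : Type*} [TopologicalSpace X] [PseudoMetricSpace Z] :
    Continuous (BoundedContinuousFunction.const X : Z → (X →ᵇ Z)) := by
  refine LipschitzWith.continuous (K := 1) (LipschitzWith.of_dist_le_mul fun a b => ?_)
  rw [NNReal.coe_one, one_mul]
  exact (BoundedContinuousFunction.dist_le dist_nonneg).2 fun x => le_rfl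

/-- approximation by separating families -/
theorem aux_approx {X Y : Type*} [MetricSpace X] {k n p m : ℕ}
    (hineq : m + (n + 1) * k < n * p) {K L : Set X} (hK : IsCompact K) (hKL : K ⊆ L)
    (hL : CovDimLENat L k) {ε : ℝ} (hε : 0 < ε) (A : Finset Y) (hA : A.Nonempty)
    (hAm : A.card ≤ m + 1) (Ψ0 : (Y → ℝ) → (X →ᵇ EuclideanSpace ℝ (Fin p)))
    (hΨ0 : ContinuousOn Ψ0 (auxSimp A)) {δ : ℝ} (hδ : 0 < δ) :
    ∃ Ψ1 : (Y → ℝ) → (X →ᵇ EuclideanSpace ℝ (Fin p)), ContinuousOn Ψ1 (auxSimp A) ∧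
      ∀ t ∈ auxSimp A, ‖Ψ1 t - Ψ0 t‖ ≤ δ ∧ AuxSep ε n K (Ψ1 t) := by
  classical
  have hη : 0 < δ / 3 := by positivity
  set η := δ / 3 with hηd
  have hO : ∀ x : X, ∃ O : Set X, IsOpen O ∧ x ∈ O ∧ O ⊆ ball x (ε / 2) ∧
      ∀ x' ∈ O, ∀ t ∈ auxSimp A, dist (Ψ0 t x') (Ψ0 t x) < η := by
    intro x
    have hGo : IsOpen {q : X × (X →ᵇ EuclideanSpace ℝ (Fin p)) | dist (q.2 q.1) (q.2 x) < η} :=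
      isOpen_lt (Continuous.dist (continuous_snd.eval continuous_fst)
        (continuous_snd.eval continuous_const)) continuous_const
    have h1 := aux_tube (y := x) hGo (auxSimp_compact A) hΨ0 (fun t _ => by
      simp only [mem_ofPred_eq, dist_self]; exact hη)
    have h2 := ball_mem_nhds x (half_pos hε)
    obtain ⟨O, hO, Oo, hx⟩ := _root_.mem_nhds_iff.1 (Filter.inter_mem h1 h2)
    exact ⟨O, Oo, hx, fun z hz => (hO hz).2, fun z hz => (hO hz).1⟩
  choose O Oo hxO hOb hOη using hO
  obtain ⟨T, V, Vo, VO, VK, Vn⟩ := aux_compact_cover hK hK.isClosed hKL hL O Oo fun x _ => hxO x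
  obtain ⟨w, hw⟩ := PartitionOfUnity.exists_isSubordinate hK.isClosed V Vo VK
  have hwV : ∀ i x, w i x ≠ 0 → x ∈ V i := fun i x h => hw i (subset_tsupport _ h)
  obtain ⟨a0, ha0⟩ := hA
  have hγ : ∀ i : {x // x ∈ T}, ∃ γ : ({a // a ∈ A.erase a0} → ℝ) → EuclideanSpace ℝ (Fin p),
      ContDiff ℝ 1 γ ∧ ∀ t ∈ auxSimp A, dist (γ fun a => t a) (Ψ0 t i) < η := fun i =>
    aux_smooth A a0 ha0 (fun t => Ψ0 t i)
      ((continuous_id.eval continuous_const).comp_continuousOn hΨ0) hη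
  choose γ hγ1 hγ2 using hγ
  obtain ⟨d, hd1, hd2⟩ := aux_generic (m := m) (k := k) (n := n) (by
    rw [Module.finrank_pi, Fintype.card_coe, Finset.card_erase_of_mem ha0]; omega) hineq γ hγ1 hη
  let W : {x // x ∈ T} → (X →ᵇ ℝ) := fun i =>
    BoundedContinuousFunction.ofNormedAddCommGroup (w i) (w i).continuous 1 fun x => by
      rw [Real.norm_of_nonneg (w.nonneg i x)]; exact w.le_one i x
  let c : {x // x ∈ T} → (Y → ℝ) → EuclideanSpace ℝ (Fin p) := fun i t =>
    γ i (fun a => t a) + d i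
  have hc : ∀ i, Continuous (c i) := fun i =>
    ((hγ1 i).continuous.comp (continuous_pi fun a => continuous_apply a.1)).add continuous_const
  let Ψ1 : (Y → ℝ) → (X →ᵇ EuclideanSpace ℝ (Fin p)) := fun t =>
    Ψ0 t + ∑ i, W i • (BoundedContinuousFunction.const X (c i t) - Ψ0 t)
  have hval : ∀ t x, Ψ1 t x = Ψ0 t x + ∑ i, w i x • (c i t - Ψ0 t x) := by
    intro t x
    have : (∑ i, W i • (BoundedContinuousFunction.const X (c i t) - Ψ0 t) :
        X →ᵇ EuclideanSpace ℝ (Fin p)) x =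
        ∑ i, (W i • (BoundedContinuousFunction.const X (c i t) - Ψ0 t)) x := by
      rw [BoundedContinuousFunction.coe_sum, Finset.sum_apply]
    change Ψ0 t x + _ = _
    rw [this]
    rfl
  have hc0 : ∀ t ∈ auxSimp A, ∀ i, dist (c i t) (Ψ0 t i) ≤ 2 * η := by
    intro t ht i
    have h1 := hγ2 i t ht
    have h2 := hd1 i
    have h3 : dist (c i t) (γ i fun a => t a) = ‖d i‖ := by simp [c, dist_eq_norm]
    have h4 := dist_triangle (c i t) (γ i fun a => t a) (Ψ0 t i)
    linarith
  have hwsum : ∀ x, ∑ i, w i x ≤ 1 := fun x => by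
    rw [← finsum_eq_sum_of_fintype]; exact w.sum_le_one x
  refine ⟨Ψ1, ?_, fun t ht => ⟨?_, ?_⟩⟩
  · refine hΨ0.add (continuousOn_finsetSum _ fun i _ => (continuous_const_smul (W i)).comp_continuousOn ?_)
    exact ((aux_const_cont.comp (hc i)).continuousOn).sub hΨ0
  · refine (BoundedContinuousFunction.norm_le hδ.le).2 fun x => ?_
    change ‖Ψ1 t x - Ψ0 t x‖ ≤ δ
    rw [hval, add_sub_cancel_left]
    calc ‖∑ i, w i x • (c i t - Ψ0 t x)‖ ≤ ∑ i, ‖w i x • (c i t - Ψ0 t x)‖ := norm_sum_le _ _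
      _ ≤ ∑ i, w i x * δ := by
          refine Finset.sum_le_sum fun i _ => ?_
          rw [norm_smul, Real.norm_of_nonneg (w.nonneg i x)]
          by_cases h : w i x = 0
          · rw [h]; simp
          · refine mul_le_mul_of_nonneg_left ?_ (w.nonneg i x)
            have h1 := hOη i x (VO i (hwV i x h)) t ht
            have h2 := hc0 t ht i
            have h3 := dist_triangle_right (c i t) (Ψ0 t x) (Ψ0 t i)
            rw [← dist_eq_norm]
            linarith
      _ = (∑ i, w i x) * δ := by rw [Finset.sum_mul]
      _ ≤ δ := by
          have := mul_le_mul_of_nonneg_right (hwsum x) hδ.le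
          linarith
  · intro x hxK hxs hxe
    have hone : ∀ s, ∑ i, w i (x s) = 1 := fun s => by
      rw [← finsum_eq_sum_of_fintype]; exact w.sum_eq_one (hxK s)
    refine hd2 (fun a => t a) (Ψ1 t (x 0)) (fun s i => w i (x s)) (fun s i => w.nonneg i _)
      hone ?_ ?_ ?_
    · intro s
      refine le_trans (ncard_le_ncard ?_ (toFinite _)) (Vn (x s) (hxK s))
      intro i hi
      exact hwV i _ hi
    · intro s s' hs i
      by_contra hcon
      push Not at hcon
      have h1 := hOb _ (VO i (hwV i _ hcon.1))
      have h2 := hOb _ (VO i (hwV i _ hcon.2))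
      rw [mem_ball] at h1 h2
      have h3 := dist_triangle_right (x s) (x s') i.1
      have h4 := hxs s s' hs
      linarith
    · intro s
      rw [hxe 0 s, hval]
      simp only [smul_sub]
      rw [Finset.sum_sub_distrib, ← Finset.sum_smul, hone s, one_smul]
      abel

/-- cone extension from the boundary of a simplex -/
theorem aux_cone {Y E : Type*} [NormedAddCommGroup E] [NormedSpace ℝ E] (A : Finset Y)
    (hA : A.Nonempty) (Φ : (Y → ℝ) → E) (hΦ : ∀ B, B ⊂ A → ContinuousOn Φ (auxSimp B))
    {C : Set E} (hC : Convex ℝ C) {g : E} (hg : g ∈ C)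
    (hΦC : ∀ B, B ⊂ A → ∀ t ∈ auxSimp B, Φ t ∈ C) :
    ∃ Ψ0 : (Y → ℝ) → E, ContinuousOn Ψ0 (auxSimp A) ∧ (∀ t ∈ auxSimp A, Ψ0 t ∈ C) ∧
      ∀ B, B ⊂ A → EqOn Ψ0 Φ (auxSimp B) := by
  classical
  let D : Set (Y → ℝ) := ⋃ B : {B // B ∈ A.powerset.erase A}, auxSimp B.1
  have hB : ∀ B : {B // B ∈ A.powerset.erase A}, B.1 ⊂ A := by
    intro B
    have := B.2
    rw [Finset.mem_erase, Finset.mem_powerset] at this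
    exact lt_of_le_of_ne this.2 this.1
  have hBD : ∀ B, B ⊂ A → auxSimp B ⊆ D := by
    intro B h t ht
    refine mem_iUnion.2 ⟨⟨B, ?_⟩, ht⟩
    rw [Finset.mem_erase, Finset.mem_powerset]
    exact ⟨h.ne, h.1⟩
  have hΦD : ContinuousOn Φ D := (locallyFinite_of_finite _).continuousOn_iUnion
    (fun B => auxSimp_closed B.1) fun B => hΦ B.1 (hB B)
  have hΦDC : ∀ t ∈ D, Φ t ∈ C := by
    intro t ht
    obtain ⟨B, hBt⟩ := mem_iUnion.1 ht
    exact hΦC B.1 (hB B) t hBt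
  let mn : (Y → ℝ) → ℝ := fun t => A.inf' hA t
  have hmn : Continuous mn := Continuous.finset_inf'_apply hA fun a _ => continuous_apply a
  let κ : (Y → ℝ) → ℝ := fun t => A.card * mn t
  have hκ : Continuous κ := continuous_const.mul hmn
  let pr : (Y → ℝ) → (Y → ℝ) := fun t a => (1 - κ t)⁻¹ * (t a - if a ∈ A then mn t else 0)
  have hmn0 : ∀ t ∈ auxSimp A, 0 ≤ mn t := fun t ht => Finset.le_inf' _ _ fun a _ => ht.1 a
  have hprD : ∀ t ∈ auxSimp A, κ t ≤ 1 / 2 → pr t ∈ D := by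
    intro t ht hk
    have hpos : 0 < 1 - κ t := by linarith
    obtain ⟨a, ha, hamin⟩ := Finset.exists_mem_eq_inf' hA t
    have h1 : pr t ∈ auxSimp A := by
      refine ⟨fun i => mul_nonneg (inv_nonneg.2 hpos.le) ?_, fun i hi => ?_, ?_⟩
      · split_ifs with hi
        · exact sub_nonneg.2 (Finset.inf'_le _ hi)
        · simpa using ht.1 i
      · simp only [pr, hi, if_false, ht.2.1 i hi]; simp
      · change ∑ i ∈ A, (1 - κ t)⁻¹ * (t i - if i ∈ A then mn t else 0) = 1
        rw [← Finset.mul_sum, Finset.sum_sub_distrib, ht.2.2, Finset.sum_congr rfl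
          (fun i hi => if_pos hi), Finset.sum_const, nsmul_eq_mul]
        exact inv_mul_cancel₀ hpos.ne'
    refine hBD (A.erase a) (Finset.erase_ssubset ha)
      (auxSimp_of_support h1 (fun i hi => ?_) (Finset.erase_subset _ _))
    have hiA : i ∈ A := by
      by_contra h
      exact hi (h1.2.1 i h)
    refine Finset.mem_erase.2 ⟨?_, hiA⟩
    rintro rfl
    apply hi
    have : mn t = t i := hamin
    simp only [pr, hiA, if_true, this]; simp
  let F1 : (Y → ℝ) → E := fun t => (2 * κ t) • g + (1 - 2 * κ t) • Φ (pr t)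
  let Ψ0 : (Y → ℝ) → E := fun t => if κ t ≤ 1 / 2 then F1 t else g
  let S1 : Set (Y → ℝ) := auxSimp A ∩ {t | κ t ≤ 1 / 2}
  let S2 : Set (Y → ℝ) := auxSimp A ∩ {t | 1 / 2 ≤ κ t}
  have hS : auxSimp A = S1 ∪ S2 := by
    ext t
    constructor
    · intro ht
      rcases le_total (κ t) (1 / 2) with h | h
      · exact Or.inl ⟨ht, h⟩
      · exact Or.inr ⟨ht, h⟩
    · rintro (h | h)
      · exact h.1
      · exact h.1
  have hS1 : IsClosed S1 := (auxSimp_closed A).inter (isClosed_le hκ continuous_const)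
  have hS2 : IsClosed S2 := (auxSimp_closed A).inter (isClosed_le continuous_const hκ)
  have hpr : ContinuousOn pr S1 := by
    rw [continuousOn_pi]
    intro a
    refine ContinuousOn.mul (ContinuousOn.inv₀ ?_ ?_) ?_
    · exact (continuous_const.sub hκ).continuousOn
    · intro t ht
      have : κ t ≤ 1 / 2 := ht.2
      have : 0 < 1 - κ t := by linarith
      exact this.ne'
    · refine ((continuous_apply a).sub ?_).continuousOn
      by_cases h : a ∈ A
      · simp only [h, if_true]; exact hmn
      · simp only [h, if_false]; exact continuous_const
  have hF1 : ContinuousOn F1 S1 := by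
    refine ContinuousOn.add (ContinuousOn.smul (continuous_const.mul hκ).continuousOn
      continuousOn_const) (ContinuousOn.smul
      (continuous_const.sub (continuous_const.mul hκ)).continuousOn ?_)
    exact hΦD.comp hpr fun t ht => hprD t ht.1 ht.2
  refine ⟨Ψ0, ?_, ?_, ?_⟩
  · rw [hS]
    refine ContinuousOn.union_of_isClosed ?_ ?_ hS1 hS2
    · exact hF1.congr fun t ht => if_pos ht.2
    · refine (continuousOn_const (c := g)).congr fun t ht => ?_
      change (if κ t ≤ 1 / 2 then F1 t else g) = g
      split_ifs with h
      · have h2 : κ t = 1 / 2 := le_antisymm h ht.2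
        simp only [F1, h2]; simp
      · rfl
  · intro t ht
    change (if κ t ≤ 1 / 2 then F1 t else g) ∈ C
    split_ifs with h
    · have h0 : 0 ≤ κ t := mul_nonneg (Nat.cast_nonneg _) (hmn0 t ht)
      exact hC hg (hΦDC _ (hprD t ht h)) (by linarith) (by linarith) (by ring)
    · exact hg
  · intro B hBA t ht
    obtain ⟨a, ha, haB⟩ := Finset.exists_of_ssubset hBA
    have h0 : mn t = 0 := by
      refine le_antisymm ?_ (hmn0 t (auxSimp_mono hBA.1 ht))
      have : mn t ≤ t a := Finset.inf'_le _ ha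
      rwa [ht.2.1 a haB] at this
    have h1 : κ t = 0 := by simp only [κ, h0, mul_zero]
    have h2 : pr t = t := by
      funext a
      simp only [pr, h1, h0]; simp
    change (if κ t ≤ 1 / 2 then F1 t else g) = Φ t
    rw [if_pos (by rw [h1]; norm_num)]
    simp only [F1, h2, h1]; simp

/-- the filling lemma at a point -/
theorem aux_fill_point {X Y : Type*} [MetricSpace X] {k n p m : ℕ}
    (hineq : m + (n + 1) * k < n * p) {K L : Set X} (hK : IsCompact K) (hKL : K ⊆ L)
    (hL : CovDimLENat L k) {ε : ℝ} (hε : 0 < ε) (A : Finset Y) (hA : A.Nonempty)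
    (hAm : A.card ≤ m + 1) {C S : Set (X →ᵇ EuclideanSpace ℝ (Fin p))} (hC : Convex ℝ C)
    (hCo : IsOpen C) (hSo : IsOpen S) {g : X →ᵇ EuclideanSpace ℝ (Fin p)} (hg : g ∈ C)
    (hS : ∀ u : X →ᵇ EuclideanSpace ℝ (Fin p), AuxSep ε n K u → u ∈ S)
    (Φ : (Y → ℝ) → (X →ᵇ EuclideanSpace ℝ (Fin p)))
    (hΦ : ∀ B, B ⊂ A → ContinuousOn Φ (auxSimp B) ∧ ∀ t ∈ auxSimp B, Φ t ∈ C ∩ S) :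
    ∃ Ψ : (Y → ℝ) → (X →ᵇ EuclideanSpace ℝ (Fin p)), ContinuousOn Ψ (auxSimp A) ∧
      (∀ t ∈ auxSimp A, Ψ t ∈ C ∩ S) ∧ ∀ B, B ⊂ A → EqOn Ψ Φ (auxSimp B) := by
  classical
  obtain ⟨Ψ0, h0c, h0C, h0Φ⟩ := aux_cone A hA Φ (fun B hB => (hΦ B hB).1) hC hg
    (fun B hB t ht => ((hΦ B hB).2 t ht).1)
  let D : Set (Y → ℝ) := ⋃ B : {B // B ∈ A.powerset.erase A}, auxSimp B.1
  have hB : ∀ B : {B // B ∈ A.powerset.erase A}, B.1 ⊂ A := by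
    intro B
    have := B.2
    rw [Finset.mem_erase, Finset.mem_powerset] at this
    exact lt_of_le_of_ne this.2 this.1
  have hBD : ∀ B, B ⊂ A → auxSimp B ⊆ D := by
    intro B h t ht
    refine mem_iUnion.2 ⟨⟨B, ?_⟩, ht⟩
    rw [Finset.mem_erase, Finset.mem_powerset]
    exact ⟨h.ne, h.1⟩
  have hDA : D ⊆ auxSimp A := iUnion_subset fun B => auxSimp_mono (hB B).1
  have hDc : IsCompact D := isCompact_iUnion fun B => auxSimp_compact B.1
  have hK' : IsCompact (Ψ0 '' D) := hDc.image_of_continuousOn (h0c.mono hDA)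
  have hK'S : Ψ0 '' D ⊆ S := by
    rintro _ ⟨t, ht, rfl⟩
    obtain ⟨B, hBt⟩ := mem_iUnion.1 ht
    rw [h0Φ B.1 (hB B) hBt]
    exact ((hΦ B.1 (hB B)).2 t hBt).2
  obtain ⟨δ1, hδ1, hδS⟩ := hK'.exists_thickening_subset_open hSo hK'S
  obtain ⟨δ2, hδ2, hδC⟩ := ((auxSimp_compact A).image_of_continuousOn
    h0c).exists_thickening_subset_open hCo (by rintro _ ⟨t, ht, rfl⟩; exact h0C t ht)
  obtain ⟨δ, hδ, hδa, hδb⟩ : ∃ δ : ℝ, 0 < δ ∧ 2 * δ ≤ δ1 ∧ δ < δ2 :=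
    ⟨min (δ1 / 2) (δ2 / 2), by positivity, by
      have := min_le_left (δ1 / 2) (δ2 / 2); linarith, by
      have := min_le_right (δ1 / 2) (δ2 / 2); linarith⟩
  obtain ⟨Ψ1, h1c, h1⟩ := aux_approx hineq hK hKL hL hε A hA hAm Ψ0 h0c hδ
  have hCmem : ∀ t ∈ auxSimp A, ∀ u, ‖u - Ψ0 t‖ ≤ δ → u ∈ C := by
    intro t ht u hu
    refine hδC (mem_thickening_iff.2 ⟨Ψ0 t, ⟨t, ht, rfl⟩, ?_⟩)
    rw [dist_eq_norm]; linarith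
  rcases D.eq_empty_or_nonempty with hD | hD
  · refine ⟨Ψ1, h1c, fun t ht => ⟨hCmem t ht _ (h1 t ht).1, hS _ (h1 t ht).2⟩, fun B hBA t ht => ?_⟩
    have := hBD B hBA ht
    rw [hD] at this
    exact this.elim
  let ρ : (Y → ℝ) → ℝ := fun t => min 1 (infDist (Ψ0 t) (Ψ0 '' D) / δ)
  have hρ0 : ∀ t, 0 ≤ ρ t := fun t => le_min zero_le_one (div_nonneg infDist_nonneg hδ.le)
  have hρ1 : ∀ t, ρ t ≤ 1 := fun t => min_le_left _ _
  have hρc : ContinuousOn ρ (auxSimp A) :=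
    ((continuous_const (y := (1:ℝ))).min continuous_id).comp_continuousOn
      (((continuous_infDist_pt _).comp_continuousOn h0c).div_const δ)
  refine ⟨fun t => Ψ0 t + ρ t • (Ψ1 t - Ψ0 t), h0c.add (hρc.smul (h1c.sub h0c)), ?_, ?_⟩
  · intro t ht
    have hn : ‖Ψ0 t + ρ t • (Ψ1 t - Ψ0 t) - Ψ0 t‖ ≤ δ := by
      rw [add_sub_cancel_left, norm_smul, Real.norm_of_nonneg (hρ0 t)]
      calc ρ t * ‖Ψ1 t - Ψ0 t‖ ≤ 1 * δ :=
            mul_le_mul (hρ1 t) (h1 t ht).1 (norm_nonneg _) zero_le_one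
        _ = δ := one_mul δ
    refine ⟨hCmem t ht _ hn, ?_⟩
    by_cases h : ρ t = 1
    · have h3 : Ψ0 t + ρ t • (Ψ1 t - Ψ0 t) = Ψ1 t := by
        rw [h]; ext x; simp
      change Ψ0 t + ρ t • (Ψ1 t - Ψ0 t) ∈ S
      rw [h3]
      exact hS _ (h1 t ht).2
    · have h2 : infDist (Ψ0 t) (Ψ0 '' D) < δ := by
        by_contra hcon
        push Not at hcon
        apply h
        exact min_eq_left ((one_le_div hδ).2 hcon)
      obtain ⟨v, hv, hvd⟩ := (infDist_lt_iff (hD.image Ψ0)).1 h2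
      refine hδS (mem_thickening_iff.2 ⟨v, hv, ?_⟩)
      have h3 := dist_triangle (Ψ0 t + ρ t • (Ψ1 t - Ψ0 t)) (Ψ0 t) v
      rw [dist_eq_norm (Ψ0 t + ρ t • (Ψ1 t - Ψ0 t)) (Ψ0 t)] at h3
      linarith
  · intro B hBA t ht
    have h2 : ρ t = 0 := by
      have : infDist (Ψ0 t) (Ψ0 '' D) = 0 := infDist_zero_of_mem ⟨t, hBD B hBA ht, rfl⟩
      simp only [ρ, this]; simp
    change Ψ0 t + ρ t • (Ψ1 t - Ψ0 t) = Φ t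
    rw [← h0Φ B hBA ht, h2]
    ext x; simp

/-- truncation of a map towards a given bounded map -/
theorem aux_trunc {X E : Type*} [TopologicalSpace X] [NormedAddCommGroup E] [NormedSpace ℝ E]
    (g : X →ᵇ E) {h : X → E} (hh : Continuous h) {α : X → ℝ} (hα : Continuous α)
    (hpos : ∀ x, 0 < α x) {M : ℝ} (hM : ∀ x, α x ≤ M) :
    ∃ u : X →ᵇ E, (∀ x, dist (u x) (g x) ≤ α x) ∧
      ∀ x, dist (h x) (g x) ≤ α x → u x = h x := by
  let e : X → E := fun x => h x - g x
  have he : Continuous e := hh.sub g.continuous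
  let c : X → ℝ := fun x => α x / max (α x) ‖e x‖
  have hmax : ∀ x, 0 < max (α x) ‖e x‖ := fun x => lt_max_of_lt_left (hpos x)
  have hc : Continuous c := hα.div (hα.max he.norm) fun x => (hmax x).ne'
  let w : X → E := fun x => c x • e x
  have hw : Continuous w := hc.smul he
  have hwn : ∀ x, ‖w x‖ ≤ α x := by
    intro x
    change ‖c x • e x‖ ≤ α x
    have hc0 : 0 ≤ c x := div_nonneg (hpos x).le (hmax x).le
    rw [norm_smul, Real.norm_of_nonneg hc0]
    calc c x * ‖e x‖ ≤ c x * max (α x) ‖e x‖ :=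
          mul_le_mul_of_nonneg_left (le_max_right _ _) hc0
      _ = α x := div_mul_cancel₀ _ (hmax x).ne'
  refine ⟨g + BoundedContinuousFunction.ofNormedAddCommGroup w hw M
    (fun x => (hwn x).trans (hM x)), fun x => ?_, fun x hx => ?_⟩
  · rw [dist_eq_norm]
    have : (g + BoundedContinuousFunction.ofNormedAddCommGroup w hw M
      (fun x => (hwn x).trans (hM x))) x - g x = w x := by simp
    rw [this]
    exact hwn x
  · have h1 : ‖e x‖ ≤ α x := by rwa [dist_eq_norm] at hx
    have h2 : c x = 1 := by
      change α x / max (α x) ‖e x‖ = 1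
      rw [max_eq_left h1]
      exact div_self (hpos x).ne'
    have h3 : w x = h x - g x := by
      change c x • e x = _
      rw [h2, one_smul]
    simp [h3]

/-- Baire property of the source limitation topology -/
theorem aux_baire {X E : Type*} [TopologicalSpace X] [MetricSpace E] [CompleteSpace E]
    (U : ℕ → Set (X →ᵇ E)) (hU : ∀ i, IsOpen[sourceLimitation X E] (U i))
    (hd : ∀ i, ∀ g : X →ᵇ E, ∀ α : X → ℝ, Continuous α → (∀ x, 0 < α x) →
      ∃ h ∈ U i, ∀ x, dist (h x) (g x) ≤ α x)
    (g : X →ᵇ E) (α : X → ℝ) (hα : Continuous α) (hpos : ∀ x, 0 < α x) :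
    ∃ h ∈ ⋂ i, U i, ∀ x, dist (h x) (g x) ≤ α x := by
  let P := {q : (X →ᵇ E) × (X → ℝ) // Continuous q.2 ∧ ∀ x, 0 < q.2 x}
  have step : ∀ (i : ℕ) (q : P), ∃ q' : P,
      (∀ x, dist (q'.1.1 x) (q.1.1 x) + q'.1.2 x ≤ q.1.2 x) ∧
      (∀ x, q'.1.2 x ≤ q.1.2 x / 2) ∧
      ∀ h : X →ᵇ E, (∀ x, dist (h x) (q'.1.1 x) ≤ q'.1.2 x) → h ∈ U i := by
    rintro i ⟨⟨g, α⟩, hα, hpos⟩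
    obtain ⟨h, hhU, hh⟩ := hd i g (fun x => α x / 2) (hα.div_const 2) fun x => half_pos (hpos x)
    obtain ⟨β, hβ, hβpos, hβU⟩ := hU i h hhU
    refine ⟨⟨⟨h, fun x => min (β x) (α x / 2)⟩, hβ.min (hα.div_const 2),
      fun x => lt_min (hβpos x) (half_pos (hpos x))⟩, fun x => ?_, fun x => min_le_right _ _,
      fun u hu => hβU u fun x => (hu x).trans (min_le_left _ _)⟩
    have h1 := hh x
    have h2 := min_le_right (β x) (α x / 2)
    change dist (h x) (g x) + min (β x) (α x / 2) ≤ α x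
    linarith
  choose st hst1 hst2 hst3 using step
  let q0 : P := ⟨⟨g, fun x => min (α x) 1⟩, hα.min continuous_const,
    fun x => lt_min (hpos x) one_pos⟩
  let q : ℕ → P := fun i => Nat.rec q0 (fun i q => st i q) i
  have hq : ∀ i, q (i + 1) = st i (q i) := fun i => rfl
  have hsmall : ∀ i x, (q i).1.2 x ≤ 1 * (1 / 2) ^ i := by
    intro i
    induction i with
    | zero => intro x; rw [pow_zero, mul_one]; exact min_le_right (α x) 1
    | succ i ih =>
      intro x
      have h1 := hst2 i (q i) x
      rw [← hq] at h1
      have h2 := ih x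
      rw [pow_succ]
      linarith
  have hstep : ∀ i x, dist ((q (i + 1)).1.1 x) ((q i).1.1 x) + (q (i + 1)).1.2 x ≤ (q i).1.2 x :=
    fun i x => hst1 i (q i) x
  have hcau : CauchySeq fun i => (q i).1.1 := by
    refine cauchySeq_of_le_geometric (1 / 2) 1 (by norm_num) fun i => ?_
    refine (BoundedContinuousFunction.dist_le (by positivity)).2 fun x => ?_
    rw [dist_comm]
    have h1 := hstep i x
    have h2 := hsmall i x
    have h3 := (q (i + 1)).2.2 x
    linarith
  obtain ⟨h, hh⟩ := cauchySeq_tendsto_of_complete hcau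
  have htail : ∀ i j x, dist ((q (i + j)).1.1 x) ((q i).1.1 x) + (q (i + j)).1.2 x
      ≤ (q i).1.2 x := by
    intro i j
    induction j with
    | zero => intro x; simp
    | succ j ih =>
      intro x
      have h1 := hstep (i + j) x
      have h2 := ih x
      have h3 := dist_triangle ((q (i + j + 1)).1.1 x) ((q (i + j)).1.1 x) ((q i).1.1 x)
      rw [← add_assoc]
      linarith
  have hlim : ∀ i x, dist (h x) ((q i).1.1 x) ≤ (q i).1.2 x := by
    intro i x
    have h1 : Filter.Tendsto (fun j => (q (i + j)).1.1 x) Filter.atTop (𝓝 (h x)) := by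
      have h2 : Filter.Tendsto (fun j => (q j).1.1 x) Filter.atTop (𝓝 (h x)) :=
        ((continuous_eval_const x).tendsto h).comp hh
      have h3 := h2.comp (Filter.tendsto_add_atTop_nat i)
      refine h3.congr fun j => ?_
      rw [Function.comp, add_comm]
    refine le_of_tendsto (h1.dist tendsto_const_nhds) (Filter.Eventually.of_forall fun j => ?_)
    have h2 := htail i j x
    have h3 := (q (i + j)).2.2 x
    linarith
  refine ⟨h, mem_iInter.2 fun i => ?_, fun x => (hlim 0 x).trans (min_le_left _ _)⟩
  exact hst3 i (q i) h (hlim (i + 1))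

theorem aux_sel_fib {X Y : Type*} [MetricSpace X] [TopologicalSpace Y] [T2Space Y]
    [ParacompactSpace Y] {k n p m : ℕ} (hineq : m + (n + 1) * k < n * p) {f : X → Y}
    (hdim : ∀ y, CovDimLENat (f ⁻¹' {y}) k) (hY : CovDimLENat Y m) {A : Set X}
    (hA : AuxPerf f A) {ε : ℝ} (hε : 0 < ε) (g : X →ᵇ EuclideanSpace ℝ (Fin p)) {α : X → ℝ}
    (hα : Continuous α) (hpos : ∀ x, 0 < α x) :
    ∃ h : Y → (X →ᵇ EuclideanSpace ℝ (Fin p)), Continuous h ∧ ∀ y,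
      (∀ x ∈ A ∩ f ⁻¹' {y}, dist (h y x) (g x) < α x) ∧ AuxSep ε n (A ∩ f ⁻¹' {y}) (h y) := by
  have h1 := aux_open_close hA g hα
  have h2 := aux_open_sep (E := EuclideanSpace ℝ (Fin p)) hA ε n
  refine aux_selection hY (h1.inter h2) ?_
  intro y T hT hTm Φ hΦ
  have hsl : Continuous fun u : X →ᵇ EuclideanSpace ℝ (Fin p) => (y, u) :=
    continuous_const.prodMk continuous_id
  refine aux_fill_point hineq (hA.2.2 y) inter_subset_right (hdim y) hε T hT hTm
    (C := {u | ∀ x ∈ A ∩ f ⁻¹' {y}, dist (u x) (g x) < α x})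
    (S := {u | AuxSep ε n (A ∩ f ⁻¹' {y}) u}) ?_ (h1.preimage hsl) (h2.preimage hsl)
    (g := g) ?_ (fun u hu => hu) Φ hΦ
  · intro u hu v hv a b ha hb hab x hx
    have := convex_ball (g x) (α x) (mem_ball.2 (hu x hx)) (mem_ball.2 (hv x hx)) ha hb hab
    exact mem_ball.1 this
  · intro x _
    simpa using hpos x

theorem aux_dense_step {X Y : Type*} [MetricSpace X] [TopologicalSpace Y] [T2Space Y]
    [ParacompactSpace Y] {k n p m : ℕ} (hineq : m + (n + 1) * k < n * p) {f : X → Y}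
    (hf : Continuous f)
    (hdim : ∀ y, CovDimLENat (f ⁻¹' {y}) k) (hY : CovDimLENat Y m) {A : Set X}
    (hA : AuxPerf f A) {ε : ℝ} (hε : 0 < ε) (g : X →ᵇ EuclideanSpace ℝ (Fin p)) (α : X → ℝ)
    (hα : Continuous α) (hpos : ∀ x, 0 < α x) :
    ∃ u : X →ᵇ EuclideanSpace ℝ (Fin p), (∀ y, AuxSep ε n (A ∩ f ⁻¹' {y}) u) ∧
      ∀ x, dist (u x) (g x) ≤ α x := by
  obtain ⟨h, hc, hh⟩ := aux_sel_fib hineq hdim hY hA hε g (hα.min continuous_const)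
    (fun x => lt_min (hpos x) one_pos)
  have hX : Continuous fun x => h (f x) x := (hc.comp hf).eval continuous_id
  obtain ⟨u, hu1, hu2⟩ := aux_trunc g hX (hα.min continuous_const)
    (fun x => lt_min (hpos x) one_pos) (fun x => min_le_right (α x) 1)
  refine ⟨u, fun y x hx hs he => ?_, fun x => (hu1 x).trans (min_le_left _ _)⟩
  have key : ∀ s, u (x s) = h y (x s) := by
    intro s
    have h1 : f (x s) = y := (hx s).2
    have h2 := hu2 (x s)
    rw [h1] at h2
    exact h2 ((hh y).1 (x s) (hx s)).le
  exact (hh y).2 x hx hs fun s s' => by rw [← key s, ← key s']; exact he s s'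

theorem aux_open_step {X Y E : Type*} [MetricSpace X] [TopologicalSpace Y] [T2Space Y]
    [ParacompactSpace Y] [NormedAddCommGroup E] [NormedSpace ℝ E] {n : ℕ} {f : X → Y}
    (hf : Continuous f) {A : Set X} (hA : AuxPerf f A) (ε : ℝ) :
    IsOpen[sourceLimitation X E] {u : X →ᵇ E | ∀ y, AuxSep ε n (A ∩ f ⁻¹' {y}) u} := by
  intro g hg
  have h2 := aux_open_sep (E := E) hA ε n
  obtain ⟨δ, hδ⟩ := exists_continuous_forall_mem_convex_of_local_const
    (X := Y) (E := ℝ) (t := fun y => {d : ℝ | 0 < d ∧ ∀ u : X →ᵇ E, dist u g ≤ d →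
      AuxSep ε n (A ∩ f ⁻¹' {y}) u}) (by
      intro y
      rw [convex_iff_ordConnected]
      constructor
      rintro a ha b hb c hc
      exact ⟨ha.1.trans_le hc.1, fun u hu => hb.2 u (hu.trans hc.2)⟩) (by
      intro y
      have h3 := h2.mem_nhds (x := (y, g)) (hg y)
      rw [nhds_prod_eq, Filter.mem_prod_iff] at h3
      obtain ⟨V, hV, W, hW, hVW⟩ := h3
      obtain ⟨r, hr, hrW⟩ := Metric.mem_nhds_iff.1 hW
      refine ⟨r / 2, ?_⟩
      filter_upwards [hV] with z hz
      refine ⟨half_pos hr, fun u hu => ?_⟩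
      have : (z, u) ∈ V ×ˢ W := ⟨hz, hrW (mem_ball.2 (by linarith))⟩
      exact hVW this)
  refine ⟨fun x => δ (f x), δ.continuous.comp hf, fun x => (hδ _).1, fun h hh y => ?_⟩
  obtain ⟨u, hu1, hu2⟩ := aux_trunc g h.continuous (α := fun _ => δ y) continuous_const
    (fun _ => (hδ y).1) (M := δ y) fun _ => le_rfl
  intro x hx hs he
  refine (hδ y).2 u ((BoundedContinuousFunction.dist_le (hδ y).1.le).2 hu1) x hx hs ?_
  have key : ∀ s, u (x s) = h (x s) := by
    intro s
    have h1 : f (x s) = y := (hx s).2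
    have h3 : dist (h (x s)) (g (x s)) ≤ δ (f (x s)) := hh (x s)
    rw [h1] at h3
    exact hu2 _ h3
  intro s s'
  rw [key s, key s']
  exact he s s'

theorem aux_covdim_of_int {X : Type*} [TopologicalSpace X] {k : ℕ} (h : CovDimLE X k) :
    CovDimLENat X k := by
  rcases h with h | ⟨k', hk, h⟩
  · intro 𝒰 _ _ _
    refine ⟨∅, by simp, ?_, by simp, fun x => isEmptyElim x⟩
    exact Subsingleton.elim _ _
  · exact aux_covdim_mono (by exact_mod_cast hk) h

theorem aux_main {X Y : Type*} [MetricSpace X] [TopologicalSpace Y] [T2Space Y]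
    [ParacompactSpace Y] {k n p m : ℕ} (hineq : m + (n + 1) * k < n * p) {f : X → Y}
    (hf : IsSigmaPerfectMap f) (hdim : ∀ y, CovDimLENat (f ⁻¹' {y}) k) (hY : CovDimLENat Y m) :
    ∃ G : Set (X →ᵇ EuclideanSpace ℝ (Fin p)),
      @Dense _ (sourceLimitation X (EuclideanSpace ℝ (Fin p))) G ∧
      @IsGδ _ (sourceLimitation X (EuclideanSpace ℝ (Fin p))) G ∧
      ∀ g ∈ G, ∀ z : Y × EuclideanSpace ℝ (Fin p),
        ∀ S : Finset X, (∀ x ∈ S, (f x, g x) = z) → S.card ≤ n := by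
  obtain ⟨B, hBm, hBu, hBp⟩ := aux_perf_of_sigma hf
  let U : ℕ → Set (X →ᵇ EuclideanSpace ℝ (Fin p)) := fun i =>
    {u | ∀ y, AuxSep (1 / ((i : ℝ) + 1)) n (B i ∩ f ⁻¹' {y}) u}
  have hUo : ∀ i, IsOpen[sourceLimitation X (EuclideanSpace ℝ (Fin p))] (U i) := fun i =>
    aux_open_step hf.1 (hBp i) _
  refine ⟨⋂ i, U i, ?_, ?_, ?_⟩
  · letI := sourceLimitation X (EuclideanSpace ℝ (Fin p))
    rw [dense_iff_inter_open]
    rintro W hW ⟨g, hg⟩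
    obtain ⟨α, hα, hpos, hαW⟩ := hW g hg
    obtain ⟨h, hhU, hh⟩ := aux_baire U hUo (fun i g α hα hpos =>
      aux_dense_step hineq hf.1 hdim hY (hBp i) (by positivity) g α hα hpos) g α hα hpos
    exact ⟨h, hαW h hh, hhU⟩
  · letI := sourceLimitation X (EuclideanSpace ℝ (Fin p))
    exact IsGδ.iInter_of_isOpen hUo
  · intro g hg z S hS
    by_contra hcon
    push Not at hcon
    obtain ⟨T, hTS, hT⟩ := Finset.exists_subset_card_eq (Nat.succ_le_of_lt hcon)
    let e : Fin (n + 1) ≃ T := (Finset.equivFinOfCardEq hT).symm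
    let x : Fin (n + 1) → X := fun s => (e s : X)
    have hxi : Function.Injective x := Subtype.val_injective.comp e.injective
    have hxS : ∀ s, x s ∈ S := fun s => hTS (e s).2
    have h1 : ∀ᶠ i in Filter.atTop, ∀ s, x s ∈ B i := by
      rw [Filter.eventually_all]
      intro s
      have : x s ∈ ⋃ i, B i := hBu ▸ mem_univ _
      obtain ⟨i, hi⟩ := mem_iUnion.1 this
      filter_upwards [Filter.eventually_ge_atTop i] with j hj using hBm hj hi
    have h2 : ∀ᶠ i : ℕ in Filter.atTop, ∀ s s', s ≠ s' →
        1 / ((i : ℝ) + 1) ≤ dist (x s) (x s') := by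
      rw [Filter.eventually_all]
      intro s
      rw [Filter.eventually_all]
      intro s'
      by_cases hss : s = s'
      · exact Filter.Eventually.of_forall fun i h => absurd hss h
      · have h3 : 0 < dist (x s) (x s') := dist_pos.2 (hxi.ne hss)
        have h4 := (tendsto_one_div_add_atTop_nhds_zero_nat (𝕜 := ℝ)).eventually
          (gt_mem_nhds h3)
        filter_upwards [h4] with i hi _ using hi.le
    obtain ⟨i, hi1, hi2⟩ := (h1.and h2).exists
    refine mem_iInter.1 hg i z.1 x (fun s => ⟨hi1 s, ?_⟩) hi2 fun s s' => ?_
    · exact congrArg Prod.fst (hS _ (hxS s))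
    · exact (congrArg Prod.snd (hS _ (hxS s))).trans (congrArg Prod.snd (hS _ (hxS s'))).symm

/-- If `k + m + 1 ≤ (p - k) n`, then for any σ-perfect map `f` with
`dim f ≤ k` and `dim Y ≤ m`, almost all bounded maps `g : X → ℝ^p` (with respect to the
source limitation topology) are such that `f × g` is at most `n`-to-one. -/
theorem statement1 {X Y : Type*} [TopologicalSpace X] [TopologicalSpace.MetrizableSpace X]
    [TopologicalSpace Y] [TopologicalSpace.MetrizableSpace Y]
    (k p m n : ℕ) (hineq : (k : ℤ) + m + 1 ≤ ((p : ℤ) - k) * n)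
    (f : X → Y) (hf : IsSigmaPerfectMap f)
    (hdimf : DimMapLE f k) (hdimY : CovDimLE Y m) :
    ∃ G : Set (X →ᵇ EuclideanSpace ℝ (Fin p)),
      @Dense _ (sourceLimitation X (EuclideanSpace ℝ (Fin p))) G ∧
      @IsGδ _ (sourceLimitation X (EuclideanSpace ℝ (Fin p))) G ∧
      ∀ g ∈ G, ∀ z : Y × EuclideanSpace ℝ (Fin p),
        ∀ S : Finset X, (∀ x ∈ S, (f x, g x) = z) → S.card ≤ n := by
  have hineq' : m + (n + 1) * k < n * p := by
    zify
    nlinarith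
  letI := TopologicalSpace.metrizableSpaceMetric X
  letI := TopologicalSpace.metrizableSpaceMetric Y
  exact aux_main hineq' hf (fun y => aux_covdim_of_int (hdimf y)) (aux_covdim_of_int hdimY)
end

section
/- Let f : X → Y be a σ-perfect map between metrizable spaces with dim f ≤ k and dim Y ≤ m. Then, for any p ≥ 1, the space C*(X, ℝ^{p+k}) with the source limitation topology contains a dense G_δ-subset consisting of maps g such that |(f×g)⁻¹(z)| ≤ max{k + m − p + 2, 1} for all z ∈ Y × ℝ^{p+k}. -/
open Set Topology Metric BoundedContinuousFunction

/-- order at most `m + 1` at the point `y` -/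
def OrdLE {ι Y : Type*} (V : ι → Set Y) (m : ℕ) (y : Y) : Prop :=
  ∀ A : Finset ι, (∀ j ∈ A, y ∈ V j) → A.card ≤ m + 1

theorem OrdLE.mono {ι Y : Type*} {V V' : ι → Set Y} {m : ℕ} {y : Y} (h : OrdLE V m y)
    (hs : ∀ j, V' j ⊆ V j) : OrdLE V' m y :=
  fun A hA => h A fun j hj => hs j (hA j hj)

theorem OrdLE.finite {ι Y : Type*} {V : ι → Set Y} {m : ℕ} {y : Y} (h : OrdLE V m y) :
    {j | y ∈ V j}.Finite := by
  by_contra hinf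
  obtain ⟨t, ht, hc⟩ := Set.Infinite.exists_subset_card_eq hinf (m + 2)
  have := h t (fun j hj => ht hj)
  omega

theorem covdim_mono {Y : Type*} [TopologicalSpace Y] {a b : ℕ} (h : a ≤ b)
    (hY : CovDimLENat Y a) : CovDimLENat Y b := by
  intro U h1 h2 h3
  obtain ⟨V, a1, a2, a3, a4⟩ := hY U h1 h2 h3
  exact ⟨V, a1, a2, a3, fun x => ⟨(a4 x).1, (a4 x).2.trans (by omega)⟩⟩

theorem covdim_nat {Y : Type*} [TopologicalSpace Y] {m : ℕ} (h : CovDimLE Y (m : ℤ)) :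
    CovDimLENat Y m := by
  rcases h with h | ⟨k, hk, h⟩
  · intro U h1 h2 h3
    exact ⟨U, h2, h3, fun V hV => ⟨V, hV, subset_rfl⟩, fun x => (h.false x).elim⟩
  · exact covdim_mono (by exact_mod_cast hk) h

theorem merge_lemma {Y ι : Type*} [TopologicalSpace Y] [Finite ι] {m : ℕ} (hY : CovDimLENat Y m)
    (U : ι → Set Y) (hU : ∀ i, IsOpen (U i)) (hc : ⋃ i, U i = univ) :
    ∃ D : ι → Set Y, (∀ i, IsOpen (D i)) ∧ (∀ i, D i ⊆ U i) ∧ (⋃ i, D i = univ) ∧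
      ∀ y, OrdLE D m y := by
  classical
  obtain ⟨𝒱, h1, h2, h3, h4⟩ := hY (range U) (finite_range U) (by rintro _ ⟨i, rfl⟩; exact hU i)
    (by rw [sUnion_range]; exact hc)
  have h3' : ∀ V : 𝒱, ∃ i, V.1 ⊆ U i := by
    rintro ⟨V, hV⟩
    obtain ⟨_, ⟨i, rfl⟩, h⟩ := h3 V hV
    exact ⟨i, h⟩
  choose τ hτ using h3'
  refine ⟨fun j => ⋃ V : 𝒱, ⋃ _ : τ V = j, V.1, fun j => ?_, fun j => ?_, ?_, fun y A hA => ?_⟩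
  · exact isOpen_iUnion fun V => isOpen_iUnion fun _ => h1 _ V.2
  · exact iUnion_subset fun V => iUnion_subset fun h => h ▸ hτ V
  · refine eq_univ_of_forall fun y => ?_
    have : y ∈ ⋃₀ 𝒱 := h2 ▸ mem_univ y
    obtain ⟨V, hV, hy⟩ := this
    simp only [mem_iUnion]
    exact ⟨τ ⟨V, hV⟩, ⟨V, hV⟩, rfl, hy⟩
  · have : ∀ j : A, ∃ V : 𝒱, τ V = j ∧ y ∈ V.1 := by
      rintro ⟨j, hj⟩
      have := hA j hj
      simp only [mem_iUnion] at this
      obtain ⟨V, h, hy⟩ := this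
      exact ⟨V, h, hy⟩
    choose W hW hy using this
    have hinj : Function.Injective W := fun a b hab => Subtype.ext (by rw [← hW, ← hW, hab])
    have hle := h4 y
    have : (A.attach.image fun j => (W j).1).card ≤ {V ∈ 𝒱 | y ∈ V}.ncard := by
      rw [← ncard_coe_finset]
      refine ncard_le_ncard ?_ hle.1
      intro V hV
      simp only [Finset.coe_image, mem_image] at hV
      obtain ⟨j, _, rfl⟩ := hV
      exact ⟨(W j).2, hy j⟩
    have hce : (A.attach.image fun j => (W j).1).card = A.card :=
      (Finset.card_image_of_injective _ (Subtype.val_injective.comp hinj)).trans A.card_attach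
    rw [hce] at this
    exact this.trans hle.2

theorem stage_lemma {Y ι : Type*} [TopologicalSpace Y] {m : ℕ} (hY : CovDimLENat Y m)
    (V : ℕ → Set Y) (hV : ∀ i, IsOpen (V i)) (hc : ⋃ i, V i = univ)
    (S : ι → Set Y) (hS : ∀ i, IsClosed (S i)) (hlf : LocallyFinite S)
    (hd : ∀ y i j, y ∈ S i → y ∈ S j → i = j)
    (hfin : ∀ i, ∃ n : ℕ, ∀ j, n ≤ j → ∀ y ∈ S i, y ∉ V j) :
    ∃ V' : ℕ → Set Y, (∀ i, IsOpen (V' i)) ∧ (∀ i, V' i ⊆ V i) ∧ (⋃ i, V' i = univ) ∧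
      ∀ i, ∀ y ∈ S i, OrdLE V' m y := by
  classical
  have key : ∀ i, ∃ D : ℕ → Set Y, (∀ j, IsOpen (D j)) ∧
      (∀ y ∈ S i, ∃ j, y ∈ D j ∧ y ∈ V j) ∧
      ∀ y ∈ S i, OrdLE (fun j => V j ∩ D j) m y := by
    intro i
    obtain ⟨n, hn⟩ := hfin i
    obtain ⟨D, d1, d2, d3, d4⟩ := merge_lemma hY (fun j : Fin n ⊕ Unit =>
      Sum.elim (fun j : Fin n => V j) (fun _ => (S i)ᶜ) j) (by
        rintro (j | j)
        · exact hV _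
        · exact (hS i).isOpen_compl) (by
        refine eq_univ_of_forall fun y => ?_
        by_cases hy : y ∈ S i
        · have : y ∈ ⋃ i, V i := hc ▸ mem_univ y
          obtain ⟨j, hj⟩ := mem_iUnion.1 this
          have hjn : j < n := by
            by_contra h
            exact hn j (not_lt.1 h) y hy hj
          exact mem_iUnion.2 ⟨Sum.inl ⟨j, hjn⟩, hj⟩
        · exact mem_iUnion.2 ⟨Sum.inr (), hy⟩)
    refine ⟨fun j => if h : j < n then D (Sum.inl ⟨j, h⟩) else ∅, fun j => ?_, fun y hy => ?_,
      fun y hy A hA => ?_⟩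
    · dsimp only
      split_ifs
      · exact d1 _
      · exact isOpen_empty
    · have : y ∈ ⋃ i, D i := d3 ▸ mem_univ y
      obtain ⟨j | j, hj⟩ := mem_iUnion.1 this
      · refine ⟨j, ?_, d2 _ hj⟩
        simpa using hj
      · exact absurd hy (d2 _ hj)
    · have hlt : ∀ j ∈ A, ∃ h : j < n, y ∈ D (Sum.inl ⟨j, h⟩) := by
        intro j hj
        have := (hA j hj).2
        dsimp only at this
        split_ifs at this with h
        · exact ⟨h, this⟩
        · exact this.elim
      have := d4 y (A.attach.image fun j => Sum.inl ⟨j.1, (hlt j.1 j.2).1⟩) (by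
        intro j hj
        simp only [Finset.mem_image] at hj
        obtain ⟨a, _, rfl⟩ := hj
        exact (hlt a.1 a.2).2)
      rw [Finset.card_image_of_injective, Finset.card_attach] at this
      · exact this
      · intro a b hab
        have := Sum.inl.inj hab
        exact Subtype.ext (Fin.mk.inj this)
  choose D d1 d2 d3 using key
  refine ⟨fun j => V j ∩ (⋃ i, S i \ D i j)ᶜ, fun j => ?_, fun j => inter_subset_left, ?_, ?_⟩
  · refine (hV j).inter (isOpen_compl_iff.2 ?_)
    refine LocallyFinite.isClosed_iUnion (hlf.subset fun i => sdiff_subset) fun i => ?_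
    exact (hS i).sdiff (d1 i j)
  · refine eq_univ_of_forall fun y => ?_
    by_cases hy : ∃ i, y ∈ S i
    · obtain ⟨i, hi⟩ := hy
      obtain ⟨j, hj, hj'⟩ := d2 i y hi
      refine mem_iUnion.2 ⟨j, hj', ?_⟩
      simp only [mem_compl_iff, mem_iUnion, not_exists]
      rintro i' ⟨h1, h2⟩
      rw [hd y i' i h1 hi] at h2
      exact h2 hj
    · have : y ∈ ⋃ i, V i := hc ▸ mem_univ y
      obtain ⟨j, hj⟩ := mem_iUnion.1 this
      refine mem_iUnion.2 ⟨j, hj, ?_⟩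
      simp only [mem_compl_iff, mem_iUnion, not_exists]
      rintro i' ⟨h1, h2⟩
      exact hy ⟨i', h1⟩
  · intro i y hy A hA
    refine d3 i y hy A fun j hj => ⟨(hA j hj).1, ?_⟩
    have := (hA j hj).2
    simp only [mem_compl_iff, mem_iUnion, not_exists] at this
    by_contra h
    exact this i ⟨hy, h⟩

theorem locallyFinite_slabs (e : ℝ) : LocallyFinite fun n : ℕ => Icc (2 * (n : ℝ) + e) (2 * n + e + 1) := by
  intro x
  refine ⟨Metric.ball x 1, Metric.ball_mem_nhds _ one_pos, ?_⟩
  refine (finite_Iic ⌈x + 1 - e⌉₊).subset ?_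
  rintro n ⟨z, hz1, hz2⟩
  rw [Metric.mem_ball, Real.dist_eq, abs_lt] at hz2
  have := Nat.le_ceil (x + 1 - e)
  have h3 : (n : ℝ) ≤ ⌈x + 1 - e⌉₊ := by
    have hn : (0 : ℝ) ≤ n := Nat.cast_nonneg n
    linarith [hz1.1, hz2.2]
  exact_mod_cast h3

theorem dowker_countable {Y : Type*} [TopologicalSpace Y] [TopologicalSpace.MetrizableSpace Y]
    {m : ℕ} (hY : CovDimLENat Y m)
    (V : ℕ → Set Y) (hV : ∀ i, IsOpen (V i)) (hc : ⋃ i, V i = univ) :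
    ∃ V' : ℕ → Set Y, (∀ i, IsOpen (V' i)) ∧ (∀ i, V' i ⊆ V i) ∧ (⋃ i, V' i = univ) ∧
      ∀ y, OrdLE V' m y := by
  let _ := TopologicalSpace.metrizableSpaceMetric Y
  obtain ⟨φ, hφ⟩ := PartitionOfUnity.exists_isSubordinate isClosed_univ V hV hc.ge
  let u : Y → ℝ := fun y => ∑ᶠ i, φ i y • ((i : ℕ) : ℝ)
  have hu : Continuous u := φ.continuous_finsum_smul (g := fun i _ => (i : ℝ))
    fun i x _ => continuousAt_const
  have husum : ∀ y, u y = ∑ i ∈ φ.finsupport y, φ i y * i := by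
    intro y
    have := φ.sum_finsupport_smul_eq_finsum (x₀ := y) (fun i _ => (i : ℝ))
    simpa [u] using this.symm
  have hmem : ∀ y i, 0 < φ i y → y ∈ V i := fun y i h =>
    hφ i (subset_tsupport _ (by simpa using h.ne'))
  have hlow : ∀ y, ∃ i : ℕ, 0 < φ i y ∧ (i : ℝ) ≤ u y := by
    intro y
    by_contra hcon
    push Not at hcon
    have h1 := φ.sum_finsupport (mem_univ y)
    have h2 : ∑ i ∈ φ.finsupport y, φ i y * u y < ∑ i ∈ φ.finsupport y, φ i y * i := by
      refine Finset.sum_lt_sum_of_nonempty ?_ fun i hi => ?_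
      · rw [Finset.nonempty_iff_ne_empty]
        rintro h
        rw [h] at h1
        simp at h1
      · have : 0 < φ i y := lt_of_le_of_ne (φ.nonneg i y) (by
          rw [PartitionOfUnity.mem_finsupport] at hi
          exact (Ne.symm hi))
        exact mul_lt_mul_of_pos_left (hcon i this) this
    rw [← Finset.sum_mul, h1, ← husum] at h2
    linarith
  have hunn : ∀ y, 0 ≤ u y := fun y => by
    obtain ⟨i, _, h⟩ := hlow y
    exact (Nat.cast_nonneg i).trans h
  obtain ⟨V1, a1, a2, a3, a4⟩ := stage_lemma hY (fun j => V j ∩ {y | (j : ℝ) - 1 < u y})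
    (fun j => (hV j).inter (isOpen_lt continuous_const hu)) (by
      refine eq_univ_of_forall fun y => ?_
      obtain ⟨i, hi, h⟩ := hlow y
      refine mem_iUnion.2 ⟨i, hmem y i hi, ?_⟩
      simp only [mem_ofPred_eq]
      linarith)
    (fun n : ℕ => u ⁻¹' Icc (2 * (n : ℝ) + 0) (2 * n + 0 + 1))
    (fun n => isClosed_Icc.preimage hu)
    ((locallyFinite_slabs 0).preimage_continuous hu) (by
      rintro y i j ⟨h1, h2⟩ ⟨h3, h4⟩
      have q1 : (2 * (i : ℝ)) ≤ 2 * j + 1 := by linarith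
      have q2 : (2 * (j : ℝ)) ≤ 2 * i + 1 := by linarith
      norm_cast at q1 q2
      omega) (by
      intro i
      refine ⟨2 * i + 2, fun j hj y hy hy' => ?_⟩
      have h1 := hy.2
      have h2 := hy'.2
      simp only [mem_ofPred_eq] at h2
      have : (2 * (i : ℝ) + 2) ≤ j := by exact_mod_cast hj
      linarith)
  obtain ⟨V2, b1, b2, b3, b4⟩ := stage_lemma hY V1 a1 a3
    (fun n : ℕ => u ⁻¹' Icc (2 * (n : ℝ) + 1) (2 * n + 1 + 1))
    (fun n => isClosed_Icc.preimage hu)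
    ((locallyFinite_slabs 1).preimage_continuous hu) (by
      rintro y i j ⟨h1, h2⟩ ⟨h3, h4⟩
      have q1 : (2 * (i : ℝ)) ≤ 2 * j + 1 := by linarith
      have q2 : (2 * (j : ℝ)) ≤ 2 * i + 1 := by linarith
      norm_cast at q1 q2
      omega) (by
      intro i
      refine ⟨2 * i + 3, fun j hj y hy hy' => ?_⟩
      have h1 := hy.2
      have h2 := (a2 _ hy').2
      simp only [mem_ofPred_eq] at h2
      have : (2 * (i : ℝ) + 3) ≤ j := by exact_mod_cast hj
      linarith)
  refine ⟨V2, b1, fun i => (b2 i).trans ((a2 i).trans inter_subset_left), b3, fun y => ?_⟩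
  have hfl := Nat.floor_le (hunn y)
  have hfl2 := Nat.lt_floor_add_one (u y)
  rcases Nat.even_or_odd' ⌊u y⌋₊ with ⟨c, hc | hc⟩
  · refine (a4 c y ?_).mono b2
    rw [hc] at hfl hfl2
    push_cast at hfl hfl2
    constructor <;> linarith
  · refine (b4 c y ?_)
    rw [hc] at hfl hfl2
    push_cast at hfl hfl2
    constructor <;> linarith


/-- the set where the coordinates in `A` dominate all the others -/
def DomSet {ι Y : Type*} [TopologicalSpace Y] (ρ : PartitionOfUnity ι Y) (A : Finset ι) : Set Y :=
  {y | ∀ a ∈ A, 0 < ρ a y ∧ ∀ b, b ∉ A → ρ b y < ρ a y}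

theorem isOpen_domSet {ι Y : Type*} [TopologicalSpace Y] (ρ : PartitionOfUnity ι Y)
    (A : Finset ι) : IsOpen (DomSet ρ A) := by
  classical
  rw [isOpen_iff_mem_nhds]
  intro y hy
  obtain ⟨t, ht, hfin⟩ := ρ.locallyFinite y
  have h1 : ∀ᶠ z in 𝓝 y, ∀ a ∈ A, 0 < ρ a z := by
    rw [Filter.eventually_all_finset]
    intro a ha
    exact (ρ a).continuous.continuousAt.eventually (lt_mem_nhds (hy a ha).1)
  have h2 : ∀ᶠ z in 𝓝 y, ∀ a ∈ A, ∀ b ∈ hfin.toFinset, b ∉ A → ρ b z < ρ a z := by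
    rw [Filter.eventually_all_finset]
    intro a ha
    rw [Filter.eventually_all_finset]
    intro b hb
    by_cases hbA : b ∈ A
    · simp [hbA]
    · simp only [hbA, not_false_eq_true, forall_const]
      exact (ρ b).continuous.continuousAt.eventually_lt (ρ a).continuous.continuousAt
        ((hy a ha).2 b hbA)
  filter_upwards [h1, h2, ht] with z hz1 hz2 hz3
  intro a ha
  refine ⟨hz1 a ha, fun b hb => ?_⟩
  by_cases hbf : b ∈ hfin.toFinset
  · exact hz2 a ha b hbf hb
  · have : ρ b z = 0 := by
      by_contra hne
      refine hbf ?_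
      rw [Set.Finite.mem_toFinset]
      exact ⟨z, hne, hz3⟩
    rw [this]
    exact hz1 a ha

theorem domSet_unique {ι Y : Type*} [TopologicalSpace Y] (ρ : PartitionOfUnity ι Y)
    {A B : Finset ι} {y : Y} (hA : y ∈ DomSet ρ A) (hB : y ∈ DomSet ρ B)
    (hc : A.card = B.card) : A = B := by
  by_contra hne
  have h1 : ¬ A ⊆ B := fun h => hne (Finset.eq_of_subset_of_card_le h hc.ge)
  have h2 : ¬ B ⊆ A := fun h => hne (Finset.eq_of_subset_of_card_le h hc.le).symm
  rw [Finset.not_subset] at h1 h2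
  obtain ⟨a, ha, ha'⟩ := h1
  obtain ⟨b, hb, hb'⟩ := h2
  exact lt_asymm ((hA a ha).2 b hb') ((hB b hb).2 a ha')

theorem dom_lemma {ι Y : Type*} [TopologicalSpace Y] [Nonempty Y] (ρ : PartitionOfUnity ι Y) :
    ∃ (V : ℕ → Set Y) (w : ℕ → Y → ι), (∀ n, IsOpen (V n)) ∧
      (∀ n, ∀ y ∈ V n, 0 < ρ (w n y) y ∧ ∀ᶠ y' in 𝓝 y, w n y' = w n y) ∧
      (∀ y, ∃ n, n + 1 = (ρ.finsupport y).card ∧ y ∈ V n) := by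
  classical
  have hne : Nonempty ι := by
    obtain ⟨y⟩ := ‹Nonempty Y›
    obtain ⟨i, _⟩ := ρ.exists_pos (mem_univ y)
    exact ⟨i⟩
  let P : ℕ → Y → Finset ι → Prop := fun n y A => A.card = n + 1 ∧ y ∈ DomSet ρ A
  let el : Finset ι → ι := fun A => Classical.epsilon fun a => a ∈ A
  let w : ℕ → Y → ι := fun n y => el (Classical.epsilon (P n y))
  have hw : ∀ n y A, P n y A → w n y = el A := by
    intro n y A hA
    have := Classical.epsilon_spec (p := P n y) ⟨A, hA⟩
    have : Classical.epsilon (P n y) = A :=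
      domSet_unique ρ this.2 hA.2 (this.1.trans hA.1.symm)
    simp only [w, this]
  refine ⟨fun n => ⋃ A : Finset ι, ⋃ _ : A.card = n + 1, DomSet ρ A, w, fun n => ?_,
    fun n y hy => ?_, fun y => ?_⟩
  · exact isOpen_iUnion fun A => isOpen_iUnion fun _ => isOpen_domSet ρ A
  · simp only [mem_iUnion] at hy
    obtain ⟨A, hc, hA⟩ := hy
    have hel : el A ∈ A := by
      refine Classical.epsilon_spec (p := fun a => a ∈ A) ?_
      exact Finset.card_pos.1 (by omega)
    rw [hw n y A ⟨hc, hA⟩]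
    refine ⟨(hA _ hel).1, ?_⟩
    filter_upwards [(isOpen_domSet ρ A).mem_nhds hA] with z hz
    exact hw n z A ⟨hc, hz⟩
  · have hpos : 0 < (ρ.finsupport y).card := by
      rw [Finset.card_pos]
      obtain ⟨i, hi⟩ := ρ.exists_pos (mem_univ y)
      exact ⟨i, by rw [PartitionOfUnity.mem_finsupport]; exact hi.ne'⟩
    refine ⟨(ρ.finsupport y).card - 1, by omega, ?_⟩
    simp only [mem_iUnion]
    refine ⟨ρ.finsupport y, by omega, fun a ha => ?_⟩
    rw [PartitionOfUnity.mem_finsupport] at ha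
    have hpa : 0 < ρ a y := lt_of_le_of_ne (ρ.nonneg a y) (Ne.symm ha)
    refine ⟨hpa, fun b hb => ?_⟩
    rw [PartitionOfUnity.mem_finsupport] at hb
    have : ρ b y = 0 := by
      by_contra h
      exact hb h
    rw [this]
    exact hpa

/-- one colour: a function supported in an open set that splits into a discrete-like family -/
def ColorFam {ι Y : Type*} [TopologicalSpace Y] (O : ι → Set Y) (σ : Y → ℝ) : Prop :=
  Continuous σ ∧ (∀ y, σ y ∈ Icc (0 : ℝ) 1) ∧ ∃ V : Set Y, IsOpen V ∧ tsupport σ ⊆ V ∧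
    ∃ w : Y → ι, ∀ y ∈ V, y ∈ O (w y) ∧ ∀ᶠ y' in 𝓝 y, w y' = w y

theorem ColorFam.mono {ι κ Y : Type*} [TopologicalSpace Y] {O : ι → Set Y} {O' : κ → Set Y}
    {σ : Y → ℝ} (h : ColorFam O σ) (e : ι → κ) (he : ∀ i, O i ⊆ O' (e i)) : ColorFam O' σ := by
  obtain ⟨h1, h2, V, h3, h4, w, h5⟩ := h
  refine ⟨h1, h2, V, h3, h4, fun y => e (w y), fun y hy => ⟨he _ (h5 y hy).1, ?_⟩⟩
  filter_upwards [(h5 y hy).2] with z hz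
  rw [hz]

theorem color_lemma {ι Y : Type*} [TopologicalSpace Y] [TopologicalSpace.MetrizableSpace Y]
    {m : ℕ} (hY : CovDimLENat Y m) (O : ι → Set Y) (hO : ∀ i, IsOpen (O i))
    (hc : ⋃ i, O i = univ) :
    ∃ σ : Fin (m + 1) → Y → ℝ, (∀ i, ColorFam O (σ i)) ∧ ∀ y, ∃ i, σ i y = 1 := by
  classical
  rcases isEmpty_or_nonempty Y with hE | hne
  · refine ⟨fun _ _ => 0, fun i => ⟨continuous_const, fun y => (hE.false y).elim, univ,
      isOpen_univ, subset_univ _, fun y => (hE.false y).elim, fun y => (hE.false y).elim⟩,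
      fun y => (hE.false y).elim⟩
  let _ := TopologicalSpace.metrizableSpaceMetric Y
  obtain ⟨ρ, hρ⟩ := PartitionOfUnity.exists_isSubordinate isClosed_univ O hO hc.ge
  obtain ⟨V, w, hV, hw, hcov⟩ := dom_lemma ρ
  obtain ⟨V', h1, h2, h3, h4⟩ := dowker_countable hY V hV (eq_univ_of_forall fun y => by
    obtain ⟨n, _, h⟩ := hcov y
    exact mem_iUnion.2 ⟨n, h⟩)
  obtain ⟨ψ, hψ⟩ := PartitionOfUnity.exists_isSubordinate isClosed_univ V' h1 h3.ge
  obtain ⟨V2, w2, hV2, hw2, hcov2⟩ := dom_lemma ψ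
  have hmem : ∀ y i, 0 < ψ i y → y ∈ V' i := fun y i h =>
    hψ i (subset_tsupport _ (by simpa using h.ne'))
  have hmemO : ∀ y i, 0 < ρ i y → y ∈ O i := fun y i h =>
    hρ i (subset_tsupport _ (by simpa using h.ne'))
  have hcov3 : ⋃ n : Fin (m + 1), V2 n = univ := by
    refine eq_univ_of_forall fun y => ?_
    obtain ⟨n, hn, hy⟩ := hcov2 y
    have := h4 y (ψ.finsupport y) (fun j hj => hmem y j (by
      rw [PartitionOfUnity.mem_finsupport] at hj
      exact lt_of_le_of_ne (ψ.nonneg j y) (Ne.symm hj)))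
    exact mem_iUnion.2 ⟨⟨n, by omega⟩, hy⟩
  obtain ⟨T, hT1, hT2, hT3⟩ := exists_iUnion_eq_closed_subset (u := fun n : Fin (m + 1) => V2 n)
    (fun n => hV2 n) (fun y => toFinite _) hcov3
  have key : ∀ n : Fin (m + 1), ∃ σ : Y → ℝ, Continuous σ ∧ (∀ y, σ y ∈ Icc (0 : ℝ) 1) ∧
      tsupport σ ⊆ V2 n ∧ ∀ y ∈ T n, σ y = 1 := by
    intro n
    obtain ⟨Z, hZ1, hZ2, hZ3⟩ := normal_exists_closure_subset (hT2 n) (hV2 n) (hT3 n)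
    obtain ⟨s, hs1, hs2, hs3⟩ := exists_continuous_zero_one_of_isClosed
      (isClosed_compl_iff.2 hZ1) (hT2 n) (disjoint_compl_left_iff_subset.2 hZ2)
    refine ⟨s, s.continuous, hs3, (closure_mono ?_).trans hZ3, fun y hy => hs2 hy⟩
    intro y hy
    by_contra hyZ
    exact hy (hs1 hyZ)
  choose σ s1 s2 s3 s4 using key
  refine ⟨σ, fun n => ⟨s1 n, s2 n, V2 n, hV2 n, s3 n, fun y => w (w2 n y) y, fun y hy => ?_⟩,
    fun y => ?_⟩
  · obtain ⟨g1, g2⟩ := hw2 n y hy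
    obtain ⟨g3, g4⟩ := hw _ y (h2 _ (hmem _ _ g1))
    refine ⟨hmemO _ _ g3, ?_⟩
    filter_upwards [g2, g4] with z hz1 hz2
    rw [hz1, hz2]
  · have : y ∈ ⋃ i, T i := hT1 ▸ mem_univ y
    obtain ⟨i, hi⟩ := mem_iUnion.1 this
    exact ⟨i, s4 i y hi⟩


theorem locLip_of_contDiff {E F : Type*} [NormedAddCommGroup E] [NormedSpace ℝ E]
    [NormedAddCommGroup F] [NormedSpace ℝ F] {f : E → F} (hf : ContDiff ℝ 1 f) :
    LocallyLipschitz f := by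
  intro x
  obtain ⟨K, t, ht, h⟩ := hf.contDiffAt.exists_lipschitzOnWith (x := x)
  exact ⟨K, t, ht, h⟩

/-- `Q` is covered by countably many locally Lipschitz images of `ℝ^d`, `d < l`. -/
def LD {C : Type*} [NormedAddCommGroup C] (l : ℕ) (Q : Set C) : Prop :=
  ∃ S : Set (Set C), S.Countable ∧ Q ⊆ ⋃₀ S ∧ ∀ R ∈ S, ∃ d, d < l ∧
    ∃ P : (Fin d → ℝ) → C, LocallyLipschitz P ∧ R ⊆ range P

section LDsec
variable {C : Type*} [NormedAddCommGroup C]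

theorem LD.mono {l l' : ℕ} {Q Q' : Set C} (h : LD l Q) (hl : l ≤ l') (hQ : Q' ⊆ Q) : LD l' Q' := by
  obtain ⟨S, h1, h2, h3⟩ := h
  refine ⟨S, h1, hQ.trans h2, fun R hR => ?_⟩
  obtain ⟨d, hd, P, hP⟩ := h3 R hR
  exact ⟨d, by omega, P, hP⟩

theorem LD.empty (l : ℕ) : LD l (∅ : Set C) :=
  ⟨∅, countable_empty, empty_subset _, fun _ hR => hR.elim⟩

theorem LD.iUnion {ι : Type*} {l : ℕ} {Q : ι → Set C} {s : Set ι} (hs : s.Countable)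
    (h : ∀ i ∈ s, LD l (Q i)) : LD l (⋃ i ∈ s, Q i) := by
  choose! S h1 h2 h3 using h
  refine ⟨⋃ i ∈ s, S i, hs.biUnion fun i hi => h1 i hi, ?_, ?_⟩
  · refine iUnion₂_subset fun i hi => (h2 i hi).trans ?_
    exact sUnion_subset_sUnion (subset_biUnion_of_mem hi)
  · intro R hR
    simp only [mem_iUnion] at hR
    obtain ⟨i, hi, hR⟩ := hR
    exact h3 i hi R hR

theorem LD.union {l : ℕ} {Q Q' : Set C} (h : LD l Q) (h' : LD l Q') : LD l (Q ∪ Q') := by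
  obtain ⟨S, h1, h2, h3⟩ := h
  obtain ⟨S', h1', h2', h3'⟩ := h'
  refine ⟨S ∪ S', h1.union h1', ?_, ?_⟩
  · rw [sUnion_union]
    exact union_subset_union h2 h2'
  · rintro R (hR | hR)
    · exact h3 R hR
    · exact h3' R hR

theorem LD.singleton (l : ℕ) (g : C) : LD (l + 1) {g} :=
  ⟨{{g}}, countable_singleton _, by simp, by
    rintro R rfl
    exact ⟨0, by omega, fun _ => g, LocallyLipschitz.const g, by simp⟩⟩

theorem LD.cone {l : ℕ} {Q : Set C} (h : LD l Q) {F : C × ℝ → C} (hF : LocallyLipschitz F) :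
    LD (l + 1) (F '' (Q ×ˢ univ)) := by
  obtain ⟨S, h1, h2, h3⟩ := h
  refine ⟨(fun R => F '' (R ×ˢ univ)) '' S, h1.image _, ?_, ?_⟩
  · rintro _ ⟨⟨c, s⟩, ⟨hc, _⟩, rfl⟩
    obtain ⟨R, hR, hcR⟩ := h2 hc
    exact ⟨_, ⟨R, hR, rfl⟩, ⟨(c, s), ⟨hcR, mem_univ _⟩, rfl⟩⟩
  · rintro _ ⟨R, hR, rfl⟩
    obtain ⟨d, hd, P, hP, hRP⟩ := h3 R hR
    refine ⟨d + 1, by omega, fun t => F (P (fun i => t i.succ), t 0), ?_, ?_⟩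
    · refine hF.comp (LocallyLipschitz.prodMk (hP.comp ?_) ?_)
      · exact locLip_of_contDiff (by fun_prop)
      · exact locLip_of_contDiff (by fun_prop)
    · rintro _ ⟨⟨c, s⟩, ⟨hc, _⟩, rfl⟩
      obtain ⟨t, rfl⟩ := hRP hc
      exact ⟨Fin.cons s t, by simp⟩

end LDsec

universe u

section Sel
variable {Y C : Type*} [TopologicalSpace Y] [NormedAddCommGroup C] [NormedSpace ℝ C]

/-- straight line interpolation -/
def lerp (s : ℝ) (c c' : C) : C := (1 - s) • c + s • c'

theorem lerp_zero (c c' : C) : lerp 0 c c' = c := by simp [lerp]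
theorem lerp_one (c c' : C) : lerp 1 c c' = c' := by simp [lerp]

theorem lerp_cont {Z : Type*} [TopologicalSpace Z] {s : Z → ℝ} {c c' : Z → C} (h1 : Continuous s)
    (h2 : Continuous c) (h3 : Continuous c') : Continuous fun z => lerp (s z) (c z) (c' z) := by
  unfold lerp
  fun_prop

theorem lerp_locLip {Z : Type*} [PseudoEMetricSpace Z] {s : Z → ℝ} {c c' : Z → C}
    (h1 : LocallyLipschitz s) (h2 : LocallyLipschitz c) (h3 : LocallyLipschitz c') :
    LocallyLipschitz fun z => lerp (s z) (c z) (c' z) := by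
  have : LocallyLipschitz fun q : ℝ × C × C => lerp q.1 q.2.1 q.2.2 := by
    unfold lerp
    exact locLip_of_contDiff (by fun_prop)
  exact this.comp (h1.prodMk (h2.prodMk h3))

theorem locLip_fst {A B : Type*} [PseudoEMetricSpace A] [PseudoEMetricSpace B] :
    LocallyLipschitz (Prod.fst : A × B → A) := LipschitzWith.prod_fst.locallyLipschitz
theorem locLip_snd {A B : Type*} [PseudoEMetricSpace A] [PseudoEMetricSpace B] :
    LocallyLipschitz (Prod.snd : A × B → B) := LipschitzWith.prod_snd.locallyLipschitz

/-- step property -/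
def StepProp (m : ℕ) (g : C) (H : Set (Y × C)) : Prop :=
  ∀ y, ∀ K : Set C, ∀ l ≤ m, IsCompact K → LD l K → (∀ c ∈ K, (y, c) ∈ H) →
    ∃ I : C → C, LocallyLipschitz I ∧ (y, I g) ∈ H ∧ ∀ c ∈ K, ∀ s ∈ Icc (0 : ℝ) 1,
      (y, lerp s c (I c)) ∈ H ∧ (y, I (lerp s c g)) ∈ H

structure SelState (H : Set (Y × C)) (l : ℕ) (K : Y → Set C) : Prop where
  cpt : ∀ y, IsCompact (K y)
  sub : ∀ y, ∀ c ∈ K y, (y, c) ∈ H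
  usc : ∀ y, ∀ᶠ y' in 𝓝 y, K y' ⊆ K y
  ld : ∀ y, LD l (K y)

theorem state_step [TopologicalSpace.MetrizableSpace Y] {m : ℕ} {g : C} {H : Set (Y × C)}
    (hH : IsOpen H) (hB : StepProp m g H) {l : ℕ} (hl : l ≤ m) {K : Y → Set C}
    (hK : SelState H l K) :
    ∃ (u : Y → Set Y) (I : Y → C → C) (K' : Y → Set C), (∀ z, IsOpen (u z)) ∧
      (⋃ z, u z = univ) ∧ (∀ z, Continuous (I z)) ∧ SelState H (l + 1) K' ∧
      ∀ z, ∀ y ∈ u z, I z g ∈ K' y ∧ ∀ c ∈ K y, ∀ s ∈ Icc (0 : ℝ) 1,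
        lerp s c (I z c) ∈ K' y ∧ I z (lerp s c g) ∈ K' y := by
  classical
  let _ := TopologicalSpace.metrizableSpaceMetric Y
  have h0 := fun y => hB y (K y) l hl (hK.cpt y) (hK.ld y) (hK.sub y)
  choose I hI1 hI2 hI3 using h0
  let N : Y → Set C := fun y =>
    ((fun q : C × ℝ => lerp q.2 q.1 (I y q.1)) '' (K y ×ˢ Icc 0 1) ∪
      (fun q : C × ℝ => I y (lerp q.2 q.1 g)) '' (K y ×ˢ Icc 0 1)) ∪ {I y g}
  have hF1 : ∀ y, LocallyLipschitz (fun q : C × ℝ => lerp q.2 q.1 (I y q.1)) := fun y =>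
    lerp_locLip locLip_snd locLip_fst ((hI1 y).comp locLip_fst)
  have hF2 : ∀ y, LocallyLipschitz (fun q : C × ℝ => I y (lerp q.2 q.1 g)) := fun y =>
    (hI1 y).comp (lerp_locLip locLip_snd locLip_fst (LocallyLipschitz.const g))
  have hNc : ∀ y, IsCompact (N y) := fun y =>
    ((((hK.cpt y).prod isCompact_Icc).image (hF1 y).continuous).union
      (((hK.cpt y).prod isCompact_Icc).image (hF2 y).continuous)).union isCompact_singleton
  have hNl : ∀ y, LD (l + 1) (N y) := fun y =>
    ((((hK.ld y).cone (hF1 y)).mono le_rfl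
      (image_mono (prod_mono subset_rfl (subset_univ _)))).union
      (((hK.ld y).cone (hF2 y)).mono le_rfl
      (image_mono (prod_mono subset_rfl (subset_univ _))))).union (LD.singleton l _)
  have hNs : ∀ y, ∀ c ∈ N y, (y, c) ∈ H := by
    rintro y _ ((⟨⟨c, s⟩, ⟨hc, hs⟩, rfl⟩ | ⟨⟨c, s⟩, ⟨hc, hs⟩, rfl⟩) | rfl)
    · exact (hI3 y c hc s hs).1
    · exact (hI3 y c hc s hs).2
    · exact hI2 y
  have hO : ∀ y, ∃ O : Set Y, IsOpen O ∧ y ∈ O ∧ ∀ y' ∈ O, (∀ c ∈ N y, (y', c) ∈ H) ∧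
      K y' ⊆ K y := by
    intro y
    have e1 : ∀ᶠ y' in 𝓝 y, ∀ c ∈ N y, (y', c) ∈ H :=
      (hNc y).eventually_forall_of_forall_eventually (P := fun y' c => (y', c) ∈ H)
        fun c hc => hH.mem_nhds (hNs y c hc)
    obtain ⟨O, h1, h2, h3⟩ := _root_.eventually_nhds_iff.1 (e1.and (hK.usc y))
    exact ⟨O, h2, h3, h1⟩
  choose O hO1 hO2 hO3 using hO
  obtain ⟨v, v1, v2, v3, v4⟩ := precise_refinement O hO1
    (eq_univ_of_forall fun y => mem_iUnion.2 ⟨y, hO2 y⟩)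
  obtain ⟨u, u1, u2, u3⟩ := exists_iUnion_eq_closure_subset v1 (fun y => v3.point_finite y) v2
  have hlf : LocallyFinite fun z => closure (u z) := v3.subset u3
  have hsub : ∀ z, ∀ y ∈ u z, N z ⊆ ⋃ z ∈ {z | y ∈ closure (u z)}, N z := fun z y hy =>
    subset_biUnion_of_mem (u := N) (show z ∈ {z | y ∈ closure (u z)} from subset_closure hy)
  refine ⟨u, I, fun y => ⋃ z ∈ {z | y ∈ closure (u z)}, N z, u2, u1,
    fun z => (hI1 z).continuous, ⟨fun y => ?_, fun y c hc => ?_, fun y => ?_, fun y => ?_⟩, ?_⟩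
  · exact (hlf.point_finite y).isCompact_biUnion fun z _ => hNc z
  · simp only [mem_iUnion] at hc
    obtain ⟨z, hz, hc⟩ := hc
    exact (hO3 z y (v4 z (u3 z hz))).1 c hc
  · filter_upwards [hlf.eventually_subset (fun z => isClosed_closure) y] with y' hy'
    exact biUnion_subset_biUnion_left hy'
  · exact LD.iUnion (hlf.point_finite y).countable fun z _ => hNl z
  · intro z y hy
    have hKK := (hO3 z y (v4 z (u3 z (subset_closure hy)))).2
    refine ⟨hsub z y hy (Or.inr rfl), fun c hc s hs => ⟨hsub z y hy (Or.inl (Or.inl ?_)),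
      hsub z y hy (Or.inl (Or.inr ?_))⟩⟩
    · exact ⟨(c, s), ⟨hKK hc, hs⟩, rfl⟩
    · exact ⟨(c, s), ⟨hKK hc, hs⟩, rfl⟩

/-- two-phase deformation -/
def twoPhase (g : C) (I : C → C) (c : C) (t : ℝ) : C :=
  lerp (min (2 * t) 1) c (I (lerp (max (2 * t - 1) 0) c g))

theorem twoPhase_zero (g : C) (I : C → C) (c : C) : twoPhase g I c 0 = c := by
  simp [twoPhase, lerp]

theorem twoPhase_one (g : C) (I : C → C) (c : C) : twoPhase g I c 1 = I g := by
  have h1 : min (2 * (1 : ℝ)) 1 = 1 := by norm_num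
  have h2 : max (2 * (1 : ℝ) - 1) 0 = 1 := by norm_num
  rw [twoPhase, h1, h2, lerp_one, lerp_one]

theorem claim_sel {Y : Type u} [TopologicalSpace Y] {C : Type*} [NormedAddCommGroup C]
    [NormedSpace ℝ C] [TopologicalSpace.MetrizableSpace Y] {m : ℕ} {g : C} {H : Set (Y × C)}
    (hH : IsOpen H) (hB : StepProp m g H) (r : ℕ) : ∀ (l : ℕ) (K : Y → Set C),
    l + r = m + 1 → SelState H l K → ∃ (ι : Type u) (O : ι → Set Y), (∀ i, IsOpen (O i)) ∧
      (⋃ i, O i = univ) ∧ ∀ σ : Fin r → Y → ℝ, (∀ i, ColorFam O (σ i)) → ∀ s : Y → C,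
      Continuous s → (∀ y, s y ∈ K y ∨ ∃ i, σ i y = 1) →
      ∃ s' : Y → C, Continuous s' ∧ ∀ y, (y, s' y) ∈ H := by
  classical
  induction r with
  | zero =>
    intro l K _ hK
    refine ⟨PUnit, fun _ => univ, fun _ => isOpen_univ, iUnion_const univ, fun σ _ s hs h =>
      ⟨s, hs, fun y => hK.sub y _ ?_⟩⟩
    rcases h y with h | ⟨i, _⟩
    · exact h
    · exact i.elim0
  | succ r ih =>
    intro l K hl hK
    obtain ⟨u, I, K', u1, u2, hI, hK', hstep⟩ := state_step hH hB (by omega : l ≤ m) hK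
    obtain ⟨ι, O, O1, O2, hO⟩ := ih (l + 1) K' (by omega) hK'
    refine ⟨Y × ι, fun q => u q.1 ∩ O q.2, fun q => (u1 _).inter (O1 _), ?_, ?_⟩
    · refine eq_univ_of_forall fun y => ?_
      have a1 : y ∈ ⋃ i, u i := u2 ▸ mem_univ y
      have a2 : y ∈ ⋃ i, O i := O2 ▸ mem_univ y
      obtain ⟨z, hz⟩ := mem_iUnion.1 a1
      obtain ⟨i, hi⟩ := mem_iUnion.1 a2
      exact mem_iUnion.2 ⟨(z, i), hz, hi⟩
    intro σ hσ s hs hs'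
    obtain ⟨c1, c2, V, c3, c4, w, c5⟩ := (hσ 0).mono (O' := u) Prod.fst fun q => inter_subset_left
    have hKsub : ∀ y, K y ⊆ K' y := by
      intro y c hc
      have a1 : y ∈ ⋃ i, u i := u2 ▸ mem_univ y
      obtain ⟨z, hz⟩ := mem_iUnion.1 a1
      have := ((hstep z y hz).2 c hc 0 (by simp)).1
      rwa [lerp_zero] at this
    have hz0 : ∀ y, y ∉ tsupport (σ 0) → σ 0 y = 0 := fun y hy =>
      image_eq_zero_of_notMem_tsupport hy
    refine hO (fun i => σ i.succ) (fun i => (hσ i.succ).mono Prod.snd fun q => inter_subset_right)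
      (fun y => if y ∈ V then twoPhase g (I (w y)) (s y) (σ 0 y) else s y) ?_ ?_
    · rw [continuous_iff_continuousAt]
      intro y
      by_cases hy : y ∈ V
      · have hc : Continuous fun y' => twoPhase g (I (w y)) (s y') (σ 0 y') := by
          unfold twoPhase
          refine lerp_cont (by fun_prop) hs ((hI _).comp ?_)
          exact lerp_cont (by fun_prop) hs continuous_const
        refine hc.continuousAt.congr ?_
        filter_upwards [c3.mem_nhds hy, (c5 y hy).2] with y' h1 h2
        rw [if_pos h1, h2]
      · have hy' : y ∈ (tsupport (σ 0))ᶜ := fun h => hy (c4 h)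
        refine hs.continuousAt.congr ?_
        filter_upwards [(isClosed_tsupport (σ 0)).isOpen_compl.mem_nhds hy'] with y' h1
        rw [hz0 y' h1, twoPhase_zero, ite_self]
    · intro y
      by_cases hy : y ∈ V
      · rw [if_pos hy]
        obtain ⟨d1, d2⟩ := hstep (w y) y (c5 y hy).1
        by_cases h1 : σ 0 y = 1
        · left
          rw [h1, twoPhase_one]
          exact d1
        rcases hs' y with h | ⟨i, hi⟩
        · left
          have ht := c2 y
          rcases le_total (σ 0 y) (1 / 2) with hle | hle
          · have e1 : min (2 * σ 0 y) 1 = 2 * σ 0 y := min_eq_left (by linarith)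
            have e2 : max (2 * σ 0 y - 1) 0 = 0 := max_eq_right (by linarith)
            rw [twoPhase, e1, e2, lerp_zero]
            exact (d2 _ h _ ⟨by linarith [ht.1], by linarith⟩).1
          · have e1 : min (2 * σ 0 y) 1 = 1 := min_eq_right (by linarith)
            have e2 : max (2 * σ 0 y - 1) 0 = 2 * σ 0 y - 1 := max_eq_left (by linarith)
            rw [twoPhase, e1, e2, lerp_one]
            exact (d2 _ h _ ⟨by linarith, by linarith [ht.2]⟩).2
        · rcases Fin.eq_zero_or_eq_succ i with rfl | ⟨j, rfl⟩
          · exact absurd hi h1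
          · exact Or.inr ⟨j, hi⟩
      · rw [if_neg hy]
        rcases hs' y with h | ⟨i, hi⟩
        · exact Or.inl (hKsub y h)
        · rcases Fin.eq_zero_or_eq_succ i with rfl | ⟨j, rfl⟩
          · rw [hz0 y fun h => hy (c4 h)] at hi
            norm_num at hi
          · exact Or.inr ⟨j, hi⟩

theorem selection_core [TopologicalSpace.MetrizableSpace Y] {m : ℕ} (hY : CovDimLENat Y m)
    {g : C} {H : Set (Y × C)} (hH : IsOpen H) (hB : StepProp m g H) :
    ∃ s' : Y → C, Continuous s' ∧ ∀ y, (y, s' y) ∈ H := by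
  obtain ⟨ι, O, h1, h2, h3⟩ := claim_sel hH hB (m + 1) 0 (fun _ => ∅) (by omega)
    ⟨fun _ => isCompact_empty, fun y c hc => hc.elim, fun y => by simp, fun y => LD.empty 0⟩
  obtain ⟨σ, s1, s2⟩ := color_lemma hY O h1 h2
  exact h3 σ s1 (fun _ => g) continuous_const fun y => Or.inr (s2 y)

/-- selection theorem -/
theorem selection [TopologicalSpace.MetrizableSpace Y] {m : ℕ} (hY : CovDimLENat Y m)
    {g : C} {H : Set (Y × C)} (hH : IsOpen H) {α : Y → ℝ} (hα : Continuous α) (hα0 : ∀ y, 0 < α y)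
    (hA : ∀ y, ∀ Q : Set C, IsCompact Q → LD (m + 1) Q → ∀ δ > 0, ∃ I : C → C,
      LocallyLipschitz I ∧ ∀ c ∈ Q, ‖I c - c‖ < δ ∧ (y, I c) ∈ H) :
    ∃ s' : Y → C, Continuous s' ∧ ∀ y, (y, s' y) ∈ H ∧ ‖s' y - g‖ < α y := by
  have hH' : IsOpen (H ∩ {q : Y × C | ‖q.2 - g‖ < α q.1}) :=
    hH.inter (isOpen_lt (by fun_prop) (by fun_prop))
  suffices hB : StepProp m g (H ∩ {q : Y × C | ‖q.2 - g‖ < α q.1}) by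
    obtain ⟨s, hs1, hs2⟩ := selection_core hY (g := g) hH' hB
    exact ⟨s, hs1, fun y => ⟨(hs2 y).1, (hs2 y).2⟩⟩
  intro y K l hl hK hld hsub
  let Q : Set C := (fun q : C × ℝ => lerp q.2 q.1 g) '' (K ×ˢ Icc 0 1) ∪ {g}
  have hQc : IsCompact Q := ((hK.prod isCompact_Icc).image
    (lerp_cont continuous_snd continuous_fst continuous_const)).union isCompact_singleton
  have hQl : LD (m + 1) Q := by
    refine LD.union ?_ (LD.singleton m g)
    refine (hld.cone (lerp_locLip locLip_snd locLip_fst (LocallyLipschitz.const g))).mono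
      (by omega) (image_mono (prod_mono subset_rfl (subset_univ _)))
  have hKball : ∀ c ∈ K, ‖c - g‖ < α y := fun c hc => (hsub c hc).2
  have hQb : Q ⊆ ball g (α y) := by
    rintro _ (⟨⟨c, s⟩, ⟨hc, hs⟩, rfl⟩ | rfl)
    · have e : lerp s c g - g = (1 - s) • (c - g) := by
        unfold lerp
        module
      rw [mem_ball, dist_eq_norm]
      dsimp only
      rw [e, norm_smul, Real.norm_of_nonneg (by linarith [hs.2])]
      have := hKball c hc
      nlinarith [norm_nonneg (c - g), hs.1, hs.2]
    · exact mem_ball_self (hα0 y)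
  have hKQ : K ⊆ Q := fun c hc => Or.inl ⟨(c, 0), ⟨hc, by simp⟩, lerp_zero c g⟩
  obtain ⟨δ1, hδ1, ht1⟩ := hQc.exists_thickening_subset_open isOpen_ball hQb
  obtain ⟨δ2, hδ2, ht2⟩ := hK.exists_thickening_subset_open
    (t := {c | (y, c) ∈ H}) (hH.preimage (by fun_prop : Continuous fun c : C => (y, c)))
    (fun c hc => (hsub c hc).1)
  obtain ⟨I, hI, hI2⟩ := hA y Q hQc hQl (min δ1 δ2) (lt_min hδ1 hδ2)
  have hIQ : ∀ c ∈ Q, (y, I c) ∈ H ∩ {q : Y × C | ‖q.2 - g‖ < α q.1} := by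
    intro c hc
    refine ⟨(hI2 c hc).2, ?_⟩
    have : I c ∈ ball g (α y) := ht1 (mem_thickening_iff.2 ⟨c, hc, by
      rw [dist_eq_norm]; exact (hI2 c hc).1.trans_le (min_le_left _ _)⟩)
    rwa [mem_ball, dist_eq_norm] at this
  refine ⟨I, hI, hIQ g (Or.inr rfl), fun c hc s hs => ⟨?_, hIQ _ (Or.inl ⟨(c, s), ⟨hc, hs⟩, rfl⟩)⟩⟩
  have hlt := (hI2 c (hKQ hc)).1
  have hd : dist (lerp s c (I c)) c < min δ1 δ2 := by
    have e : lerp s c (I c) - c = s • (I c - c) := by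
      unfold lerp
      module
    rw [dist_eq_norm, e, norm_smul, Real.norm_of_nonneg hs.1]
    nlinarith [norm_nonneg (I c - c), hs.1, hs.2]
  constructor
  · exact ht2 (mem_thickening_iff.2 ⟨c, hc, hd.trans_le (min_le_right _ _)⟩)
  · have : lerp s c (I c) ∈ ball g (α y) :=
      ht1 (mem_thickening_iff.2 ⟨c, hKQ hc, hd.trans_le (min_le_left _ _)⟩)
    rwa [mem_ball, dist_eq_norm] at this

end Sel


theorem bump_family {X E : Type*} [MetricSpace X] [NormedAddCommGroup E] {T K : Set X} {k : ℕ}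
    (hT : CovDimLENat T k) (hK : IsCompact K) (hKT : K ⊆ T) {Q : Set (X →ᵇ E)} (hQ : IsCompact Q)
    {ε δ : ℝ} (hε : 0 < ε) (hδ : 0 < δ) :
    ∃ (t : Finset X) (φ : t → C(X, ℝ)), (∀ i x, 0 ≤ φ i x) ∧ (∀ x, ∑ i, φ i x ≤ 1) ∧
      (∀ x ∈ K, ∑ i, φ i x = 1) ∧
      (∀ x ∈ K, ∀ A : Finset t, (∀ i ∈ A, φ i x ≠ 0) → A.card ≤ k + 1) ∧
      ∀ i x, φ i x ≠ 0 → dist x i < ε ∧ ∀ c ∈ Q, ‖c x - c i‖ < δ := by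
  classical
  have hN : ∀ x : X, ∃ U : Set X, IsOpen U ∧ x ∈ U ∧ ∀ x' ∈ U, dist x' x < ε ∧
      ∀ c ∈ Q, ‖c x' - c x‖ < δ := by
    intro x
    have e1 : ∀ᶠ x' in 𝓝 x, ∀ c ∈ Q, ‖c x' - c x‖ < δ := by
      refine hQ.eventually_forall_of_forall_eventually
        (P := fun (x' : X) (c : X →ᵇ E) => ‖c x' - c x‖ < δ) fun c _ => ?_
      have hc1 : Continuous fun z : X × (X →ᵇ E) => z.2 z.1 :=
        Continuous.eval continuous_snd continuous_fst
      have hc2 : Continuous fun z : X × (X →ᵇ E) => z.2 x :=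
        Continuous.eval continuous_snd continuous_const
      refine ((hc1.sub hc2).norm).continuousAt.eventually (gt_mem_nhds ?_)
      simpa using hδ
    have e2 : ∀ᶠ x' in 𝓝 x, dist x' x < ε := Metric.ball_mem_nhds x hε
    obtain ⟨O, h1, h2, h3⟩ := _root_.eventually_nhds_iff.1 (e2.and e1)
    exact ⟨O, h2, h3, h1⟩
  choose N N1 N2 N3 using hN
  obtain ⟨t, ht1, ht2⟩ := hK.elim_nhds_subcover N (fun x _ => (N1 x).mem_nhds (N2 x))
  let U : Option t → Set T := fun o =>
    o.elim (Subtype.val ⁻¹' Kᶜ) (fun i => Subtype.val ⁻¹' N i)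
  obtain ⟨D, d1, d2, d3, d4⟩ := merge_lemma hT U (by
      rintro (_ | i)
      · exact hK.isClosed.isOpen_compl.preimage continuous_subtype_val
      · exact (N1 i).preimage continuous_subtype_val) (by
      refine eq_univ_of_forall fun y => ?_
      by_cases hy : y.1 ∈ K
      · have := ht2 hy
        simp only [mem_iUnion] at this
        obtain ⟨x, hx, hy'⟩ := this
        exact mem_iUnion.2 ⟨some ⟨x, hx⟩, hy'⟩
      · exact mem_iUnion.2 ⟨none, hy⟩)
  have hW : ∀ i : t, ∃ W : Set X, IsOpen W ∧ Subtype.val ⁻¹' W = D (some i) := fun i =>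
    isOpen_induced_iff.1 (d1 (some i))
  choose W W1 W2 using hW
  obtain ⟨φ, hφ⟩ := PartitionOfUnity.exists_isSubordinate hK.isClosed (fun i : t => W i ∩ N i)
    (fun i => (W1 i).inter (N1 i)) (by
      intro x hx
      have : (⟨x, hKT hx⟩ : T) ∈ ⋃ i, D i := d3 ▸ mem_univ _
      obtain ⟨o, ho⟩ := mem_iUnion.1 this
      rcases o with _ | i
      · exact absurd hx (d2 _ ho)
      · refine mem_iUnion.2 ⟨i, ?_, d2 _ ho⟩
        rw [← W2] at ho
        exact ho)
  have hmem : ∀ i x, φ i x ≠ 0 → x ∈ W i ∩ N i := fun i x h => hφ i (subset_tsupport _ h)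
  refine ⟨t, φ, φ.nonneg, fun x => ?_, fun x hx => ?_, fun x hx A hA => ?_, fun i x h => ?_⟩
  · rw [← finsum_eq_sum_of_fintype]
    exact φ.sum_le_one x
  · rw [← finsum_eq_sum_of_fintype]
    exact φ.sum_eq_one hx
  · have := d4 ⟨x, hKT hx⟩ (A.map Function.Embedding.some) (by
      intro j hj
      rw [Finset.mem_map] at hj
      obtain ⟨i, hi, rfl⟩ := hj
      have := (hmem i x (hA i hi)).1
      change _ ∈ D (some i)
      rw [← W2]
      exact this)
    rwa [Finset.card_map] at this
  · exact N3 i x (hmem i x h).2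

section Pert
variable {X E ι : Type*} [TopologicalSpace X] [NormedAddCommGroup E] [NormedSpace ℝ E] [Fintype ι]

/-- the perturbation -/
noncomputable def pert (ξ : ι → X) (φ : ι → X →ᵇ ℝ) (v : ι → E) (c : X →ᵇ E) : X →ᵇ E :=
  c + ∑ i, φ i • (BoundedContinuousFunction.const X (c (ξ i) + v i) - c)

theorem pert_apply (ξ : ι → X) (φ : ι → X →ᵇ ℝ) (v : ι → E) (c : X →ᵇ E) (x : X) :
    pert ξ φ v c x = c x + ∑ i, φ i x • (c (ξ i) + v i - c x) := by
  simp only [pert, BoundedContinuousFunction.coe_add, Pi.add_apply, BoundedContinuousFunction.coe_sum,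
    Finset.sum_apply]
  rfl

theorem pert_apply_one {ξ : ι → X} {φ : ι → X →ᵇ ℝ} {v : ι → E} {c : X →ᵇ E} {x : X}
    (h : ∑ i, φ i x = 1) : pert ξ φ v c x = ∑ i, φ i x • (c (ξ i) + v i) := by
  rw [pert_apply]
  simp only [smul_sub, Finset.sum_sub_distrib, ← Finset.sum_smul, h, one_smul]
  abel

theorem pert_lip (ξ : ι → X) (φ : ι → X →ᵇ ℝ) (v : ι → E) (h0 : ∀ i x, 0 ≤ φ i x)
    (h1 : ∀ x, ∑ i, φ i x ≤ 1) : LocallyLipschitz (pert ξ φ v) := by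
  have : LipschitzWith 3 (pert ξ φ v) := by
    refine LipschitzWith.of_dist_le_mul fun c c' => ?_
    rw [BoundedContinuousFunction.dist_le (by positivity)]
    intro x
    rw [pert_apply, pert_apply, dist_eq_norm]
    have hb : ∀ z, ‖c z - c' z‖ ≤ dist c c' := fun z => by
      rw [← dist_eq_norm]
      exact BoundedContinuousFunction.dist_coe_le_dist z
    have e : c x + ∑ i, φ i x • (c (ξ i) + v i - c x) -
        (c' x + ∑ i, φ i x • (c' (ξ i) + v i - c' x)) =
        (c x - c' x) + ∑ i, φ i x • ((c (ξ i) - c' (ξ i)) - (c x - c' x)) := by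
      rw [add_sub_add_comm, ← Finset.sum_sub_distrib]
      congr 1
      refine Finset.sum_congr rfl fun i _ => ?_
      rw [← smul_sub]
      congr 1
      abel
    rw [e]
    have h2 : ‖∑ i, φ i x • ((c (ξ i) - c' (ξ i)) - (c x - c' x))‖ ≤ 2 * dist c c' := by
      calc _ ≤ ∑ i, φ i x * (2 * dist c c') := by
            refine norm_sum_le_of_le _ fun i _ => ?_
            rw [norm_smul, Real.norm_of_nonneg (h0 i x)]
            refine mul_le_mul_of_nonneg_left ?_ (h0 i x)
            refine (norm_sub_le _ _).trans ?_
            linarith [hb x, hb (ξ i)]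
        _ ≤ 2 * dist c c' := by
            rw [← Finset.sum_mul]
            nlinarith [h1 x, dist_nonneg (x := c) (y := c')]
    refine (norm_add_le _ _).trans ?_
    have := hb x
    push_cast
    linarith
  exact this.locallyLipschitz

theorem pert_close {ξ : ι → X} {φ : ι → X →ᵇ ℝ} {v : ι → E} {c : X →ᵇ E} {δ : ℝ} (hδ : 0 ≤ δ)
    (h0 : ∀ i x, 0 ≤ φ i x) (h1 : ∀ x, ∑ i, φ i x ≤ 1) (hv : ∀ i, ‖v i‖ ≤ δ)
    (hc : ∀ i x, φ i x ≠ 0 → ‖c x - c (ξ i)‖ ≤ δ) : ‖pert ξ φ v c - c‖ ≤ 2 * δ := by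
  rw [BoundedContinuousFunction.norm_le (by positivity)]
  intro x
  rw [BoundedContinuousFunction.coe_sub, Pi.sub_apply, pert_apply, add_sub_cancel_left]
  calc _ ≤ ∑ i, φ i x * (2 * δ) := by
        refine norm_sum_le_of_le _ fun i _ => ?_
        rw [norm_smul, Real.norm_of_nonneg (h0 i x)]
        by_cases hz : φ i x = 0
        · simp [hz]
        refine mul_le_mul_of_nonneg_left ?_ (h0 i x)
        have e : c (ξ i) + v i - c x = v i - (c x - c (ξ i)) := by abel
        rw [e]
        refine (norm_sub_le _ _).trans ?_
        linarith [hv i, hc i x hz]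
    _ ≤ 2 * δ := by
        rw [← Finset.sum_mul]
        nlinarith [h1 x]

end Pert


section Bad
variable {E ι : Type*} [NormedAddCommGroup E] [NormedSpace ℝ E] [Fintype ι] {q : ℕ}

noncomputable instance subFintype (π : Fin q ↪ ι) : Fintype {i // i ∉ range π} :=
  Fintype.ofFinite _

theorem sum_split {M : Type*} [AddCommMonoid M] (F : ι → M) (j : ι) (B : Finset ι) (hj : j ∉ B)
    (hF : ∀ i, i ≠ j → i ∉ B → F i = 0) : ∑ i, F i = F j + ∑ b : B, F b := by
  classical
  rw [Finset.sum_coe_sort B F, ← Finset.sum_insert hj]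
  symm
  refine Finset.sum_subset (Finset.subset_univ _) fun i _ hi => ?_
  rw [Finset.mem_insert, not_or] at hi
  exact hF i hi.1 hi.2

/-- extension by zero from the non-pivots -/
noncomputable def extZ (π : Fin q ↪ ι) (v : {i // i ∉ range π} → E) (i : ι) : E :=
  open Classical in if h : i ∉ range π then v ⟨i, h⟩ else 0

/-- the parametrisation of bad perturbations -/
noncomputable def badMap (π : Fin q ↪ ι) (B : Fin q → Finset ι)
    (z : (ι → E) × ((a : Fin q) → B a → ℝ) × E × ({i // i ∉ range π} → E)) : ι → E :=
  Function.extend π (fun a => (1 + ∑ b : B a, z.2.1 a b) • z.2.2.1 -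
    ∑ b : B a, z.2.1 a b • (z.1 b + extZ π z.2.2.2 b) - z.1 (π a)) (extZ π z.2.2.2)

theorem contDiff_extZ (π : Fin q ↪ ι) (i : ι) :
    ContDiff ℝ 1 fun v : {i // i ∉ range π} → E => extZ π v i := by
  classical
  unfold extZ
  by_cases h : i ∉ range π
  · simp only [h, not_false_eq_true, dite_true]
    fun_prop
  · simp only [h, dite_false]
    fun_prop

theorem locLip_badMap (π : Fin q ↪ ι) (B : Fin q → Finset ι) :
    LocallyLipschitz (badMap (E := E) π B) := by
  classical
  refine locLip_of_contDiff ?_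
  rw [contDiff_pi]
  intro i
  have hext : ∀ i, ContDiff ℝ 1 fun z : (ι → E) × ((a : Fin q) → B a → ℝ) × E ×
      ({i // i ∉ range π} → E) => extZ π z.2.2.2 i := fun i =>
    (contDiff_extZ π i).comp (by fun_prop)
  by_cases h : ∃ a, π a = i
  · obtain ⟨a, rfl⟩ := h
    simp only [badMap, π.injective.extend_apply]
    have h2 : ∀ b : B a, ContDiff ℝ 1 fun z : (ι → E) × ((a : Fin q) → B a → ℝ) × E ×
      ({i // i ∉ range π} → E) => z.2.1 a b := fun b =>
      contDiff_pi.1 (contDiff_pi.1 (contDiff_fst.comp contDiff_snd) a) b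
    refine ContDiff.sub (ContDiff.sub (ContDiff.smul ?_ (by fun_prop)) ?_) (by fun_prop)
    · exact contDiff_const.add (ContDiff.sum fun b _ => h2 b)
    · refine ContDiff.sum fun b _ => (h2 b).smul (ContDiff.add (by fun_prop) (hext b))
  · simp only [badMap, Function.extend_apply' _ _ _ h]
    exact hext i

theorem bad_identity (π : Fin q ↪ ι) (w v : ι → E) (z : E) (ψ : Fin q → ι → ℝ)
    (B : Fin q → Finset ι)
    (h1 : ∀ a, ψ a (π a) ≠ 0) (h2 : ∀ a, π a ∉ B a) (h3 : ∀ a, ∀ i ∈ B a, i ∉ range π)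
    (h4 : ∀ a i, i ≠ π a → i ∉ B a → ψ a i = 0) (h5 : ∀ a, ∑ i, ψ a i = 1)
    (h6 : ∀ a, ∑ i, ψ a i • (w i + v i) = z) :
    badMap π B (w, fun a b => ψ a b / ψ a (π a), z, fun i => v i) = v := by
  classical
  have hext : ∀ i, i ∉ range π → extZ π (fun i : {i // i ∉ range π} => v i) i = v i := by
    intro i hi
    simp only [extZ, hi, not_false_eq_true, dite_true]
  funext i
  by_cases h : ∃ a, π a = i
  · obtain ⟨a, rfl⟩ := h
    simp only [badMap, π.injective.extend_apply]
    have e5 := h5 a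
    rw [sum_split (fun i => ψ a i) (π a) (B a) (h2 a) (h4 a)] at e5
    have e6 := h6 a
    rw [sum_split (fun i => ψ a i • (w i + v i)) (π a) (B a) (h2 a) (fun i hi hi' => by
      simp [h4 a i hi hi'])] at e6
    have hs : (1 + ∑ b : B a, ψ a b / ψ a (π a)) = (ψ a (π a))⁻¹ := by
      rw [← Finset.sum_div]
      have := h1 a
      field_simp
      linarith
    have hs2 : ∑ b : B a, (ψ a b / ψ a (π a)) •
        (w b + extZ π (fun i : {i // i ∉ range π} => v i) b) =
        (ψ a (π a))⁻¹ • ∑ b : B a, ψ a b • (w b + v b) := by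
      rw [Finset.smul_sum]
      refine Finset.sum_congr rfl fun b _ => ?_
      rw [hext b (h3 a b b.2), smul_smul, div_eq_inv_mul]
    rw [hs, hs2, ← e6, smul_add, smul_smul, inv_mul_cancel₀ (h1 a), one_smul]
    abel
  · simp only [badMap, Function.extend_apply' _ _ _ h]
    exact hext i (by simpa using h)

open Module in
theorem dimH_bad [FiniteDimensional ℝ E] {C : Type*} [NormedAddCommGroup C] {d k m p : ℕ}
    (hd : d ≤ m) (hE : finrank ℝ E = p + k) (hq : k + m < (q - 1) * p)
    (P : (Fin d → ℝ) → C) (hP : LocallyLipschitz P) (ev : C → ι → E) (hev : LocallyLipschitz ev)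
    (π : Fin q ↪ ι) (B : Fin q → Finset ι) (hB : ∀ a, (B a).card ≤ k) :
    dimH (range fun z : (Fin d → ℝ) × ((a : Fin q) → B a → ℝ) × E × ({i // i ∉ range π} → E) =>
      badMap π B (ev (P z.1), z.2)) ≤ ((finrank ℝ (ι → E) - 1 : ℕ) : ENNReal) ∧
      0 < finrank ℝ (ι → E) := by
  classical
  have hlip : LocallyLipschitz fun z : (Fin d → ℝ) × ((a : Fin q) → B a → ℝ) × E ×
      ({i // i ∉ range π} → E) => badMap π B (ev (P z.1), z.2) :=
    (locLip_badMap π B).comp (LocallyLipschitz.prodMk (hev.comp (hP.comp locLip_fst)) locLip_snd)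
  have h1 : finrank ℝ ((Fin d → ℝ) × ((a : Fin q) → B a → ℝ) × E × ({i // i ∉ range π} → E)) =
      d + ((∑ a, (B a).card) + ((p + k) + (Fintype.card ι - q) * (p + k))) := by
    rw [finrank_prod, finrank_prod, finrank_prod, finrank_pi_fintype, finrank_pi_fintype,
      finrank_pi_fintype, hE]
    simp only [finrank_self, finrank_pi, Fintype.card_fin, Fintype.card_coe, Finset.sum_const,
      Finset.card_univ, smul_eq_mul, mul_one]
    congr 4
    rw [Fintype.card_subtype_compl]
    congr 1
    rw [← Set.toFinset_card, Set.toFinset_range, Finset.card_image_of_injective _ π.injective]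
    simp
  have hVq : q ≤ Fintype.card ι := by simpa using Fintype.card_le_of_embedding π
  have h2 : finrank ℝ (ι → E) = Fintype.card ι * (p + k) := by
    rw [finrank_pi_fintype, hE]
    simp
  have h3 : ∑ a, (B a).card ≤ q * k := by
    calc ∑ a, (B a).card ≤ ∑ a : Fin q, k := Finset.sum_le_sum fun a _ => hB a
      _ = q * k := by simp
  have h4 : finrank ℝ ((Fin d → ℝ) × ((a : Fin q) → B a → ℝ) × E × ({i // i ∉ range π} → E)) <
      finrank ℝ (ι → E) := by
    rw [h1, h2]
    obtain ⟨r, hr⟩ := Nat.exists_eq_add_of_le hVq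
    rw [hr, Nat.add_sub_cancel_left]
    rcases q with _ | q
    · simp at hq
    · simp only [Nat.add_sub_cancel] at hq
      nlinarith
  refine ⟨?_, by omega⟩
  refine (dimH_range_le_of_locally_lipschitzOn fun z => ?_).trans ?_
  · obtain ⟨K, t, ht, h⟩ := hlip z
    exact ⟨K, t, ht, h⟩
  · rw [Real.dimH_univ_eq_finrank]
    exact_mod_cast (by omega)

end Bad

open Module in
theorem local_density {X E : Type*} [MetricSpace X] [NormedAddCommGroup E] [NormedSpace ℝ E]
    [FiniteDimensional ℝ E] {T K : Set X} {k m p q : ℕ}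
    (hE : finrank ℝ E = p + k) (hq : k + m < (q - 1) * p)
    (hT : CovDimLENat T k) (hK : IsCompact K) (hKT : K ⊆ T) {Q : Set (X →ᵇ E)} (hQ : IsCompact Q)
    (hLD : LD (m + 1) Q) {ε δ : ℝ} (hε : 0 < ε) (hδ : 0 < δ) :
    ∃ I : (X →ᵇ E) → (X →ᵇ E), LocallyLipschitz I ∧ ∀ c ∈ Q, ‖I c - c‖ < δ ∧
      ¬ ∃ x : Fin q → X, (∀ a, x a ∈ K) ∧ (∀ a b, a ≠ b → ε ≤ dist (x a) (x b)) ∧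
        ∀ a b, I c (x a) = I c (x b) := by
  classical
  have hq2 : 0 < q := by
    rcases q with _ | q
    · simp at hq
    · omega
  obtain ⟨t, φ0, f1, f2, f3, f4, f5⟩ := bump_family hT hK hKT hQ (half_pos hε)
    (by positivity : 0 < δ / 4)
  have hle1 : ∀ i x, φ0 i x ≤ 1 := fun i x =>
    (Finset.single_le_sum (f := fun i => φ0 i x) (fun i _ => f1 i x) (Finset.mem_univ i)).trans (f2 x)
  let φ : t → X →ᵇ ℝ := fun i => BoundedContinuousFunction.ofNormedAddCommGroup (φ0 i)
    (φ0 i).continuous 1 fun x => by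
      rw [Real.norm_of_nonneg (f1 i x)]
      exact hle1 i x
  have hφ : ∀ i x, φ i x = φ0 i x := fun i x => rfl
  let ξ : t → X := fun i => i
  obtain ⟨S, S1, S2, S3⟩ := hLD
  let ev : (X →ᵇ E) → t → E := fun c i => c (ξ i)
  have hev : LocallyLipschitz ev := by
    have : LipschitzWith 1 ev := by
      refine LipschitzWith.of_dist_le_mul fun c c' => ?_
      rw [NNReal.coe_one, one_mul, dist_pi_le_iff dist_nonneg]
      intro i
      exact BoundedContinuousFunction.dist_coe_le_dist _
    exact this.locallyLipschitz
  choose! d hd P hP hR using S3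
  let cfg := {z : (Fin q ↪ t) × (Fin q → Finset t) // ∀ a, (z.2 a).card ≤ k}
  let Bad : (S × cfg) → Set (t → E) := fun s =>
    range fun z : (Fin (d s.1) → ℝ) × ((a : Fin q) → (s.2.1.2 a) → ℝ) × E ×
      ({i // i ∉ range s.2.1.1} → E) => badMap s.2.1.1 s.2.1.2 (ev (P s.1 z.1), z.2)
  have hcount : Countable (S × cfg) := by
    have := S1.to_subtype
    infer_instance
  have hdense : Dense (⋃ s, Bad s)ᶜ ∨ (⋃ s, Bad s) = ∅ := by
    rcases isEmpty_or_nonempty (S × cfg) with he | ⟨⟨s0⟩⟩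
    · right
      simp
    · left
      refine dense_compl_of_dimH_lt_finrank ?_
      rw [dimH_iUnion]
      have h0 := (dimH_bad (by have := hd s0.1 s0.1.2; omega) hE hq (P s0.1) (hP s0.1 s0.1.2) ev hev
        s0.2.1.1 s0.2.1.2 s0.2.2).2
      refine lt_of_le_of_lt (iSup_le fun s => (dimH_bad (by have := hd s.1 s.1.2; omega) hE hq
        (P s.1) (hP s.1 s.1.2) ev hev s.2.1.1 s.2.1.2 s.2.2).1) ?_
      exact_mod_cast (by omega)
  obtain ⟨v, hv1, hv2⟩ : ∃ v ∈ ball (0 : t → E) (δ / 4), v ∉ ⋃ s, Bad s := by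
    rcases hdense with h | h
    · obtain ⟨v, hv⟩ := h.inter_open_nonempty (ball 0 (δ / 4)) isOpen_ball
        ⟨0, mem_ball_self (by positivity)⟩
      exact ⟨v, hv.1, hv.2⟩
    · exact ⟨0, mem_ball_self (by positivity), by rw [h]; simp⟩
  have hvn : ∀ i, ‖v i‖ ≤ δ / 4 := fun i => (norm_le_pi_norm v i).trans (by
    rw [mem_ball, dist_zero_right] at hv1
    exact hv1.le)
  refine ⟨pert ξ φ v, pert_lip ξ φ v f1 f2, fun c hc => ⟨?_, ?_⟩⟩
  · refine lt_of_le_of_lt (pert_close (δ := δ / 4) (by positivity) f1 f2 hvn fun i x h => ?_) (by linarith)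
    exact ((f5 i x h).2 c hc).le
  · rintro ⟨x, x1, x2, x3⟩
    refine hv2 ?_
    obtain ⟨R, hRS, hcR⟩ := S2 hc
    obtain ⟨τ, hτ⟩ := hR R hRS hcR
    have hsep : ∀ i a b, φ0 i (x a) ≠ 0 → φ0 i (x b) ≠ 0 → a = b := by
      intro i a b ha hb
      by_contra hab
      have g1 := (f5 i _ ha).1
      have g2 := (f5 i _ hb).1
      have g3 := x2 a b hab
      have g4 := dist_triangle_right (x a) (x b) i
      linarith
    have hpiv : ∀ a, ∃ i, φ0 i (x a) ≠ 0 := by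
      intro a
      by_contra hcon
      push Not at hcon
      have := f3 (x a) (x1 a)
      simp [hcon] at this
    choose π hπ using hpiv
    let π' : Fin q ↪ t := ⟨π, fun a b hab => hsep (π a) a b (hπ a) (by rw [hab]; exact hπ b)⟩
    let B : Fin q → Finset t := fun a => (Finset.univ.filter fun i => φ0 i (x a) ≠ 0).erase (π a)
    have hB : ∀ a, (B a).card ≤ k := by
      intro a
      have h1 := f4 (x a) (x1 a) (Finset.univ.filter fun i => φ0 i (x a) ≠ 0) (by simp)
      have h2 : (B a).card = (Finset.univ.filter fun i => φ0 i (x a) ≠ 0).card - 1 :=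
        Finset.card_erase_of_mem (by simpa using hπ a)
      omega
    refine mem_iUnion.2 ⟨(⟨R, hRS⟩, ⟨(π', B), hB⟩), ?_⟩
    refine ⟨(τ, fun a b => φ0 b (x a) / φ0 (π a) (x a), pert ξ φ v c (x ⟨0, hq2⟩), fun i => v i), ?_⟩
    refine bad_identity π' (ev (P R τ)) v _ (fun a i => φ0 i (x a)) B hπ
      (fun a => Finset.notMem_erase _ _) ?_ ?_ (fun a => f3 _ (x1 a)) ?_
    · rintro a i hi ⟨b, rfl⟩
      simp only [B, Finset.mem_erase, Finset.mem_filter, Finset.mem_univ, true_and] at hi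
      have := hsep (π b) a b hi.2 (hπ b)
      subst this
      exact hi.1 rfl
    · intro a i hi hi'
      by_contra hne
      refine hi' ?_
      simp only [B, Finset.mem_erase, Finset.mem_filter, Finset.mem_univ, true_and]
      exact ⟨hi, hne⟩
    · intro a
      rw [x3 ⟨0, hq2⟩ a, pert_apply_one (f3 _ (x1 a)), hτ]
      rfl


/-- properness data of `f` on a closed set `A` -/
structure PropOn {X Y : Type*} [TopologicalSpace X] [TopologicalSpace Y] (f : X → Y) (A : Set X) :
    Prop where
  closed : IsClosed A
  img : ∀ F : Set X, IsClosed F → IsClosed (f '' (A ∩ F))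
  cpt : ∀ K : Set Y, IsCompact K → IsCompact (A ∩ f ⁻¹' K)

section PropSec
variable {X Y : Type*} [TopologicalSpace X] [TopologicalSpace Y] {f : X → Y}

theorem propOn_of_perfect {A : Set X} (h1 : IsClosed A) (h2 : IsClosed (f '' A))
    (h3 : IsPerfectMap (Set.MapsTo.restrict f A (f '' A) (Set.mapsTo_image f A))) :
    PropOn f A := by
  have hp : IsProperMap (fun x : A => f x) :=
    (h2.isClosedEmbedding_subtypeVal.isProperMap).comp
      (isProperMap_iff_isClosedMap_and_compact_fibers.2 h3)
  refine ⟨h1, fun F hF => ?_, fun K hK => ?_⟩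
  · have := hp.isClosedMap _ (hF.preimage continuous_subtype_val)
    convert this using 1
    ext y
    constructor
    · rintro ⟨x, ⟨hx, hxF⟩, rfl⟩
      exact ⟨⟨x, hx⟩, hxF, rfl⟩
    · rintro ⟨⟨x, hx⟩, hxF, rfl⟩
      exact ⟨x, ⟨hx, hxF⟩, rfl⟩
  · have := (hp.isCompact_preimage hK).image continuous_subtype_val
    convert this using 1
    ext x
    constructor
    · rintro ⟨hx, hxF⟩
      exact ⟨⟨x, hx⟩, hxF, rfl⟩
    · rintro ⟨⟨x, hx⟩, hxF, rfl⟩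
      exact ⟨hx, hxF⟩

theorem PropOn.biUnion {A : ℕ → Set X} (h : ∀ i, PropOn f (A i)) (n : ℕ) :
    PropOn f (⋃ i ∈ Iic n, A i) := by
  have hfin : (Iic n).Finite := finite_Iic n
  refine ⟨hfin.isClosed_biUnion fun i _ => (h i).closed, fun F hF => ?_, fun K hK => ?_⟩
  · have : f '' ((⋃ i ∈ Iic n, A i) ∩ F) = ⋃ i ∈ Iic n, f '' (A i ∩ F) := by
      simp only [iUnion_inter, image_iUnion]
    rw [this]
    exact hfin.isClosed_biUnion fun i _ => (h i).img F hF
  · simp only [iUnion_inter]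
    exact hfin.isCompact_biUnion fun i _ => (h i).cpt K hK

end PropSec

section SL
variable {X E : Type*} [TopologicalSpace X] [NormedAddCommGroup E] [NormedSpace ℝ E]

theorem exists_clamp (g : X →ᵇ E) {r : X → ℝ} (hr : Continuous r) (hr0 : ∀ x, 0 < r x) {M : ℝ}
    (hM : ∀ x, r x ≤ M) {u : X → E} (hu : Continuous u) :
    ∃ h : X →ᵇ E, (∀ x, dist (h x) (g x) ≤ r x) ∧ ∀ x, dist (u x) (g x) ≤ r x → h x = u x := by
  have hb : ∀ x, ‖(r x / max (r x) ‖u x - g x‖) • (u x - g x)‖ ≤ r x := by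
    intro x
    have hm : 0 < max (r x) ‖u x - g x‖ := lt_max_of_lt_left (hr0 x)
    rw [norm_smul, Real.norm_of_nonneg (div_nonneg (hr0 x).le hm.le), div_mul_eq_mul_div,
      div_le_iff₀ hm]
    exact mul_le_mul_of_nonneg_left (le_max_right _ _) (hr0 x).le
  have hcont : Continuous fun x => (r x / max (r x) ‖u x - g x‖) • (u x - g x) := by
    have hg := g.continuous
    refine Continuous.smul (hr.div (by fun_prop) fun x => ?_) (by fun_prop)
    exact (lt_max_of_lt_left (hr0 x)).ne'
  refine ⟨g + BoundedContinuousFunction.ofNormedAddCommGroup _ hcont M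
    fun x => (hb x).trans (hM x), fun x => ?_, fun x hx => ?_⟩
  · rw [dist_eq_norm]
    simpa using hb x
  · rw [dist_eq_norm] at hx
    simp only [BoundedContinuousFunction.coe_add, Pi.add_apply,
      BoundedContinuousFunction.coe_ofNormedAddCommGroup]
    rw [max_eq_left hx, div_self (hr0 x).ne', one_smul]
    abel

theorem baire_sl [CompleteSpace E] (G : ℕ → Set (X →ᵇ E))
    (hopen : ∀ n, @IsOpen _ (sourceLimitation X E) (G n))
    (hdense : ∀ n (g : X →ᵇ E) (α : X → ℝ), Continuous α → (∀ x, 0 < α x) →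
      ∃ h ∈ G n, ∀ x, dist (h x) (g x) ≤ α x) :
    @Dense _ (sourceLimitation X E) (⋂ n, G n) := by
  rw [@dense_iff_inter_open _ (sourceLimitation X E)]
  rintro U hU ⟨g0, hg0⟩
  obtain ⟨α0, a1, a2, a3⟩ := hU g0 hg0
  let St := {z : (X →ᵇ E) × (X → ℝ) // Continuous z.2 ∧ ∀ x, 0 < z.2 x}
  have step : ∀ (n : ℕ) (z : St), ∃ z' : St, (∀ x, z'.1.2 x ≤ z.1.2 x / 2) ∧
      (∀ x, dist (z'.1.1 x) (z.1.1 x) ≤ z.1.2 x / 2) ∧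
      ∀ h : X →ᵇ E, (∀ x, dist (h x) (z'.1.1 x) ≤ z'.1.2 x) → h ∈ G n := by
    rintro n ⟨⟨g, α⟩, hα, hα0⟩
    obtain ⟨g', hg', hd⟩ := hdense n g (fun x => α x / 2) (by fun_prop) fun x => half_pos (hα0 x)
    obtain ⟨β, b1, b2, b3⟩ := hopen n g' hg'
    refine ⟨⟨(g', fun x => min (β x) (α x / 2)), ?_, ?_⟩, fun x => min_le_right _ _, hd, ?_⟩
    · exact b1.min (hα.div_const 2)
    · exact fun x => lt_min (b2 x) (half_pos (hα0 x))
    · exact fun h hh => b3 h fun x => (hh x).trans (min_le_left _ _)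
  choose nx n1 n2 n3 using step
  let z0 : St := ⟨(g0, fun x => min (α0 x) 1), a1.min continuous_const,
    fun x => lt_min (a2 x) one_pos⟩
  let z : ℕ → St := fun n => Nat.rec z0 (fun n z => nx n z) n
  have zs : ∀ n, z (n + 1) = nx n (z n) := fun n => rfl
  have hbound : ∀ n x, (z n).1.2 x ≤ (1 / 2) ^ n := by
    intro n
    induction n with
    | zero => intro x; rw [pow_zero]; exact min_le_right (α0 x) 1
    | succ n ih =>
      intro x
      rw [zs, pow_succ]
      have := n1 n (z n) x
      have := ih x
      linarith
  have hnest : ∀ n j, n ≤ j → ∀ x, dist ((z j).1.1 x) ((z n).1.1 x) ≤ (z n).1.2 x - (z j).1.2 x := by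
    intro n j hnj
    induction j, hnj using Nat.le_induction with
    | base => intro x; simp
    | succ j hj ih =>
      intro x
      rw [zs]
      have h1 := ih x
      have h2 := n1 j (z j) x
      have h3 := n2 j (z j) x
      have h4 := dist_triangle ((nx j (z j)).1.1 x) ((z j).1.1 x) ((z n).1.1 x)
      linarith
  have hcau : CauchySeq fun n => (z n).1.1 := by
    refine cauchySeq_of_le_geometric (1 / 2) 1 (by norm_num) fun n => ?_
    rw [BoundedContinuousFunction.dist_le (by positivity)]
    intro x
    rw [dist_comm, one_mul]
    have h1 := hnest n (n + 1) (by omega) x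
    have h2 := (z (n + 1)).2.2 x
    have h3 := hbound n x
    linarith
  obtain ⟨g, hg⟩ := cauchySeq_tendsto_of_complete hcau
  have hlim : ∀ n x, dist (g x) ((z n).1.1 x) ≤ (z n).1.2 x := by
    intro n x
    have hx : Filter.Tendsto (fun j => (z j).1.1 x) Filter.atTop (𝓝 (g x)) :=
      Filter.Tendsto.eval hg tendsto_const_nhds
    refine le_of_tendsto (hx.dist tendsto_const_nhds) ?_
    filter_upwards [Filter.eventually_ge_atTop n] with j hj
    have h1 := hnest n j hj x
    have h2 := (z j).2.2 x
    linarith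
  refine ⟨g, a3 g fun x => (hlim 0 x).trans (min_le_left _ _), mem_iInter.2 fun n => ?_⟩
  exact n3 n (z n) g (hlim (n + 1))

end SL

section Good
variable {X Y E : Type*} [MetricSpace X] [TopologicalSpace Y] [NormedAddCommGroup E]

/-- pairs `(y, c)` such that `c` has no `q` points that are `ε`-separated in `A ∩ f⁻¹ y` with the
same value -/
def GoodPair (E : Type*) [NormedAddCommGroup E] (f : X → Y) (A : Set X) (ε : ℝ) (q : ℕ) :
    Set (Y × (X →ᵇ E)) :=
  {z | ¬ ∃ x : Fin q → X, (∀ a, x a ∈ A ∩ f ⁻¹' {z.1}) ∧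
    (∀ a b, a ≠ b → ε ≤ dist (x a) (x b)) ∧ ∀ a b, z.2 (x a) = z.2 (x b)}

theorem GoodPair.congr {f : X → Y} {A : Set X} {ε : ℝ} {q : ℕ} {y : Y} {c c' : X →ᵇ E}
    (h : (y, c) ∈ GoodPair E f A ε q) (hc : ∀ x ∈ A, f x = y → c' x = c x) :
    (y, c') ∈ GoodPair E f A ε q := by
  rintro ⟨x, x1, x2, x3⟩
  refine h ⟨x, x1, x2, fun a b => ?_⟩
  have := x3 a b
  dsimp only at this ⊢
  rwa [hc _ (x1 a).1 (x1 a).2, hc _ (x1 b).1 (x1 b).2] at this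

theorem isOpen_goodPair [TopologicalSpace.MetrizableSpace Y] {f : X → Y} (hf : Continuous f)
    {A : Set X} (hA : PropOn f A) (ε : ℝ) (q : ℕ) : IsOpen (GoodPair E f A ε q) := by
  let _ := TopologicalSpace.metrizableSpaceMetric Y
  rw [← isClosed_compl_iff]
  refine IsSeqClosed.isClosed ?_
  rintro z ⟨y, c⟩ hz hlim
  have hz' : ∀ n, ∃ x : Fin q → X, (∀ a, x a ∈ A ∩ f ⁻¹' {(z n).1}) ∧
    (∀ a b, a ≠ b → ε ≤ dist (x a) (x b)) ∧ ∀ a b, (z n).2 (x a) = (z n).2 (x b) := fun n =>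
    not_not.1 (hz n)
  choose x x1 x2 x3 using hz'
  rw [Prod.tendsto_iff] at hlim
  obtain ⟨hl1, hl2⟩ := hlim
  dsimp only at hl1 hl2
  have hcK := hA.cpt _ hl1.isCompact_insert_range
  have hpi : IsCompact (Set.pi univ fun _ : Fin q =>
      A ∩ f ⁻¹' (insert y (range fun n => (z n).1))) := isCompact_univ_pi fun _ => hcK
  obtain ⟨x', hx', ψ, hψ, hconv⟩ := hpi.tendsto_subseq (x := x) (by
    intro n a _
    refine ⟨(x1 n a).1, Or.inr ⟨n, (x1 n a).2.symm⟩⟩)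
  rw [tendsto_pi_nhds] at hconv
  have ht := hψ.tendsto_atTop
  refine not_not.2 ⟨x', fun a => ⟨(hx' a (mem_univ a)).1, ?_⟩, fun a b hab => ?_, fun a b => ?_⟩
  · have h1 : Filter.Tendsto (fun n => f (x (ψ n) a)) Filter.atTop (𝓝 (f (x' a))) :=
      (hf.tendsto _).comp (hconv a)
    have h2 : (fun n => f (x (ψ n) a)) = fun n => (z (ψ n)).1 := funext fun n => (x1 (ψ n) a).2
    rw [h2] at h1
    exact tendsto_nhds_unique h1 (hl1.comp ht)
  · refine le_of_tendsto_of_tendsto' tendsto_const_nhds ((hconv a).dist (hconv b)) fun n => ?_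
    exact x2 (ψ n) a b hab
  · have h1 : ∀ a, Filter.Tendsto (fun n => (z (ψ n)).2 (x (ψ n) a)) Filter.atTop (𝓝 (c (x' a))) :=
      fun a => Filter.Tendsto.eval (hl2.comp ht) (hconv a)
    refine tendsto_nhds_unique (h1 a) ?_
    have h2 : (fun n => (z (ψ n)).2 (x (ψ n) a)) = fun n => (z (ψ n)).2 (x (ψ n) b) :=
      funext fun n => x3 (ψ n) a b
    rw [h2]
    exact h1 b

variable [NormedSpace ℝ E]

theorem goodMaps_open [TopologicalSpace.MetrizableSpace Y] {f : X → Y} (hf : Continuous f)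
    {A : Set X} (hA : PropOn f A) (ε : ℝ) (q : ℕ) :
    @IsOpen _ (sourceLimitation X E) {g | ∀ y, (y, g) ∈ GoodPair E f A ε q} := by
  let _ := TopologicalSpace.metrizableSpaceMetric Y
  intro g hg
  have hO := isOpen_goodPair (E := E) hf hA ε q
  obtain ⟨α, hα⟩ := exists_continuous_forall_mem_convex_of_local_const
    (t := fun y : Y => {r : ℝ | 0 < r ∧ ∀ c : X →ᵇ E, ‖c - g‖ ≤ r → (y, c) ∈ GoodPair E f A ε q})
    (fun y => by
      refine Set.OrdConnected.convex ⟨?_⟩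
      rintro a ⟨ha, _⟩ b ⟨_, hb⟩ r ⟨h1, h2⟩
      exact ⟨ha.trans_le h1, fun c hc => hb c (hc.trans h2)⟩)
    (fun y => by
      have := hO.mem_nhds (hg y)
      rw [nhds_prod_eq, Filter.mem_prod_iff] at this
      obtain ⟨u, hu, v, hv, huv⟩ := this
      obtain ⟨r, hr, hrv⟩ := Metric.nhds_basis_closedBall.mem_iff.1 hv
      refine ⟨r, ?_⟩
      filter_upwards [hu] with y' hy'
      refine ⟨hr, fun c hc => huv ⟨hy', hrv ?_⟩⟩
      rwa [mem_closedBall, dist_eq_norm])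
  refine ⟨fun x => α (f x), α.continuous.comp hf, fun x => (hα (f x)).1, fun h hh y => ?_⟩
  obtain ⟨c, c1, c2⟩ := exists_clamp g (r := fun _ => α y) continuous_const (fun _ => (hα y).1)
    (fun _ => le_rfl) h.continuous
  refine GoodPair.congr (c := c) ((hα y).2 c ?_) fun x _ hx => ?_
  · rw [← dist_eq_norm, BoundedContinuousFunction.dist_le (hα y).1.le]
    exact c1
  · refine (c2 x ?_).symm
    rw [← hx]
    exact hh x

open Module in
theorem goodMaps_dense [TopologicalSpace.MetrizableSpace Y] [FiniteDimensional ℝ E] {f : X → Y}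
    (hf : Continuous f) {A : Set X} (hA : PropOn f A) {k m p q : ℕ}
    (hE : finrank ℝ E = p + k) (hq : k + m < (q - 1) * p)
    (hdf : ∀ y, CovDimLENat (f ⁻¹' {y}) k) (hY : CovDimLENat Y m) {ε : ℝ} (hε : 0 < ε)
    (g : X →ᵇ E) (α : X → ℝ) (hα : Continuous α) (hα0 : ∀ x, 0 < α x) :
    ∃ h ∈ {g | ∀ y, (y, g) ∈ GoodPair E f A ε q}, ∀ x, dist (h x) (g x) ≤ α x := by
  let _ := TopologicalSpace.metrizableSpaceMetric Y
  obtain ⟨β, hβ⟩ := exists_continuous_forall_mem_convex_of_local_const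
    (t := fun y : Y => {r : ℝ | 0 < r ∧ r ≤ 1 ∧ ∀ x ∈ A, f x = y → r ≤ α x})
    (fun y => by
      refine Set.OrdConnected.convex ⟨?_⟩
      rintro a ⟨ha, _⟩ b ⟨_, hb, hb'⟩ r ⟨h1, h2⟩
      exact ⟨ha.trans_le h1, h2.trans hb, fun x hx hy => h2.trans (hb' x hx hy)⟩)
    (fun y => by
      have hc : IsCompact (A ∩ f ⁻¹' {y}) := hA.cpt _ isCompact_singleton
      obtain ⟨r, hr, hrx⟩ : ∃ r > 0, ∀ x ∈ A ∩ f ⁻¹' {y}, r < α x := by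
        rcases (A ∩ f ⁻¹' {y}).eq_empty_or_nonempty with he | hne
        · exact ⟨1, one_pos, by simp [he]⟩
        · obtain ⟨x0, hx0, hmin⟩ := hc.exists_isMinOn hne hα.continuousOn
          refine ⟨α x0 / 2, half_pos (hα0 x0), fun x hx => ?_⟩
          have := hmin hx
          have h2 := hα0 x0
          simp only [mem_ofPred_eq] at this
          linarith
      have hcl := hA.img {x | α x ≤ r} (isClosed_le hα continuous_const)
      have hy : y ∈ (f '' (A ∩ {x | α x ≤ r}))ᶜ := by
        rintro ⟨x, ⟨hx1, hx2⟩, hx3⟩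
        exact absurd (hrx x ⟨hx1, hx3⟩) (not_lt.2 hx2)
      refine ⟨min r 1, ?_⟩
      filter_upwards [hcl.isOpen_compl.mem_nhds hy] with y' hy'
      refine ⟨lt_min hr one_pos, min_le_right _ _, fun x hx hxy => ?_⟩
      by_contra hcon
      refine hy' ⟨x, ⟨hx, ?_⟩, hxy⟩
      exact (not_le.1 hcon).le.trans (min_le_left _ _))
  obtain ⟨s, s1, s2⟩ := selection hY (g := g) (isOpen_goodPair (E := E) hf hA ε q) β.continuous
    (fun y => (hβ y).1) (fun y Q hQ hLD δ hδ => by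
      obtain ⟨I, hI, hI2⟩ := local_density hE hq (hdf y) (hA.cpt _ isCompact_singleton)
        inter_subset_right hQ hLD hε hδ
      exact ⟨I, hI, hI2⟩)
  have hu : Continuous fun x => s (f x) x := Continuous.eval (s1.comp hf) continuous_id
  obtain ⟨h, h1, h2⟩ := exists_clamp g (r := fun x => min (α x) 1) (hα.min continuous_const)
    (fun x => lt_min (hα0 x) one_pos) (fun x => min_le_right _ _) hu
  refine ⟨h, fun y => ?_, fun x => (h1 x).trans (min_le_left _ _)⟩
  refine GoodPair.congr (s2 y).1 fun x hx hxy => ?_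
  rw [h2 x, hxy]
  obtain ⟨b1, b2, b3⟩ := hβ (f x)
  refine le_trans ?_ (le_min (b3 x hx rfl) b2)
  refine le_trans (BoundedContinuousFunction.dist_coe_le_dist x) ?_
  rw [dist_eq_norm]
  exact (s2 (f x)).2.le

end Good

theorem arith_bound (k m p : ℕ) (hp : 1 ≤ p) :
    k + m < ((max ((k : ℤ) + m - p + 2) 1).toNat + 1 - 1) * p := by
  rw [Nat.add_sub_cancel]
  rcases le_total p (k + m + 1) with h | h
  · have : (max ((k : ℤ) + m - p + 2) 1).toNat = k + m + 1 - p + 1 := by omega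
    rw [this]
    obtain ⟨r, hr⟩ := Nat.exists_eq_add_of_le h
    rw [hr, Nat.add_sub_cancel_left]
    nlinarith
  · have : (max ((k : ℤ) + m - p + 2) 1).toNat = 1 := by omega
    rw [this]
    omega


/-- For a σ-perfect map `f` with `dim f ≤ k` and `dim Y ≤ m` and any
`p ≥ 1`, almost all bounded maps `g : X → ℝ^{p+k}` are such that every fiber of `f × g`
has at most `max (k + m - p + 2) 1` points. -/
theorem statement2 {X Y : Type*} [TopologicalSpace X] [TopologicalSpace.MetrizableSpace X]
    [TopologicalSpace Y] [TopologicalSpace.MetrizableSpace Y]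
    (k m p : ℕ) (hp : 1 ≤ p)
    (f : X → Y) (hf : IsSigmaPerfectMap f)
    (hdimf : DimMapLE f k) (hdimY : CovDimLE Y m) :
    ∃ G : Set (X →ᵇ EuclideanSpace ℝ (Fin (p + k))),
      @Dense _ (sourceLimitation X (EuclideanSpace ℝ (Fin (p + k)))) G ∧
      @IsGδ _ (sourceLimitation X (EuclideanSpace ℝ (Fin (p + k)))) G ∧
      ∀ g ∈ G, ∀ z : Y × EuclideanSpace ℝ (Fin (p + k)),
        ∀ S : Finset X, (∀ x ∈ S, (f x, g x) = z) →
          (S.card : ℤ) ≤ max ((k : ℤ) + m - p + 2) 1 := by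
  let _ := TopologicalSpace.metrizableSpaceMetric X
  obtain ⟨hfc, A, hcov, hA⟩ := hf
  have hPA : ∀ i, PropOn f (A i) := fun i => propOn_of_perfect (hA i).1 (hA i).2.1 (hA i).2.2
  have hPB := PropOn.biUnion hPA
  have hq := arith_bound k m p hp
  generalize hqd : (max ((k : ℤ) + m - p + 2) 1).toNat + 1 = q at hq
  have hE : Module.finrank ℝ (EuclideanSpace ℝ (Fin (p + k))) = p + k := by simp
  let G : ℕ → Set (X →ᵇ EuclideanSpace ℝ (Fin (p + k))) := fun n =>
    {g | ∀ y, (y, g) ∈ GoodPair (EuclideanSpace ℝ (Fin (p + k))) f (⋃ i ∈ Iic n, A i)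
      (1 / ((n : ℝ) + 1)) q}
  have hopen : ∀ n, @IsOpen _ (sourceLimitation X (EuclideanSpace ℝ (Fin (p + k)))) (G n) :=
    fun n => goodMaps_open hfc (hPB n) _ q
  refine ⟨⋂ n, G n, baire_sl G hopen fun n g α hα hα0 => ?_, ?_, ?_⟩
  · exact goodMaps_dense hfc (hPB n) hE hq (fun y => covdim_nat (hdimf y)) (covdim_nat hdimY)
      (by positivity) g α hα hα0
  · exact @IsGδ.iInter_of_isOpen _ _ (sourceLimitation X (EuclideanSpace ℝ (Fin (p + k)))) _ _ hopen
  · intro g hg z S hS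
    by_contra hcon
    have hcard : q ≤ S.card := by omega
    let x : Fin q → X := fun a => (S.equivFin.symm (Fin.castLE hcard a)).1
    have hxS : ∀ a, x a ∈ S := fun a => (S.equivFin.symm (Fin.castLE hcard a)).2
    have hxi : Function.Injective x := fun a b hab =>
      Fin.castLE_injective hcard (S.equivFin.symm.injective (Subtype.ext hab))
    have e1 : ∀ᶠ n : ℕ in Filter.atTop, ∀ a, x a ∈ ⋃ i ∈ Iic n, A i := by
      rw [Filter.eventually_all]
      intro a
      have : x a ∈ ⋃ i, A i := hcov ▸ mem_univ _
      obtain ⟨i, hi⟩ := mem_iUnion.1 this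
      filter_upwards [Filter.eventually_ge_atTop i] with n hn
      exact mem_biUnion (show i ∈ Iic n from hn) hi
    have e2 : ∀ᶠ n : ℕ in Filter.atTop, ∀ a b, a ≠ b → 1 / ((n : ℝ) + 1) ≤ dist (x a) (x b) := by
      rw [Filter.eventually_all]
      intro a
      rw [Filter.eventually_all]
      intro b
      by_cases hab : a = b
      · simp [hab]
      · have hd : 0 < dist (x a) (x b) := dist_pos.2 (hxi.ne hab)
        filter_upwards [(tendsto_one_div_add_atTop_nhds_zero_nat (𝕜 := ℝ)).eventually
          (gt_mem_nhds hd)] with n hn _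
        exact hn.le
    obtain ⟨n, hn1, hn2⟩ := (e1.and e2).exists
    have h1 : ∀ a, f (x a) = z.1 := fun a => congrArg Prod.fst (hS _ (hxS a))
    have h2 : ∀ a, g (x a) = z.2 := fun a => congrArg Prod.snd (hS _ (hxS a))
    exact mem_iInter.1 hg n z.1 ⟨x, fun a => ⟨hn1 a, h1 a⟩, hn2, fun a b => (h2 a).trans (h2 b).symm⟩
end
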